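/- arXiv:1105.2648 — 4 statements merged into one kernel-verified Lean document; each statement's English description precedes it below -/
import Mathlib

section
/- Let ℂ∞ denote the Riemann sphere and let n ≥ 2. For each j = 1,…,n let X_j ⊆ ℂ∞ and Y_j ⊆ ℂ∞ be nonempty open connected sets such that the complement ℂ∞ ∖ X_j is an infinite set (equivalently, nonempty and indiscrete, since ℂ∞ is compact) and the complement ℂ∞ ∖ Y_j contains at least three points. Let F = (F₁,…,Fₙ) : X₁ × ⋯ × Xₙ → Y₁ × ⋯ × Yₙ be a proper holomorphic map all of whose fibers are finite. Then there exist a permutation π of {1,…,n} and holomorphic maps g_i : X_{π(i)} → Y_i such that F_i(z₁,…,zₙ) = g_i(z_{π(i)}) for every i and every (z₁,…,zₙ) in the domain. -/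
open Set OnePoint
open scoped Classical

/-! We model the Riemann sphere `ℂ∞` as the one-point compactification `OnePoint ℂ` of `ℂ`,
and define holomorphy of maps into (and between open subsets of) `OnePoint ℂ` by reading
the maps in the two standard charts: the identity chart on `ℂ` and the inversion chart
at `∞`. -/

/-- Reads a point of the Riemann sphere in the identity chart: `z ↦ z` on `ℂ`
(with junk value `0` at `∞`). -/
noncomputable def spDown : OnePoint ℂ → ℂ := fun z => OnePoint.elim z 0 id

/-- The inversion `z ↦ 1/z` of the Riemann sphere, interchanging `0` and `∞`. -/
noncomputable def spInv : OnePoint ℂ → OnePoint ℂ :=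
  fun z => OnePoint.elim z ((0 : ℂ) : OnePoint ℂ)
    (fun w => if w = 0 then (∞ : OnePoint ℂ) else ((w⁻¹ : ℂ) : OnePoint ℂ))

/-- A map `h` from a complex normed space into the Riemann sphere is holomorphic at `a` if it
is continuous at `a` and, read in the standard chart around the value `h a` (the identity
chart if `h a ≠ ∞`, the inversion chart if `h a = ∞`), it is analytic at `a`. -/
def SphHoloAt {E : Type*} [NormedAddCommGroup E] [NormedSpace ℂ E]
    (h : E → OnePoint ℂ) (a : E) : Prop :=
  ContinuousAt h a ∧
    ((h a ≠ ∞ ∧ AnalyticAt ℂ (fun z => spDown (h z)) a) ∨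
      (h a = ∞ ∧ AnalyticAt ℂ (fun z => spDown (spInv (h z))) a))

/-- Holomorphy on a set, for maps from a complex normed space into the Riemann sphere. -/
def SphHoloOn {E : Type*} [NormedAddCommGroup E] [NormedSpace ℂ E]
    (h : E → OnePoint ℂ) (U : Set E) : Prop :=
  ∀ a ∈ U, SphHoloAt h a

/-- The standard local parametrization of the Riemann sphere at `p`: the identity chart if
`p ≠ ∞` and the inversion chart if `p = ∞`; it maps `sphChartPt p` to `p`. -/
noncomputable def sphChart (p : OnePoint ℂ) : ℂ → OnePoint ℂ :=
  if p = ∞ then (fun z => spInv ((z : ℂ) : OnePoint ℂ)) else (fun z => ((z : ℂ) : OnePoint ℂ))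

/-- The coordinate of `p` in the standard chart at `p`. -/
noncomputable def sphChartPt (p : OnePoint ℂ) : ℂ := if p = ∞ then 0 else spDown p

/-- Holomorphy on a set `U`, for a map of one Riemann-sphere variable: at each `p ∈ U` the
map, read in the standard parametrization at `p`, is holomorphic at the coordinate of `p`. -/
def SphHoloOnS (f : OnePoint ℂ → OnePoint ℂ) (U : Set (OnePoint ℂ)) : Prop :=
  ∀ p ∈ U, SphHoloAt (fun z : ℂ => f (sphChart p z)) (sphChartPt p)

/-- Holomorphy on a set `U`, for a map of several Riemann-sphere variables: at each `p ∈ U`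
the map, read in the product of the standard parametrizations at the coordinates of `p`, is
holomorphic at the coordinates of `p`. -/
def SphHoloOnProd {n : ℕ} (f : (Fin n → OnePoint ℂ) → OnePoint ℂ)
    (U : Set (Fin n → OnePoint ℂ)) : Prop :=
  ∀ p ∈ U, SphHoloAt (fun z : Fin n → ℂ => f (fun i => sphChart (p i) (z i)))
      (fun i => sphChartPt (p i))

namespace SphAux
open Metric Filter Topology


lemma log_ball {f : ℂ → ℂ} {c : ℂ} {r : ℝ} (hr : 0 < r) (hf : DifferentiableOn ℂ f (ball c r))
    (h0 : ∀ z ∈ ball c r, f z ≠ 0) {L : ℂ} (hL : Complex.exp L = f c) :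
    ∃ g : ℂ → ℂ, g c = L ∧ DifferentiableOn ℂ g (ball c r) ∧
      ∀ z ∈ ball c r, Complex.exp (g z) = f z := by
  have hd : DifferentiableOn ℂ (fun z => deriv f z / f z) (ball c r) :=
    (hf.deriv isOpen_ball).div hf h0
  obtain ⟨g, hgc, hg⟩ := hd.isExactOn_ball.with_val_at c L
  refine ⟨g, hgc, fun z hz => (hg z hz).differentiableAt.differentiableWithinAt, ?_⟩
  have hfd : ∀ z ∈ ball c r, HasDerivAt f (deriv f z) z := fun z hz =>
    ((hf z hz).differentiableAt (isOpen_ball.mem_nhds hz)).hasDerivAt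
  have key : ∀ z ∈ ball c r, HasDerivAt (fun z => f z * Complex.exp (-g z)) 0 z := by
    intro z hz
    have := (hfd z hz).mul ((hg z hz).neg.cexp)
    refine HasDerivAt.congr_deriv this ?_
    have h3 := h0 z hz
    have h4 : f z * (Complex.exp (-g z) * -(deriv f z / f z)) = - (deriv f z * Complex.exp (-g z)) := by
      field_simp
    change deriv f z * Complex.exp (-g z) + f z * (Complex.exp (-g z) * -(deriv f z / f z)) = 0
    rw [h4]
    ring
  have hconst : ∀ z ∈ ball c r, f z * Complex.exp (-g z) = f c * Complex.exp (-g c) := by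
    intro z hz
    refine isOpen_ball.is_const_of_deriv_eq_zero (convex_ball c r).isPreconnected
      (fun z hz => (key z hz).differentiableAt.differentiableWithinAt)
      (fun z hz => (key z hz).deriv) hz (mem_ball_self hr)
  intro z hz
  have h := hconst z hz
  rw [hgc, ← hL, ← Complex.exp_add] at h
  simp only [add_neg_cancel, Complex.exp_zero] at h
  rw [Complex.exp_neg] at h
  field_simp at h
  exact h.symm

lemma bloch {f : ℂ → ℂ} {c : ℂ} {r R : ℝ} (hr : 0 < r) (hf : DifferentiableOn ℂ f (ball c r))
    (hR : ∀ w : ℂ, ∃ v ∈ ball w R, ∀ z ∈ ball c r, f z ≠ v) :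
    ‖deriv f c‖ ≤ 128 * R / r := by
  have hRpos : 0 < R := by
    obtain ⟨v, hv, -⟩ := hR 0
    exact pos_of_mem_ball hv
  by_cases hc0 : deriv f c = 0
  · rw [hc0, norm_zero]; positivity
  set s := r / 2 with hs
  have hs0 : 0 < s := by positivity
  have hsub : closedBall c s ⊆ ball c r := closedBall_subset_ball (by linarith)
  have hdf : DifferentiableOn ℂ (deriv f) (ball c r) := hf.deriv isOpen_ball
  have hcont : ContinuousOn (fun z => (s - dist z c) * ‖deriv f z‖) (closedBall c s) := by
    have := (hdf.continuousOn.mono hsub).norm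
    fun_prop
  obtain ⟨a, ha, hamax⟩ := (isCompact_closedBall c s).exists_isMaxOn
    ⟨c, mem_closedBall_self hs0.le⟩ hcont
  have hmax : ∀ z ∈ closedBall c s, (s - dist z c) * ‖deriv f z‖ ≤ (s - dist a c) * ‖deriv f a‖ :=
    fun z hz => hamax hz
  set M := ‖deriv f a‖ with hM
  set t := (s - dist a c) / 2 with ht
  have h1 : s * ‖deriv f c‖ ≤ 2 * t * M := by
    have := hmax c (mem_closedBall_self hs0.le)
    simp only [dist_self, sub_zero] at this
    rw [ht]; linarith
  have hcpos : 0 < ‖deriv f c‖ := norm_pos_iff.mpr hc0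
  have ht0 : 0 ≤ t := by
    have := mem_closedBall.mp ha
    rw [ht]; linarith
  have hM0 : 0 ≤ M := norm_nonneg _
  have hpos : 0 < t * M := by
    have : 0 < s * ‖deriv f c‖ := by positivity
    nlinarith
  have htp : 0 < t := by
    rcases ht0.eq_or_lt with h | h
    · rw [← h] at hpos; simp at hpos
    · exact h
  have hMp : 0 < M := by
    rcases hM0.eq_or_lt with h | h
    · rw [← h] at hpos; simp at hpos
    · exact h
  have hin : ∀ z ∈ ball a t, t ≤ s - dist z c := by
    intro z hz
    have h2 := dist_triangle z a c
    have h3 := mem_ball.mp hz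
    have : dist a c = s - 2 * t := by rw [ht]; ring
    linarith
  have hballs : ball a t ⊆ closedBall c s := by
    intro z hz
    have := hin z hz
    rw [mem_closedBall]; linarith
  have hder : ∀ z ∈ ball a t, ‖deriv f z‖ ≤ 2 * M := by
    intro z hz
    have h2 := hmax z (hballs hz)
    have h3 := hin z hz
    have h4 : s - dist a c = 2 * t := by rw [ht]; ring
    rw [h4] at h2
    have h5 : t * ‖deriv f z‖ ≤ (s - dist z c) * ‖deriv f z‖ := by gcongr
    have h6 : t * ‖deriv f z‖ ≤ t * (2 * M) := by linarith
    exact le_of_mul_le_mul_left h6 htp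
  have hsch : ∀ z ∈ ball a t, dist (deriv f z) (deriv f a) ≤ 4 * M / t * dist z a := by
    intro z hz
    refine Complex.dist_le_div_mul_dist_of_mapsTo_ball (hdf.mono (hballs.trans hsub)) ?_ hz
    intro w hw
    have := hder w hw
    rw [mem_closedBall, dist_eq_norm]
    have h2 := norm_sub_le (deriv f w) (deriv f a)
    linarith
  set ρ := t / 8 with hρ
  have hρ0 : 0 < ρ := by positivity
  have hρt : closedBall a ρ ⊆ ball a t := closedBall_subset_ball (by linarith)
  have hfd : ∀ z ∈ ball a t, HasDerivAt f (deriv f z) z := fun z hz =>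
    ((hf z (hsub (hballs hz))).differentiableAt
      (isOpen_ball.mem_nhds (hsub (hballs hz)))).hasDerivAt
  have hmv : ∀ z ∈ closedBall a ρ,
      ‖(f z - deriv f a * z) - (f a - deriv f a * a)‖ ≤ M / 2 * ‖z - a‖ := by
    intro z hz
    refine (convex_closedBall a ρ).norm_image_sub_le_of_norm_hasDerivWithin_le
      (f := fun z => f z - deriv f a * z) (f' := fun z => deriv f z - deriv f a) ?_ ?_
      (mem_closedBall_self hρ0.le) hz
    · intro w hw
      have := (hfd w (hρt hw)).sub ((hasDerivAt_id w).const_mul (deriv f a))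
      simp only [mul_one] at this
      exact this.hasDerivWithinAt
    · intro w hw
      have h2 := hsch w (hρt hw)
      rw [dist_eq_norm] at h2
      refine h2.trans ?_
      have h3 := mem_closedBall.mp hw
      calc 4 * M / t * dist w a ≤ 4 * M / t * (t / 8) := by gcongr
        _ = M / 2 := by field_simp; ring
  have hsph : ∀ z ∈ sphere a ρ, M * ρ / 2 ≤ ‖f z - f a‖ := by
    intro z hz
    have h2 := hmv z (sphere_subset_closedBall hz)
    have h3 : ‖z - a‖ = ρ := by rw [← dist_eq_norm]; exact hz
    rw [h3] at h2
    have h4 : ‖deriv f a * (z - a)‖ = M * ρ := by rw [norm_mul, h3]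
    have h5 : deriv f a * (z - a) = (f z - f a) -
      ((f z - deriv f a * z) - (f a - deriv f a * a)) := by ring
    rw [h5] at h4
    have := norm_sub_le (f z - f a) ((f z - deriv f a * z) - (f a - deriv f a * a))
    linarith
  have hdc : DiffContOnCl ℂ f (ball a ρ) := by
    apply DifferentiableOn.diffContOnCl
    rw [closure_ball _ hρ0.ne']
    exact hf.mono (hρt.trans (hballs.trans hsub))
  have hfreq : ∃ᶠ z in 𝓝 a, f z ≠ f a := by
    intro hcon
    have : f =ᶠ[𝓝 a] fun _ => f a := by
      filter_upwards [hcon] with z hz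
      simpa using hz
    have h2 := this.deriv_eq
    simp at h2
    rw [hM, h2] at hMp
    simp at hMp
  have himg := hdc.ball_subset_image_closedBall hρ0 hsph hfreq
  obtain ⟨v, hv, hvn⟩ := hR (f a)
  have hle : M * ρ / 2 / 2 ≤ R := by
    by_contra hlt
    push Not at hlt
    obtain ⟨z, hz, hzv⟩ := himg (ball_subset_ball hlt.le hv)
    exact hvn z (hsub (hballs (hρt hz))) hzv
  rw [le_div_iff₀ hr]
  have : M * t ≤ 32 * R := by rw [hρ] at hle; linarith
  have : s = r / 2 := hs
  nlinarith

lemma net (w : ℂ) : ∃ v ∈ ball w 5, ∃ n : ℤ, Complex.cosh v ^ 2 = n := by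
  have hreal : ∀ x : ℝ, 0 ≤ x → ∃ y : ℝ, x ≤ y ∧ y ≤ x + 1 ∧ ∃ n : ℤ, Real.cosh y ^ 2 = n := by
    intro x hx
    have hmem : ((⌈Real.cosh x ^ 2⌉ : ℤ) : ℝ) ∈ Icc (Real.cosh x ^ 2) (Real.cosh (x + 1) ^ 2) := by
      refine ⟨Int.le_ceil _, ?_⟩
      have h1 := (Int.ceil_lt_add_one (Real.cosh x ^ 2)).le
      refine h1.trans ?_
      rw [Real.cosh_add]
      have h2 : 1 ≤ Real.sinh 1 := Real.self_le_sinh_iff.mpr zero_le_one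
      have h3 : 0 ≤ Real.sinh x := Real.sinh_nonneg_iff.mpr hx
      have h4 := Real.one_le_cosh x
      have h5 := Real.one_le_cosh 1
      have h6 := Real.cosh_sq 1
      have h7 : Real.cosh x * Real.cosh 1 ≤ Real.cosh x * Real.cosh 1 + Real.sinh x * Real.sinh 1 := by
        have : 0 ≤ Real.sinh x * Real.sinh 1 := by positivity
        linarith
      have h8 : (Real.cosh x * Real.cosh 1) ^ 2 ≤
          (Real.cosh x * Real.cosh 1 + Real.sinh x * Real.sinh 1) ^ 2 := by
        gcongr
      refine le_trans ?_ h8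
      rw [mul_pow, h6]
      have h9 : 1 ≤ Real.cosh x ^ 2 := one_le_pow₀ h4
      have h10 : 1 ≤ Real.sinh 1 ^ 2 := one_le_pow₀ h2
      nlinarith
    obtain ⟨y, hy, hyn⟩ := intermediate_value_Icc (f := fun y => Real.cosh y ^ 2)
      (by linarith : x ≤ x + 1) ((Real.continuous_cosh.pow 2).continuousOn) hmem
    exact ⟨y, hy.1, hy.2, _, hyn⟩
  obtain ⟨x, hx1, n, hxn⟩ : ∃ x : ℝ, |x - w.re| ≤ 1 ∧ ∃ n : ℤ, Real.cosh x ^ 2 = n := by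
    rcases le_total 0 w.re with h | h
    · obtain ⟨y, h1, h2, n, hn⟩ := hreal _ h
      exact ⟨y, abs_le.mpr ⟨by linarith, by linarith⟩, n, hn⟩
    · obtain ⟨y, h1, h2, n, hn⟩ := hreal (-w.re) (by linarith)
      exact ⟨-y, abs_le.mpr ⟨by linarith, by linarith⟩, n, by rw [Real.cosh_neg]; exact hn⟩
  set m : ℤ := ⌊w.im / Real.pi⌋ with hm
  refine ⟨⟨x, m * Real.pi⟩, ?_, n, ?_⟩
  · rw [mem_ball, dist_eq_norm]
    refine (Complex.norm_le_abs_re_add_abs_im _).trans_lt ?_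
    simp only [Complex.sub_re, Complex.sub_im]
    have h1 := Int.floor_le (w.im / Real.pi)
    have h2 := Int.lt_floor_add_one (w.im / Real.pi)
    rw [le_div_iff₀ Real.pi_pos] at h1
    rw [div_lt_iff₀ Real.pi_pos] at h2
    have h3 : |(m : ℝ) * Real.pi - w.im| ≤ Real.pi := by
      rw [abs_le]; constructor <;> nlinarith
    have := Real.pi_lt_four
    linarith
  · have hv : (⟨x, m * Real.pi⟩ : ℂ) = (x : ℂ) + (m : ℂ) * Real.pi * Complex.I := by
      apply Complex.ext <;> simp
    rw [hv]
    have hs : Complex.sinh ((m : ℂ) * Real.pi * Complex.I) = 0 := by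
      rw [Complex.sinh_mul_I, Complex.sin_int_mul_pi, zero_mul]
    have hcs := Complex.cosh_sq ((m : ℂ) * Real.pi * Complex.I)
    rw [Complex.cosh_add, hs, mul_zero, add_zero, mul_pow, hcs, hs]
    have := congrArg (fun r : ℝ => (r : ℂ)) hxn
    simp only [Complex.ofReal_pow, Complex.ofReal_cosh, Complex.ofReal_intCast] at this
    rw [this]; ring

lemma landau {f : ℂ → ℂ} {c : ℂ} {r : ℝ} (hr : 0 < r) (hf : DifferentiableOn ℂ f (ball c r))
    (h0 : ∀ z ∈ ball c r, f z ≠ 0) (h1 : ∀ z ∈ ball c r, f z ≠ 1) :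
    ‖deriv f c‖ ≤ 1280 / r * (‖f c‖ * (|Real.log ‖f c‖| + 2 * Real.pi)) := by
  have hcm : c ∈ ball c r := mem_ball_self hr
  obtain ⟨l, hlc, hld, hl⟩ := log_ball hr hf h0 (Complex.exp_log (h0 c hcm))
  have hpi : (2 * Real.pi * Complex.I : ℂ) ≠ 0 := Complex.two_pi_I_ne_zero
  set a : ℂ → ℂ := fun z => l z / (2 * Real.pi * Complex.I) with ha
  have had : DifferentiableOn ℂ a (ball c r) := hld.div_const _
  have hla : ∀ z, l z = a z * (2 * Real.pi * Complex.I) := fun z => by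
    simp only [ha]; field_simp
  have hint : ∀ z ∈ ball c r, ∀ n : ℤ, a z ≠ n := by
    intro z hz n hn
    apply h1 z hz
    rw [← hl z hz, hla, hn]
    exact Complex.exp_int_mul_two_pi_mul_I n
  have ha0 : ∀ z ∈ ball c r, a z ≠ 0 := fun z hz => by simpa using hint z hz 0
  have ha1 : ∀ z ∈ ball c r, a z - 1 ≠ 0 := fun z hz => by
    have := hint z hz 1
    simpa [sub_eq_zero] using this
  obtain ⟨p, -, hpd, hp⟩ := log_ball hr had ha0 (Complex.exp_log (ha0 c hcm))
  obtain ⟨q, -, hqd, hq⟩ := log_ball hr (had.sub_const 1) ha1 (Complex.exp_log (ha1 c hcm))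
  set P : ℂ → ℂ := fun z => Complex.exp (p z / 2) with hP
  set Q : ℂ → ℂ := fun z => Complex.exp (q z / 2) with hQ
  have hP2 : ∀ z ∈ ball c r, P z ^ 2 = a z := fun z hz => by
    rw [← hp z hz, hP, ← Complex.exp_nat_mul]; congr 1; push_cast; ring
  have hQ2 : ∀ z ∈ ball c r, Q z ^ 2 = a z - 1 := fun z hz => by
    rw [← hq z hz, hQ, ← Complex.exp_nat_mul]; congr 1; push_cast; ring
  have hPQ : ∀ z ∈ ball c r, (P z - Q z) * (P z + Q z) = 1 := fun z hz => by
    linear_combination hP2 z hz - hQ2 z hz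
  have hPd : DifferentiableOn ℂ P (ball c r) := (hpd.div_const 2).cexp
  have hQd : DifferentiableOn ℂ Q (ball c r) := (hqd.div_const 2).cexp
  have hu0 : ∀ z ∈ ball c r, P z - Q z ≠ 0 := fun z hz => left_ne_zero_of_mul_eq_one (hPQ z hz)
  obtain ⟨g, -, hgd, hg⟩ := log_ball (f := fun z => P z - Q z) hr (hPd.sub hQd) hu0
    (Complex.exp_log (hu0 c hcm))
  have hgn : ∀ z ∈ ball c r, Complex.exp (-g z) = P z + Q z := fun z hz => by
    rw [Complex.exp_neg, hg z hz]
    exact inv_eq_of_mul_eq_one_right (hPQ z hz)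
  have hch : ∀ z ∈ ball c r, Complex.cosh (g z) = P z := fun z hz => by
    rw [Complex.cosh, hg z hz, hgn z hz]; ring
  have hsh : ∀ z ∈ ball c r, Complex.sinh (g z) = -Q z := fun z hz => by
    rw [Complex.sinh, hg z hz, hgn z hz]; ring
  have hbl : ‖deriv g c‖ ≤ 128 * 5 / r := by
    refine bloch hr hgd fun w => ?_
    obtain ⟨v, hv, n, hn⟩ := net w
    refine ⟨v, hv, fun z hz hzv => hint z hz n ?_⟩
    rw [← hP2 z hz, ← hch z hz, hzv, hn]
  have hgc : HasDerivAt g (deriv g c) c :=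
    ((hgd c hcm).differentiableAt (isOpen_ball.mem_nhds hcm)).hasDerivAt
  have hfeq : f =ᶠ[𝓝 c] fun z => Complex.exp (Complex.cosh (g z) ^ 2 * (2 * Real.pi * Complex.I)) := by
    filter_upwards [isOpen_ball.mem_nhds hcm] with z hz
    rw [← hl z hz, hla, ← hP2 z hz, ← hch z hz]
  have hderiv : deriv f c = f c * ((2 * Complex.cosh (g c) * (Complex.sinh (g c) * deriv g c)) *
      (2 * Real.pi * Complex.I)) := by
    rw [hfeq.deriv_eq, hfeq.eq_of_nhds]
    have := (((hgc.ccosh).pow 2).mul_const (2 * Real.pi * Complex.I)).cexp.deriv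
    simpa using this
  have hnp : ‖P c‖ ^ 2 = ‖a c‖ := by rw [← norm_pow, hP2 c hcm]
  have hnq : ‖Q c‖ ^ 2 ≤ ‖a c‖ + 1 := by
    rw [← norm_pow, hQ2 c hcm]
    exact (norm_sub_le _ _).trans (by simp)
  have hnpi : ‖(2 * Real.pi * Complex.I : ℂ)‖ = 2 * Real.pi := by
    simp [abs_of_pos Real.pi_pos]
  have hac : 2 * Real.pi * ‖a c‖ ≤ |Real.log ‖f c‖| + Real.pi := by
    have h2 : ‖l c‖ = ‖a c‖ * (2 * Real.pi) := by rw [hla, norm_mul, hnpi]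
    have h3 : ‖l c‖ ≤ |Real.log ‖f c‖| + Real.pi := by
      rw [hlc]
      refine (Complex.norm_le_abs_re_add_abs_im _).trans ?_
      rw [Complex.log_re, Complex.log_im]
      have := Complex.abs_arg_le_pi (f c)
      linarith
    linarith
  rw [hderiv, hch c hcm, hsh c hcm]
  simp only [norm_mul, norm_neg, hnpi]
  rw [show ‖(2 : ℂ)‖ = 2 by simp]
  have hPQn : 2 * (‖P c‖ * ‖Q c‖) ≤ 2 * ‖a c‖ + 1 := by nlinarith [sq_nonneg (‖P c‖ - ‖Q c‖)]
  calc ‖f c‖ * (2 * ‖P c‖ * (‖Q c‖ * ‖deriv g c‖) * (2 * Real.pi))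
      = ‖f c‖ * ((2 * (‖P c‖ * ‖Q c‖)) * (2 * Real.pi)) * ‖deriv g c‖ := by ring
    _ ≤ ‖f c‖ * ((2 * ‖a c‖ + 1) * (2 * Real.pi)) * (128 * 5 / r) := by
        have := Real.pi_pos
        gcongr
    _ ≤ ‖f c‖ * (2 * (|Real.log ‖f c‖| + 2 * Real.pi)) * (128 * 5 / r) := by
        have h5 : (2 * ‖a c‖ + 1) * (2 * Real.pi) ≤ 2 * (|Real.log ‖f c‖| + 2 * Real.pi) := by
          linarith
        gcongr
    _ = _ := by ring


lemma rado_max {f g : ℂ → ℂ} (hfc : Continuous f) (hfd : ∀ z, f z ≠ 0 → DifferentiableAt ℂ f z)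
    {c : ℂ} {r C : ℝ} (hC : 0 < C)
    (hgd : DifferentiableOn ℂ g ({z | f z ≠ 0} ∩ ball c r))
    (hgc : ContinuousOn g (closure ({z | f z ≠ 0} ∩ ball c r)))
    (hb : ∀ z ∈ closure ({z | f z ≠ 0} ∩ ball c r), z ∈ sphere c r → ‖g z‖ ≤ C)
    {z : ℂ} (hz : f z ≠ 0) (hzb : z ∈ ball c r) : ‖g z‖ ≤ C := by
  set U := {z | f z ≠ 0} ∩ ball c r with hU
  have hUo : IsOpen U := (isOpen_ne_fun hfc continuous_const).inter isOpen_ball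
  have hUcl : closure U ⊆ closedBall c r :=
    (closure_mono inter_subset_right).trans closure_ball_subset_closedBall
  obtain ⟨M, hM⟩ := (isCompact_closedBall c r).exists_bound_of_continuousOn hfc.continuousOn
  have hM0 : 0 ≤ M := (norm_nonneg _).trans (hM z (ball_subset_closedBall hzb))
  have key : ∀ N : ℕ, ‖g z‖ ^ N * ‖f z‖ ≤ C ^ N * M := by
    intro N
    have hd : DiffContOnCl ℂ (fun z => g z ^ N * f z) U := by
      refine ⟨(hgd.pow N).mul fun z hz => (hfd z hz.1).differentiableWithinAt, ?_⟩
      exact (hgc.pow N).mul hfc.continuousOn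
    have := Complex.norm_le_of_forall_mem_frontier_norm_le (f := fun z => g z ^ N * f z) (U := U)
      (isBounded_ball.subset inter_subset_right) hd (C := C ^ N * M) (z := z) ?_
      (subset_closure ⟨hz, hzb⟩)
    · simpa [norm_mul, norm_pow] using this
    · intro w hw
      rw [frontier, hUo.interior_eq] at hw
      by_cases hw0 : f w = 0
      · simp only [hw0, mul_zero, norm_zero]; positivity
      · have hws : w ∈ sphere c r := by
          have h1 := hUcl hw.1
          have h2 : w ∉ ball c r := fun h => hw.2 ⟨hw0, h⟩
          rw [mem_closedBall] at h1
          rw [mem_ball, not_lt] at h2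
          exact le_antisymm h1 h2
        rw [norm_mul, norm_pow]
        have h3 := hb w hw.1 hws
        have h4 := hM w (hUcl hw.1)
        gcongr
  by_contra hlt
  push Not at hlt
  have h1 : 1 < ‖g z‖ / C := by rwa [one_lt_div hC]
  obtain ⟨N, hN⟩ := ((tendsto_pow_atTop_atTop_of_one_lt h1).eventually_gt_atTop (M / ‖f z‖)).exists
  have hfz : 0 < ‖f z‖ := norm_pos_iff.mpr hz
  rw [div_pow, div_lt_div_iff₀ hfz (by positivity)] at hN
  have := key N
  linarith

lemma rado_dense {f : ℂ → ℂ} (hfc : Continuous f) (hfd : ∀ z, f z ≠ 0 → DifferentiableAt ℂ f z)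
    (hne : ∃ z, f z ≠ 0) : Dense {z | f z ≠ 0} := by
  intro b
  by_contra hb
  set Ω := {z | f z ≠ 0} with hΩ
  obtain ⟨z0, hz0⟩ := hne
  have hΩne : Ω.Nonempty := ⟨z0, hz0⟩
  have hpos : 0 < infDist b Ω := by
    rw [← infDist_closure]
    exact (isClosed_closure.notMem_iff_infDist_pos hΩne.closure).mp hb
  set ρ := infDist b Ω with hρ
  obtain ⟨α, hα, hαd⟩ := (infDist_lt_iff hΩne).mp (show infDist b Ω < 2 * ρ by linarith)
  have hnb : ∀ z ∈ closure Ω, z - b ≠ 0 := fun z hz h => hb (by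
    rw [sub_eq_zero] at h; rwa [← h])
  have := rado_max (g := fun z => (z - b)⁻¹) hfc hfd (c := b) (r := 2 * ρ) (C := (2 * ρ)⁻¹)
    (by positivity) ?_ ?_ ?_ (z := α) hα (by rw [mem_ball, dist_comm]; exact hαd)
  · rw [norm_inv, ← dist_eq_norm, dist_comm] at this
    have hd : 0 < dist b α := by
      rw [dist_comm, dist_eq_norm]; exact norm_pos_iff.mpr (hnb α (subset_closure hα))
    rw [inv_le_inv₀ hd (by positivity)] at this
    linarith
  · intro z hz
    have := hnb z (subset_closure hz.1)
    exact ((differentiableAt_id.sub_const b).inv this).differentiableWithinAt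
  · intro z hz
    have := hnb z (closure_mono inter_subset_left hz)
    exact ((continuousAt_id.sub continuousAt_const).inv₀ this).continuousWithinAt
  · intro z hz hzs
    rw [norm_inv, ← dist_eq_norm, mem_sphere.mp hzs]

lemma trig_approx {F : ℂ → ℂ} (hF : Continuous F) (c : ℂ) {r : ℝ} (hr : 0 < r) {ε : ℝ}
    (hε : 0 < ε) : ∃ q : ℂ → ℂ, Differentiable ℂ q ∧
      ∀ z ∈ sphere c r, |(F z - q z).re| ≤ ε := by
  let φ : C(AddCircle (1 : ℝ), ℂ) :=
    ⟨fun x => F (c + r * (AddCircle.toCircle x : ℂ)), by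
      have := @AddCircle.continuous_toCircle 1
      fun_prop⟩
  have hspan : ∀ ψ ∈ Submodule.span ℂ (range (@fourier (1 : ℝ))), ∃ q : ℂ → ℂ,
      Differentiable ℂ q ∧ ∀ x : AddCircle (1 : ℝ),
        (ψ x).re = (q (c + r * (AddCircle.toCircle x : ℂ))).re := by
    intro ψ hψ
    suffices H : ∀ a : ℂ, ∃ q : ℂ → ℂ,
      Differentiable ℂ q ∧ ∀ x : AddCircle (1 : ℝ),
        (a * ψ x).re = (q (c + r * (AddCircle.toCircle x : ℂ))).re by simpa using H 1
    have hrC : (r : ℂ) ≠ 0 := by exact_mod_cast hr.ne'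
    induction hψ using Submodule.span_induction with
    | mem ψ hψ =>
      obtain ⟨n, rfl⟩ := hψ
      intro a
      have hpow : ∀ m : ℕ, ∀ x : AddCircle (1 : ℝ),
          fourier (m : ℤ) x = ((c + r * (AddCircle.toCircle x : ℂ) - c) / r) ^ m := by
        intro m x
        rw [fourier_apply, AddCircle.toCircle_zsmul]
        simp [hrC]
      rcases Int.eq_nat_or_neg n with ⟨m, rfl | rfl⟩
      · refine ⟨fun z => a * ((z - c) / r) ^ m, by fun_prop, fun x => ?_⟩
        rw [hpow]
      · refine ⟨fun z => (starRingEnd ℂ) a * ((z - c) / r) ^ m, by fun_prop, fun x => ?_⟩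
        rw [fourier_neg]
        change _ = ((starRingEnd ℂ) a * ((c + r * (AddCircle.toCircle x : ℂ) - c) / r) ^ m).re
        rw [← hpow]
        simp [Complex.mul_re]
    | zero => intro a; exact ⟨fun _ => 0, by fun_prop, by simp⟩
    | add ψ₁ ψ₂ _ _ h1 h2 =>
      intro a
      obtain ⟨q1, d1, e1⟩ := h1 a
      obtain ⟨q2, d2, e2⟩ := h2 a
      refine ⟨fun z => q1 z + q2 z, by fun_prop, fun x => ?_⟩
      rw [Complex.add_re, ← e1, ← e2, ← Complex.add_re, ← mul_add]; rfl
    | smul b ψ _ h =>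
      intro a
      obtain ⟨q, d, e⟩ := h (a * b)
      refine ⟨q, d, fun x => ?_⟩
      rw [← e, mul_assoc]; rfl
  have hmem : φ ∈ (Submodule.span ℂ (range (@fourier (1 : ℝ)))).topologicalClosure := by
    rw [span_fourier_closure_eq_top]; trivial
  obtain ⟨ψ, hψ, hd⟩ := Metric.mem_closure_iff.mp hmem ε hε
  obtain ⟨q, hq, hqe⟩ := hspan ψ hψ
  refine ⟨q, hq, fun z hz => ?_⟩
  have hrC : (r : ℂ) ≠ 0 := by exact_mod_cast hr.ne'
  have hu : (z - c) / r ∈ Submonoid.unitSphere ℂ := by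
    change _ ∈ sphere (0 : ℂ) 1
    rw [mem_sphere_zero_iff_norm]
    rw [mem_sphere, dist_eq_norm] at hz
    rw [norm_div, hz]; simp [abs_of_pos hr, hr.ne']
  obtain ⟨x, hx⟩ := (AddCircle.homeomorphCircle (one_ne_zero (α := ℝ))).surjective ⟨(z - c) / r, hu⟩
  rw [AddCircle.homeomorphCircle_apply] at hx
  have hxz : c + r * (AddCircle.toCircle x : ℂ) = z := by
    rw [hx]
    change c + r * ((z - c) / r) = z
    field_simp; ring
  have h1 : dist (φ x) (ψ x) ≤ ε := (ContinuousMap.dist_apply_le_dist x).trans hd.le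
  rw [dist_eq_norm] at h1
  have h2 := (Complex.abs_re_le_norm _).trans h1
  have h3 := hqe x
  rw [hxz] at h3
  have h4 : φ x = F z := by change F (c + r * (AddCircle.toCircle x : ℂ)) = F z; rw [hxz]
  rw [h4, Complex.sub_re, h3, ← Complex.sub_re] at h2
  exact h2

lemma rado_mean {f F : ℂ → ℂ} (hfc : Continuous f) (hfd : ∀ z, f z ≠ 0 → DifferentiableAt ℂ f z)
    (hne : ∃ z, f z ≠ 0) (hFc : Continuous F) (hFd : ∀ z, f z ≠ 0 → DifferentiableAt ℂ F z)
    (c : ℂ) {r : ℝ} (hr : 0 < r) : Real.circleAverage F c r = F c := by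
  have hdense := rado_dense hfc hfd hne
  have key : ∀ F : ℂ → ℂ, Continuous F → (∀ z, f z ≠ 0 → DifferentiableAt ℂ F z) →
      (Real.circleAverage F c r).re = (F c).re := by
    intro F hFc hFd
    suffices H : ∀ ε > 0, |(Real.circleAverage F c r).re - (F c).re| ≤ ε by
      have := le_of_forall_pos_le_add (a := |(Real.circleAverage F c r).re - (F c).re|) (b := 0)
        (fun ε hε => by simpa using H ε hε)
      exact sub_eq_zero.mp (abs_nonpos_iff.mp this)
    intro ε hε
    obtain ⟨q, hq, hqs⟩ := trig_approx hFc c hr (half_pos hε)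
    have hqc := hq.continuous
    have hG : ∀ s : ℂ, (s = 1 ∨ s = -1) → ∀ z ∈ ball c r, (s * (F z - q z)).re ≤ ε / 2 := by
      intro s hs
      have hcl : ball c r ⊆ closure (ball c r ∩ {z | f z ≠ 0}) :=
        hdense.open_subset_closure_inter isOpen_ball
      have hclosed : IsClosed {z | (s * (F z - q z)).re ≤ ε / 2} :=
        isClosed_le (by fun_prop) continuous_const
      refine hcl.trans (closure_minimal ?_ hclosed)
      rintro z ⟨hzb, hz⟩
      have := rado_max (g := fun z => Complex.exp (s * (F z - q z))) hfc hfd (c := c) (r := r)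
        (C := Real.exp (ε / 2)) (Real.exp_pos _) ?_ ?_ ?_ hz hzb
      · rw [Complex.norm_exp, Real.exp_le_exp] at this
        exact this
      · intro w hw
        exact ((((hFd w hw.1).sub (hq w)).const_mul s).cexp).differentiableWithinAt
      · fun_prop
      · intro w _ hw
        rw [Complex.norm_exp, Real.exp_le_exp]
        have := hqs w hw
        rw [abs_le] at this
        rcases hs with rfl | rfl
        · simpa using this.2
        · have h1 := this.1
          rw [neg_one_mul, Complex.neg_re]; linarith
    have hc : |(F c - q c).re| ≤ ε / 2 := by
      have h1 := hG 1 (Or.inl rfl) c (mem_ball_self hr)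
      have h2 := hG (-1) (Or.inr rfl) c (mem_ball_self hr)
      rw [one_mul] at h1
      rw [neg_one_mul, Complex.neg_re] at h2
      rw [abs_le]; constructor <;> linarith
    have hqa : Real.circleAverage q c r = q c := hq.diffContOnCl.circleAverage
    have hci : ∀ G : ℂ → ℂ, Continuous G → CircleIntegrable G c r := fun G hG =>
      hG.continuousOn.circleIntegrable hr.le
    have hsub : Real.circleAverage (F - q) c r = Real.circleAverage F c r - q c := by
      rw [Real.circleAverage_sub (hci F hFc) (hci q hqc), hqa]
    have hre : (Real.circleAverage (F - q) c r).re =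
        Real.circleAverage (fun z => (F z - q z).re) c r := by
      have := Complex.reCLM.circleAverage_comp_comm (hci (F - q) (hFc.sub hqc))
      exact this.symm
    have hrei : CircleIntegrable (fun z => (F z - q z).re) c r :=
      ContinuousOn.circleIntegrable hr.le (by fun_prop)
    have havg : |Real.circleAverage (fun z => (F z - q z).re) c r| ≤ ε / 2 := by
      refine Real.abs_circleAverage_le_circleAverage_abs.trans ?_
      refine Real.circleAverage_mono_on_of_le_circle hrei.abs ?_
      intro x hx
      rw [abs_of_pos hr] at hx
      exact hqs x hx
    rw [← hre, hsub] at havg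
    rw [Complex.sub_re] at havg hc
    rw [abs_le] at *
    constructor <;> linarith
  apply Complex.ext (key F hFc hFd)
  have h := key (fun z => -Complex.I * F z) (by fun_prop) (fun z hz => (hFd z hz).const_mul _)
  have h2 : Real.circleAverage (fun z => -Complex.I * F z) c r
      = -Complex.I * Real.circleAverage F c r := by
    change Real.circleAverage ((-Complex.I) • F) c r = _
    rw [Real.circleAverage_smul]; rfl
  rw [h2] at h
  simpa using h

lemma rado {f : ℂ → ℂ} (hfc : Continuous f) (hfd : ∀ z, f z ≠ 0 → DifferentiableAt ℂ f z)
    (hne : ∃ z, f z ≠ 0) : Differentiable ℂ f := by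
  intro a
  have hci : CircleIntegrable f a ((1 : NNReal) : ℝ) := hfc.continuousOn.circleIntegrable (by simp)
  have hps := hasFPowerSeriesOn_cauchy_integral hci one_pos
  set G : ℂ → ℂ := fun w => (2 * Real.pi * Complex.I : ℂ)⁻¹ •
    ∮ z in C(a, ((1 : NNReal) : ℝ)), (z - w)⁻¹ • f z with hG
  have hGd : DifferentiableOn ℂ G (ball a 1) := by
    have := hps.differentiableOn
    have e : Metric.eball a ((1 : NNReal) : ENNReal) = ball a 1 := by
      ext z; simp [edist_dist, Metric.eball]
    rw [e] at this
    exact this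
  have hcl : ball a 1 ⊆ closure (ball a 1 ∩ {z | f z ≠ 0}) :=
    (rado_dense hfc hfd hne).open_subset_closure_inter isOpen_ball
  have heq : EqOn f G (ball a 1 ∩ {z | f z ≠ 0}) := by
    rintro w ⟨hwb, hw⟩
    have hdc : Continuous (dslope f w) := by
      rw [← continuousOn_univ, continuousOn_dslope univ_mem]
      exact ⟨hfc.continuousOn, hfd w hw⟩
    have hdd : ∀ z, f z ≠ 0 → DifferentiableAt ℂ (dslope f w) z := by
      have hopen : IsOpen {z | f z ≠ 0} := isOpen_ne_fun hfc continuous_const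
      have : DifferentiableOn ℂ (dslope f w) {z | f z ≠ 0} := by
        rw [Complex.differentiableOn_dslope (hopen.mem_nhds hw)]
        exact fun z hz => (hfd z hz).differentiableWithinAt
      intro z hz
      exact (this z hz).differentiableAt (hopen.mem_nhds hz)
    have hm := rado_mean (F := fun z => (z - a) * dslope f w z) hfc hfd hne (by fun_prop)
      (fun z hz => (differentiableAt_id.sub_const a).mul (hdd z hz)) a one_pos
    rw [Real.circleAverage_eq_circleIntegral one_ne_zero] at hm
    simp only [sub_self, zero_mul] at hm
    rw [smul_eq_zero_iff_right (inv_ne_zero Complex.two_pi_I_ne_zero)] at hm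
    have hcong : (∮ z in C(a, 1), (z - a)⁻¹ • ((z - a) * dslope f w z)) =
        ∮ z in C(a, 1), ((z - w)⁻¹ • f z - (z - w)⁻¹ • f w) := by
      apply circleIntegral.integral_congr zero_le_one
      intro z hz
      have hza : z - a ≠ 0 := by
        intro h
        rw [mem_sphere, dist_eq_norm, h] at hz
        simp at hz
      have hzw : z ≠ w := by
        rintro rfl
        exact (mem_ball.mp hwb).ne hz
      change (z - a)⁻¹ • ((z - a) * dslope f w z) = (z - w)⁻¹ • f z - (z - w)⁻¹ • f w
      rw [dslope_of_ne _ hzw, slope_def_module]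
      simp only [smul_eq_mul]
      field_simp
    have hzw0 : ∀ z ∈ sphere a 1, z - w ≠ 0 := by
      intro z hz h
      rw [sub_eq_zero] at h
      subst h
      exact (mem_ball.mp hwb).ne hz
    have hinv : ContinuousOn (fun z => (z - w)⁻¹) (sphere a 1) :=
      ContinuousOn.inv₀ (by fun_prop) hzw0
    have hI1 : CircleIntegrable (fun z => (z - w)⁻¹ • f z) a 1 :=
      (hinv.smul hfc.continuousOn).circleIntegrable zero_le_one
    have hI2 : CircleIntegrable (fun z => (z - w)⁻¹ • f w) a 1 :=
      (hinv.smul continuousOn_const).circleIntegrable zero_le_one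
    rw [hcong, circleIntegral.integral_sub hI1 hI2,
      circleIntegral.integral_smul_const, circleIntegral.integral_sub_inv_of_mem_ball hwb,
      sub_eq_zero] at hm
    simp only [hG, NNReal.coe_one]
    rw [hm, smul_smul, inv_mul_cancel₀ Complex.two_pi_I_ne_zero, one_smul]
  have heq2 : EqOn f G (ball a 1) :=
    heq.of_subset_closure hfc.continuousOn hGd.continuousOn inter_subset_left hcl
  have : DifferentiableOn ℂ f (ball a 1) := hGd.congr heq2
  exact (this a (mem_ball_self one_pos)).differentiableAt (isOpen_ball.mem_nhds (mem_ball_self one_pos))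

lemma rado_zero {f : ℂ → ℂ} (hfc : Continuous f) (hfd : ∀ z, f z ≠ 0 → DifferentiableAt ℂ f z)
    {ζ : ℂ} (hacc : ∃ᶠ z in 𝓝[≠] ζ, f z = 0) : ∀ z, f z = 0 := by
  by_contra hne
  push Not at hne
  have hd := rado hfc hfd hne
  have ha : AnalyticOnNhd ℂ f univ := fun z _ => hd.analyticAt z
  have := AnalyticOnNhd.eq_of_frequently_eq ha (fun z _ => analyticAt_const (v := (0 : ℂ))) hacc
  obtain ⟨z, hz⟩ := hne
  exact hz (congrFun this z)

lemma landau2 {f : ℂ → ℂ} {c α β : ℂ} {r : ℝ} (hr : 0 < r) (hab : α ≠ β)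
    (hf : DifferentiableOn ℂ f (ball c r))
    (h0 : ∀ z ∈ ball c r, f z ≠ α) (h1 : ∀ z ∈ ball c r, f z ≠ β) :
    ‖deriv f c‖ ≤ 1280 / r * (‖f c - α‖ *
      (|Real.log (‖f c - α‖ / ‖β - α‖)| + 2 * Real.pi)) := by
  have hba : β - α ≠ 0 := sub_ne_zero.mpr hab.symm
  have h := landau (f := fun z => (f z - α) / (β - α)) hr ((hf.sub_const α).div_const _)
    (fun z hz => div_ne_zero (sub_ne_zero.mpr (h0 z hz)) hba)
    (fun z hz h => h1 z hz (by rw [div_eq_one_iff_eq hba] at h; exact sub_left_injective h))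
  have hd : deriv (fun z => (f z - α) / (β - α)) c = deriv f c / (β - α) := by
    rw [deriv_div_const, deriv_sub_const]
  rw [hd, norm_div, norm_div] at h
  have hn : 0 < ‖β - α‖ := norm_pos_iff.mpr hba
  rw [div_le_iff₀ hn] at h
  refine h.trans (le_of_eq ?_)
  field_simp

lemma tend_zero (b : ℂ) {d : ℝ} (hd : 0 < d) :
    Tendsto (fun w : ℂ => ‖w - b‖ * (|Real.log (‖w - b‖ / d)| + 2 * Real.pi) ^ 3) (𝓝 b) (𝓝 0) := by
  have hs : Tendsto (fun w : ℂ => ‖w - b‖ / d) (𝓝 b) (𝓝 0) := by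
    have : Continuous (fun w : ℂ => ‖w - b‖ / d) := by fun_prop
    simpa using this.tendsto b
  have hb : Tendsto (fun w : ℂ => d * ((‖w - b‖ / d) ^ ((1:ℝ)/2) * (6 + 2 * Real.pi) ^ 3)) (𝓝 b) (𝓝 0) := by
    have := hs.rpow_const (p := (1:ℝ)/2) (Or.inr (by norm_num))
    rw [Real.zero_rpow (by norm_num)] at this
    simpa using (this.mul_const ((6 + 2 * Real.pi) ^ 3)).const_mul d
  refine squeeze_zero' (Eventually.of_forall fun w => by have := Real.pi_pos; positivity) ?_ hb
  have h1 : ∀ᶠ w in 𝓝 b, ‖w - b‖ / d < 1 := hs.eventually (gt_mem_nhds one_pos)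
  filter_upwards [h1] with w hw
  set s := ‖w - b‖ / d with hsdef
  have hwb : ‖w - b‖ = d * s := by rw [hsdef]; field_simp
  rw [hwb, mul_assoc]
  apply mul_le_mul_of_nonneg_left _ hd.le
  have hs0 : 0 ≤ s := by positivity
  rcases hs0.eq_or_lt with h0 | h0
  · rw [← h0]; simp
  have hl := (Real.abs_log_mul_self_rpow_lt s ((1:ℝ)/6) h0 hw.le (by norm_num)).le
  rw [abs_mul, abs_of_nonneg (Real.rpow_nonneg hs0 _)] at hl
  set u := s ^ ((1:ℝ)/6) with hu
  have hu0 : 0 < u := Real.rpow_pos_of_pos h0 _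
  have hu1 : u ≤ 1 := Real.rpow_le_one hs0 hw.le (by norm_num)
  have e1 : s ^ ((1:ℝ)/2) = u ^ 3 := by
    rw [hu, ← Real.rpow_natCast, ← Real.rpow_mul hs0]; norm_num
  have e2 : s = u ^ 6 := by
    rw [hu, ← Real.rpow_natCast, ← Real.rpow_mul hs0]; norm_num
  rw [e1]
  have e3 : u * (|Real.log s| + 2 * Real.pi) ≤ 6 + 2 * Real.pi := by
    have := Real.pi_pos
    norm_num at hl
    nlinarith
  calc s * (|Real.log s| + 2 * Real.pi) ^ 3 = u ^ 3 * (u * (|Real.log s| + 2 * Real.pi)) ^ 3 := by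
        nth_rewrite 1 [e2]; ring
    _ ≤ _ := by
        have := Real.pi_pos
        gcongr

lemma near_inf (α β : ℂ) {d A ε : ℝ} (hd : 0 < d) (hA : 0 < A) (hε : 0 < ε) :
    ∃ R : ℝ, ∀ w : ℂ, R < ‖w‖ →
      (A * (‖w - α‖ * (|Real.log (‖w - α‖ / d)| + 2 * Real.pi))) ^ 3 ≤
        ε * ‖(w - α) * (w - β)‖ ^ 2 := by
  have h1 := (Real.isLittleO_pow_log_id_atTop (n := 3)).bound (c := ε * d ⁻¹ * (1 / (32 * A ^ 3)) * d * d)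
    (by positivity)
  have hlog : ∀ᶠ s in atTop, 2 * Real.pi ≤ Real.log s := Real.tendsto_log_atTop.eventually_ge_atTop _
  obtain ⟨S, hS⟩ := eventually_atTop.mp (h1.and (hlog.and (eventually_ge_atTop (1:ℝ))))
  refine ⟨‖α‖ + d * max S 0 + 2 * ‖α - β‖, fun w hw => ?_⟩
  have ht1 : ‖w‖ - ‖α‖ ≤ ‖w - α‖ := norm_sub_norm_le w α
  have hm : S ≤ max S 0 := le_max_left _ _
  have hm0 : 0 ≤ max S 0 := le_max_right _ _
  set t := ‖w - α‖ with ht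
  have hab := norm_nonneg (α - β)
  have hts : d * max S 0 ≤ t := by linarith
  have htab : 2 * ‖α - β‖ ≤ t := by nlinarith [mul_nonneg hd.le hm0]
  have hsS : S ≤ t / d := hm.trans ((le_div_iff₀ hd).mpr (by linarith))
  obtain ⟨q1, q2, q3⟩ := hS _ hsS
  have hl0 : 0 ≤ Real.log (t / d) := Real.log_nonneg q3
  have ht0 : 0 < t := by
    have : 0 < t / d := by linarith
    exact (div_pos_iff_of_pos_right hd).mp this
  rw [abs_of_nonneg hl0]
  simp only [id] at q1
  rw [Real.norm_of_nonneg (by positivity), Real.norm_of_nonneg (by positivity)] at q1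
  have hb : t / 2 ≤ ‖w - β‖ := by
    have : t ≤ ‖w - β‖ + ‖α - β‖ := by
      have e : w - α = (w - β) - (α - β) := by ring
      rw [ht, e]; exact norm_sub_le _ _
    linarith
  have q1' : Real.log (t / d) ^ 3 ≤ ε * t / (32 * A ^ 3) := by
    refine q1.trans (le_of_eq ?_); field_simp
  rw [norm_mul]
  have hL : Real.log (t / d) + 2 * Real.pi ≤ 2 * Real.log (t / d) := by linarith
  have hpi := Real.pi_pos
  calc (A * (t * (Real.log (t / d) + 2 * Real.pi))) ^ 3
      ≤ (A * (t * (2 * Real.log (t / d)))) ^ 3 := by gcongr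
    _ = 8 * A ^ 3 * t ^ 3 * Real.log (t / d) ^ 3 := by ring
    _ ≤ 8 * A ^ 3 * t ^ 3 * (ε * t / (32 * A ^ 3)) := by gcongr
    _ = ε * (t * (t / 2)) ^ 2 := by field_simp; norm_num
    _ ≤ ε * (t * ‖w - β‖) ^ 2 := by gcongr

lemma near_pt {V : Set ℂ} {α β b : ℂ} {r ε : ℝ} (hr : 0 < r) (hε : 0 < ε) (hab : α ≠ β)
    (hα : α ∉ V) (hβ : β ∉ V) (hb : b ∉ V) :
    ∀ᶠ w in 𝓝 b, ∀ (c : ℂ) (f : ℂ → ℂ), DifferentiableOn ℂ f (ball c r) →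
      MapsTo f (ball c r) V → f c = w → ‖deriv f c‖ ^ 3 ≤ ε * ‖(w - α) * (w - β)‖ ^ 2 := by
  have hcb : ∀ γ : ℂ, b ≠ γ → γ ∉ V → ∀ w (c : ℂ) (f : ℂ → ℂ), DifferentiableOn ℂ f (ball c r) →
      MapsTo f (ball c r) V → f c = w → ‖deriv f c‖ ^ 3 ≤ ‖w - b‖ ^ 2 * ((1280 / r) ^ 3 *
      (‖w - b‖ * (|Real.log (‖w - b‖ / ‖γ - b‖)| + 2 * Real.pi) ^ 3)) := by
    intro γ hγ hγV w c f hf hm hw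
    have := landau2 hr hγ hf (fun z hz h => hb (h ▸ hm hz)) (fun z hz h => hγV (h ▸ hm hz))
    rw [hw] at this
    calc _ ≤ _ := pow_le_pow_left₀ (norm_nonneg _) this 3
      _ = _ := by ring
  have hT : ∀ γ : ℂ, b ≠ γ → Tendsto (fun w : ℂ => (1280 / r) ^ 3 *
      (‖w - b‖ * (|Real.log (‖w - b‖ / ‖γ - b‖)| + 2 * Real.pi) ^ 3)) (𝓝 b) (𝓝 0) := by
    intro γ hγ
    simpa using (tend_zero b (norm_pos_iff.mpr (sub_ne_zero.mpr hγ.symm))).const_mul ((1280 / r) ^ 3)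
  have hC : ∀ γ : ℂ, Continuous (fun w : ℂ => ε * ‖w - γ‖ ^ 2) := fun γ => by fun_prop
  have special : ∀ γ : ℂ, b ≠ γ → γ ∉ V → 
    ∀ᶠ w in 𝓝 b, ∀ (c : ℂ) (f : ℂ → ℂ), DifferentiableOn ℂ f (ball c r) →
      MapsTo f (ball c r) V → f c = w → ‖deriv f c‖ ^ 3 ≤ ε * ‖(w - b) * (w - γ)‖ ^ 2 := by
    intro γ hγ hγV
    have hpos : 0 < ε * ‖b - γ‖ ^ 2 := by
      have := norm_pos_iff.mpr (sub_ne_zero.mpr hγ); positivity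
    filter_upwards [(hT γ hγ).eventually_lt ((hC γ).tendsto b) hpos] with w hw c f hf hm hfw
    refine (hcb γ hγ hγV w c f hf hm hfw).trans ?_
    rw [norm_mul, mul_pow]
    calc _ ≤ ‖w - b‖ ^ 2 * (ε * ‖w - γ‖ ^ 2) := by gcongr
      _ = _ := by ring
  by_cases h1 : b = α
  · subst h1; exact special β hab hβ
  by_cases h2 : b = β
  · subst h2
    filter_upwards [special α h1 hα] with w hw c f hf hm hfw
    rw [mul_comm (w - α)]; exact hw c f hf hm hfw
  have hpos : 0 < ε * ‖(b - α) * (b - β)‖ ^ 2 := by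
    have := norm_pos_iff.mpr (mul_ne_zero (sub_ne_zero.mpr h1) (sub_ne_zero.mpr h2)); positivity
  have hC2 : Continuous (fun w : ℂ => ε * ‖(w - α) * (w - β)‖ ^ 2) := by fun_prop
  have hC3 : Continuous (fun w : ℂ => ‖w - b‖ ^ 2) := by fun_prop
  have ht := (hC3.tendsto b).mul (hT α h1)
  rw [mul_zero] at ht
  filter_upwards [ht.eventually_lt (hC2.tendsto b) hpos] with w hw c f hf hm hfw
  exact (hcb α h1 hα w c f hf hm hfw).trans hw.le

lemma exists_compact {V : Set ℂ} {α β : ℂ} {r ε : ℝ} (hr : 0 < r) (hε : 0 < ε) (hab : α ≠ β)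
    (hα : α ∉ V) (hβ : β ∉ V) :
    ∃ K : Set ℂ, IsCompact K ∧ K ⊆ V ∧ ∀ (c : ℂ) (f : ℂ → ℂ), DifferentiableOn ℂ f (ball c r) →
      MapsTo f (ball c r) V → f c ∉ K → ‖deriv f c‖ ^ 3 ≤ ε * ‖(f c - α) * (f c - β)‖ ^ 2 := by
  let S : Set ℂ := {w | ∃ (c : ℂ) (f : ℂ → ℂ), DifferentiableOn ℂ f (ball c r) ∧
      MapsTo f (ball c r) V ∧ f c = w ∧ ε * ‖(w - α) * (w - β)‖ ^ 2 < ‖deriv f c‖ ^ 3}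
  refine ⟨closure S, ?_, ?_, ?_⟩
  · obtain ⟨R, hR⟩ := near_inf α β (d := ‖β - α‖) (A := 1280 / r)
      (norm_pos_iff.mpr (sub_ne_zero.mpr hab.symm)) (by positivity) hε
    refine (Metric.isBounded_closedBall (x := (0:ℂ)) (r := R)).subset ?_ |>.isCompact_closure
    rintro w ⟨c, f, hf, hm, hw, hlt⟩
    rw [mem_closedBall_zero_iff]
    by_contra hcon
    have h1 := hR w (not_le.mp hcon)
    have := landau2 hr hab hf (fun z hz h => hα (h ▸ hm hz)) (fun z hz h => hβ (h ▸ hm hz))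
    rw [hw] at this
    have := pow_le_pow_left₀ (norm_nonneg _) this 3
    linarith
  · intro b hb
    by_contra hbV
    obtain ⟨w, ⟨c, f, hf, hm, hfw, hlt⟩, hw⟩ := ((mem_closure_iff_frequently.mp hb).and_eventually
      (near_pt hr hε hab hα hβ hbV)).exists
    exact absurd (hw c f hf hm hfw) (not_le.mpr hlt)
  · intro c f hf hm hK
    by_contra hcon
    exact hK (subset_closure ⟨c, f, hf, hm, rfl, not_le.mp hcon⟩)

lemma exists_bound {V : Set ℂ} {α β : ℂ} {r : ℝ} (hr : 0 < r) (hab : α ≠ β)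
    (hα : α ∉ V) (hβ : β ∉ V) :
    ∃ M : ℝ, 0 < M ∧ ∀ (c : ℂ) (f : ℂ → ℂ), DifferentiableOn ℂ f (ball c r) →
      MapsTo f (ball c r) V → ‖deriv f c‖ ^ 3 ≤ M * ‖(f c - α) * (f c - β)‖ ^ 2 := by
  obtain ⟨K, hK, hKV, hKf⟩ := exists_compact hr one_pos hab hα hβ
  have hne : ∀ w ∈ K, (w - α) * (w - β) ≠ 0 := fun w hw => mul_ne_zero
    (sub_ne_zero.mpr fun h => hα (h ▸ hKV hw)) (sub_ne_zero.mpr fun h => hβ (h ▸ hKV hw))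
  have hc : ContinuousOn (fun w : ℂ => (1280 / r * (‖w - α‖ *
      (|Real.log (‖w - α‖ / ‖β - α‖)| + 2 * Real.pi))) ^ 3 / ‖(w - α) * (w - β)‖ ^ 2) K := by
    have hd : ‖β - α‖ ≠ 0 := norm_ne_zero_iff.mpr (sub_ne_zero.mpr hab.symm)
    have h1 : ContinuousOn (fun w : ℂ => Real.log (‖w - α‖ / ‖β - α‖)) K := by
      apply ContinuousOn.log (by fun_prop)
      intro w hw
      exact div_ne_zero (norm_ne_zero_iff.mpr (left_ne_zero_of_mul (hne w hw))) hd
    apply ContinuousOn.div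
    · fun_prop
    · fun_prop
    · intro w hw
      exact pow_ne_zero _ (norm_ne_zero_iff.mpr (hne w hw))
  obtain ⟨M, hM⟩ := hK.bddAbove_image hc
  refine ⟨max M 1, by positivity, fun c f hf hm => ?_⟩
  by_cases h : f c ∈ K
  · have h1 := hM (mem_image_of_mem _ h)
    have hp : 0 < ‖(f c - α) * (f c - β)‖ ^ 2 := by
      have := norm_pos_iff.mpr (hne _ h); positivity
    simp only [div_le_iff₀ hp] at h1
    have := landau2 hr hab hf (fun z hz h => hα (h ▸ hm hz)) (fun z hz h => hβ (h ▸ hm hz))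
    have := pow_le_pow_left₀ (norm_nonneg _) this 3
    refine (this.trans h1).trans ?_
    gcongr
    exact le_max_left _ _
  · refine (hKf c f hf hm h).trans ?_
    gcongr
    exact le_max_right _ _
lemma update_mem {n : ℕ} {β : Type*} {U : Fin n → Set β} {x : Fin n → β} (hx : x ∈ univ.pi U)
    {k : Fin n} {t : β} (ht : t ∈ U k) : Function.update x k t ∈ univ.pi U := by
  intro i _
  by_cases h : i = k
  · subst h; simpa using ht
  · rw [Function.update_of_ne h]; exact hx i trivial

/-- partial derivative -/
noncomputable def pd {n : ℕ} (g : (Fin n → ℂ) → ℂ) (k : Fin n) (z : Fin n → ℂ) : ℂ :=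
  fderiv ℂ g z (Pi.single k 1)

lemma pd_analytic {n : ℕ} {g : (Fin n → ℂ) → ℂ} {P : Set (Fin n → ℂ)} (hg : AnalyticOnNhd ℂ g P)
    (k : Fin n) : AnalyticOnNhd ℂ (pd g k) P := by
  intro z hz
  exact ((ContinuousLinearMap.apply ℂ ℂ (Pi.single k 1 : Fin n → ℂ)).analyticAt _).comp
    (hg.fderiv z hz)

lemma pd_hasDerivAt {n : ℕ} {g : (Fin n → ℂ) → ℂ} {z : Fin n → ℂ} {k : Fin n} {t : ℂ}
    (hg : AnalyticAt ℂ g (Function.update z k t)) :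
    HasDerivAt (fun t => g (Function.update z k t)) (pd g k (Function.update z k t)) t :=
  hg.differentiableAt.hasFDerivAt.comp_hasDerivAt t (hasDerivAt_update z k t)

lemma dep_of_pd {n : ℕ} {U : Fin n → Set ℂ} (hUo : ∀ j, IsOpen (U j))
    (hUc : ∀ j, IsPreconnected (U j)) {g : (Fin n → ℂ) → ℂ} (hg : AnalyticOnNhd ℂ g (univ.pi U))
    (j : Fin n) (hd : ∀ k, k ≠ j → ∀ z ∈ univ.pi U, pd g k z = 0) :
    ∀ x ∈ univ.pi U, ∀ y ∈ univ.pi U, x j = y j → g x = g y := by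
  intro x hx y hy hxy
  have step : ∀ z ∈ univ.pi U, ∀ k, k ≠ j → ∀ s ∈ U k, g (Function.update z k s) = g z := by
    intro z hz k hk s hs
    have h1 : ∀ t ∈ U k, HasDerivAt (fun t => g (Function.update z k t)) 0 t := by
      intro t ht
      have hm := update_mem hz ht
      have := pd_hasDerivAt (hg _ hm)
      rwa [hd k hk _ hm] at this
    obtain ⟨a, ha⟩ := (hUo k).exists_is_const_of_deriv_eq_zero (hUc k)
      (fun t ht => (h1 t ht).differentiableAt.differentiableWithinAt) (fun t ht => (h1 t ht).deriv)
    have e1 := ha s hs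
    have e2 := ha (z k) (hz k trivial)
    simp only [Function.update_eq_self] at e2
    rw [e1, e2]
  have main : ∀ S : Finset (Fin n), S.piecewise y x ∈ univ.pi U ∧ g (S.piecewise y x) = g x := by
    intro S
    induction S using Finset.induction_on with
    | empty => simpa using hx
    | insert k S hk ih =>
      rw [Finset.piecewise_insert]
      refine ⟨update_mem ih.1 (hy k trivial), ?_⟩
      by_cases hkj : k = j
      · subst hkj
        have : (S.piecewise y x) k = y k := by
          rw [Finset.piecewise_eq_of_notMem _ _ _ hk, hxy]
        rw [← this, Function.update_eq_self, ih.2]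
      · rw [step _ ih.1 k hkj _ (hy k trivial), ih.2]
  have := (main Finset.univ).2
  rw [Finset.piecewise_univ] at this
  exact this.symm

lemma prod_ne {n : ℕ} {ι : Type*} {P : Set (Fin n → ℂ)} (hPo : IsOpen P) (hPc : IsPreconnected P)
    (hPne : P.Nonempty)
    (d : ι → (Fin n → ℂ) → ℂ) (S : Finset ι) (hd : ∀ i ∈ S, AnalyticOnNhd ℂ (d i) P)
    (hne : ∀ i ∈ S, ∃ x ∈ P, d i x ≠ 0) : ∃ x ∈ P, ∏ i ∈ S, d i x ≠ 0 := by
  induction S using Finset.induction_on with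
  | empty => obtain ⟨x, hx⟩ := hPne; exact ⟨x, hx, by simp⟩
  | insert a S ha ih =>
    obtain ⟨x, hx, hxS⟩ := ih (fun i hi => hd i (Finset.mem_insert_of_mem hi))
      (fun i hi => hne i (Finset.mem_insert_of_mem hi))
    by_contra hcon
    push Not at hcon
    have hc : ContinuousAt (fun y => ∏ i ∈ S, d i y) x := by
      apply tendsto_finset_prod
      intro i hi
      exact (hd i (Finset.mem_insert_of_mem hi) x hx).continuousAt
    have hev : d a =ᶠ[𝓝 x] 0 := by
      filter_upwards [hc.eventually_ne hxS, hPo.mem_nhds hx] with y hy hyP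
      have := hcon y hyP
      rw [Finset.prod_insert ha] at this
      exact (mul_eq_zero.mp this).resolve_right hy
    obtain ⟨y, hy, hy0⟩ := hne a (Finset.mem_insert_self _ _)
    exact hy0 ((hd a (Finset.mem_insert_self _ _)).eqOn_zero_of_preconnected_of_eventuallyEq_zero
      hPc hx hev hy)

lemma planar_one {n : ℕ} {U V : Fin n → Set ℂ} (hUo : ∀ j, IsOpen (U j))
    (hUc : ∀ j, IsPreconnected (U j)) (hUne : (univ.pi U).Nonempty)
    {ζ : Fin n → ℂ} (hζ : ∀ j, ∃ᶠ z in 𝓝[≠] ζ j, z ∉ U j)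
    {α β : Fin n → ℂ} (hab : ∀ i, α i ≠ β i) (hα : ∀ i, α i ∉ V i) (hβ : ∀ i, β i ∉ V i)
    {f : (Fin n → ℂ) → Fin n → ℂ} (hfa : ∀ i, AnalyticOnNhd ℂ (fun z => f z i) (univ.pi U))
    (hmap : ∀ x ∈ univ.pi U, ∀ i, f x i ∈ V i)
    (H : ∀ K : Fin n → Set ℂ, (∀ i, IsCompact (K i) ∧ K i ⊆ V i) → ∀ x ∈ univ.pi U, ∀ j,
      ∀ z0 ∉ U j, ∀ᶠ z in 𝓝[U j] z0, ∃ i, f (Function.update x j z) i ∉ K i)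
    (j : Fin n) :
    ∃ i, (∃ x ∈ univ.pi U, ∃ y ∈ univ.pi U, f x i ≠ f y i) ∧
      ∀ x ∈ univ.pi U, ∀ y ∈ univ.pi U, x j = y j → f x i = f y i := by
  by_contra hcon
  push Not at hcon
  set P := univ.pi U with hP
  have hPo : IsOpen P := isOpen_set_pi finite_univ (fun i _ => hUo i)
  have hPc : IsPreconnected P := isPreconnected_univ_pi hUc
  set I : Finset (Fin n) := Finset.univ.filter (fun i => ∃ x ∈ P, ∃ y ∈ P, f x i ≠ f y i) with hI
  have hk : ∀ i, ∃ k, i ∈ I → k ≠ j ∧ ∃ x ∈ P, pd (fun z => f z i) k x ≠ 0 := by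
    intro i
    by_cases hi : i ∈ I
    · obtain ⟨x, hx, y, hy, hxy, hne⟩ := hcon i (Finset.mem_filter.mp hi).2
      by_contra h
      push Not at h
      exact hne (dep_of_pd hUo hUc (hfa i) j (fun k hk z hz => (h k).2 hk z hz) x hx y hy hxy)
    · exact ⟨i, fun h => absurd h hi⟩
  choose k hk using hk
  obtain ⟨x, hx, hxne⟩ := prod_ne hPo hPc hUne (fun i => pd (fun z => f z i) (k i)) I
    (fun i _ => pd_analytic (hfa i) _) (fun i hi => (hk i hi).2)
  have hr : ∀ l, ∃ r > 0, ball (x l) r ⊆ U l := fun l =>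
    Metric.isOpen_iff.mp (hUo l) (x l) (hx l trivial)
  choose r hr0 hrU using hr
  -- local estimate set-up
  have hφ : ∀ i ∈ I, ∀ z ∈ U j, ∃ φ : ℂ → ℂ, DifferentiableOn ℂ φ (ball (x (k i)) (r (k i))) ∧
      MapsTo φ (ball (x (k i)) (r (k i))) (V i) ∧
      φ (x (k i)) = f (Function.update x j z) i ∧
      deriv φ (x (k i)) = pd (fun z => f z i) (k i) (Function.update x j z) := by
    intro i hi z hz
    have hkj := (hk i hi).1
    have hy := update_mem hx hz
    have hyk : Function.update x j z (k i) = x (k i) := Function.update_of_ne hkj _ _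
    have hself : Function.update (Function.update x j z) (k i) (x (k i)) = Function.update x j z := by
      rw [← hyk, Function.update_eq_self]
    refine ⟨fun t => f (Function.update (Function.update x j z) (k i) t) i, ?_, ?_, ?_, ?_⟩
    · intro t ht
      exact (pd_hasDerivAt (g := fun z => f z i)
        (hfa i _ (update_mem hy (hrU _ ht)))).differentiableAt.differentiableWithinAt
    · intro t ht
      exact hmap _ (update_mem hy (hrU _ ht)) i
    · simp only [hself]
    · have := (pd_hasDerivAt (g := fun z => f z i) (z := Function.update x j z) (k := k i)
        (t := x (k i)) (hfa i _ (by rw [hself]; exact hy))).deriv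
      rw [this, hself]
  set q : Fin n → ℂ → ℂ := fun i z => pd (fun z => f z i) (k i) (Function.update x j z) ^ 3 /
    ((f (Function.update x j z) i - α i) * (f (Function.update x j z) i - β i)) ^ 2 with hq
  have hden : ∀ i, ∀ z ∈ U j,
      (f (Function.update x j z) i - α i) * (f (Function.update x j z) i - β i) ≠ 0 := by
    intro i z hz
    have := hmap _ (update_mem hx hz) i
    exact mul_ne_zero (sub_ne_zero.mpr fun h => hα i (h ▸ this))
      (sub_ne_zero.mpr fun h => hβ i (h ▸ this))
  have hq1 : ∀ i, ∃ M : ℝ, 1 ≤ M ∧ (i ∈ I → ∀ z ∈ U j, ‖q i z‖ ≤ M) := by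
    intro i
    obtain ⟨M, hM, hMf⟩ := exists_bound (hr0 (k i)) (hab i) (hα i) (hβ i)
    refine ⟨max M 1, le_max_right _ _, fun hi z hz => ?_⟩
    obtain ⟨φ, h1, h2, h3, h4⟩ := hφ i hi z hz
    have := hMf _ φ h1 h2
    rw [h3, h4] at this
    have hp : 0 < ‖(f (Function.update x j z) i - α i) * (f (Function.update x j z) i - β i)‖ ^ 2 := by
      have := norm_pos_iff.mpr (hden i z hz); positivity
    rw [hq]
    simp only [norm_div, norm_pow]
    rw [div_le_iff₀ hp]
    refine this.trans ?_
    gcongr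
    exact le_max_left _ _
  choose M hM1 hM using hq1
  have hq2 : ∀ ε > 0, ∀ i, ∃ K : Set ℂ, IsCompact K ∧ K ⊆ V i ∧
      (∀ z ∈ U j, f (Function.update x j z) i ∉ K → i ∈ I ∧ ‖q i z‖ ≤ ε) := by
    intro ε hε i
    by_cases hi : i ∈ I
    · obtain ⟨K, hK, hKV, hKf⟩ := exists_compact (hr0 (k i)) hε (hab i) (hα i) (hβ i)
      refine ⟨K, hK, hKV, fun z hz hzK => ⟨hi, ?_⟩⟩
      obtain ⟨φ, h1, h2, h3, h4⟩ := hφ i hi z hz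
      have := hKf _ φ h1 h2
      rw [h3, h4] at this
      have := this hzK
      have hp : 0 < ‖(f (Function.update x j z) i - α i) * (f (Function.update x j z) i - β i)‖ ^ 2 := by
        have := norm_pos_iff.mpr (hden i z hz); positivity
      rw [hq]
      simp only [norm_div, norm_pow]
      rwa [div_le_iff₀ hp]
    · refine ⟨{f x i}, isCompact_singleton, by simpa using hmap x hx i, fun z hz hzK => ?_⟩
      exact absurd (Finset.mem_filter.mpr ⟨Finset.mem_univ _, _, update_mem hx hz, x, hx, hzK⟩) hi
  set h : ℂ → ℂ := fun z => if z ∈ U j then ∏ i ∈ I, q i z else 0 with hh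
  have hqd : ∀ z ∈ U j, ∀ i, DifferentiableAt ℂ (q i) z := by
    intro z hz i
    have hy := update_mem hx hz
    have d1 : DifferentiableAt ℂ (fun z => f (Function.update x j z) i) z :=
      (pd_hasDerivAt (g := fun z => f z i) (hfa i _ hy)).differentiableAt
    have d2 : DifferentiableAt ℂ (fun z => pd (fun z => f z i) (k i) (Function.update x j z)) z :=
      (pd_hasDerivAt (pd_analytic (hfa i) (k i) _ hy)).differentiableAt
    exact (d2.pow 3).div (((d1.sub_const _).mul (d1.sub_const _)).pow 2) (pow_ne_zero _ (hden i z hz))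
  have hhd : ∀ z ∈ U j, DifferentiableAt ℂ h z := by
    intro z hz
    have e : h =ᶠ[𝓝 z] fun z => ∏ i ∈ I, q i z := by
      filter_upwards [(hUo j).mem_nhds hz] with w hw
      simp only [hh, if_pos hw]
    refine DifferentiableAt.congr_of_eventuallyEq ?_ e
    exact DifferentiableAt.fun_finset_prod (fun i _ => hqd z hz i)
  have hhc : Continuous h := by
    rw [continuous_iff_continuousAt]
    intro z0
    by_cases hz0 : z0 ∈ U j
    · exact (hhd z0 hz0).continuousAt
    have hz00 : h z0 = 0 := by simp only [hh, if_neg hz0]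
    rw [ContinuousAt, hz00, Metric.tendsto_nhds]
    intro ε' hε'
    have hMM : 0 < ∏ i ∈ I, M i := Finset.prod_pos fun i _ => by linarith [hM1 i]
    obtain ⟨ε, hε, hεe⟩ : ∃ ε > 0, ε * ∏ i ∈ I, M i < ε' :=
      ⟨ε' / 2 / ∏ i ∈ I, M i, by positivity, by
        rw [div_mul_cancel₀ _ hMM.ne']; linarith⟩
    choose K hK hKV hKq using hq2 ε hε
    have := H K (fun i => ⟨hK i, hKV i⟩) x hx j z0 hz0
    rw [eventually_nhdsWithin_iff] at this
    filter_upwards [this] with z hz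
    rw [dist_zero_right]
    by_cases hzU : z ∈ U j
    · obtain ⟨i, hi⟩ := hz hzU
      obtain ⟨hiI, hqi⟩ := hKq i z hzU hi
      simp only [hh, if_pos hzU]
      rw [← Finset.mul_prod_erase I _ hiI, norm_mul, norm_prod]
      refine lt_of_le_of_lt ?_ hεe
      rw [← Finset.mul_prod_erase I _ hiI]
      have hle : ∏ l ∈ I.erase i, ‖q l z‖ ≤ ∏ l ∈ I.erase i, M l :=
        Finset.prod_le_prod (fun _ _ => norm_nonneg _)
          (fun l hl => hM l (Finset.mem_of_mem_erase hl) z hzU)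
      have hle0 : 0 ≤ ∏ l ∈ I.erase i, ‖q l z‖ := Finset.prod_nonneg fun _ _ => norm_nonneg _
      refine mul_le_mul hqi (hle.trans ?_) hle0 hε.le
      have := hM1 i
      nlinarith [hle0.trans hle]
    · simp only [hh, if_neg hzU, norm_zero]; exact hε'
  have hz := rado_zero hhc (fun z hz => hhd z (by
    by_contra hzU
    exact hz (by simp only [hh, if_neg hzU]))) (ζ := ζ j)
    ((hζ j).mono fun z hz => by simp only [hh, if_neg hz]) (x j)
  have hxj : x j ∈ U j := hx j trivial
  simp only [hh, if_pos hxj] at hz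
  obtain ⟨i, hi, hqi⟩ := Finset.prod_eq_zero_iff.mp hz
  have hd := hden i _ hxj
  simp only [hq] at hqi
  rw [div_eq_zero_iff, or_iff_left (pow_ne_zero _ hd)] at hqi
  have := pow_eq_zero_iff (three_ne_zero) |>.mp hqi
  rw [Function.update_eq_self] at this
  exact Finset.prod_ne_zero_iff.mp hxne i hi this

lemma planar {n : ℕ} {U V : Fin n → Set ℂ} (hUo : ∀ j, IsOpen (U j))
    (hUc : ∀ j, IsPreconnected (U j)) (hUne : (univ.pi U).Nonempty)
    {ζ : Fin n → ℂ} (hζ : ∀ j, ∃ᶠ z in 𝓝[≠] ζ j, z ∉ U j)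
    {α β : Fin n → ℂ} (hab : ∀ i, α i ≠ β i) (hα : ∀ i, α i ∉ V i) (hβ : ∀ i, β i ∉ V i)
    {f : (Fin n → ℂ) → Fin n → ℂ} (hfa : ∀ i, AnalyticOnNhd ℂ (fun z => f z i) (univ.pi U))
    (hmap : ∀ x ∈ univ.pi U, ∀ i, f x i ∈ V i)
    (H : ∀ K : Fin n → Set ℂ, (∀ i, IsCompact (K i) ∧ K i ⊆ V i) → ∀ x ∈ univ.pi U, ∀ j,
      ∀ z0 ∉ U j, ∀ᶠ z in 𝓝[U j] z0, ∃ i, f (Function.update x j z) i ∉ K i) :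
    ∃ π : Equiv.Perm (Fin n), ∀ i, ∀ x ∈ univ.pi U, ∀ y ∈ univ.pi U,
      x (π i) = y (π i) → f x i = f y i := by
  choose τ h1 h2 using planar_one hUo hUc hUne hζ hab hα hβ hfa hmap H
  have hinj : Function.Injective τ := by
    intro j j' hjj
    by_contra hne
    obtain ⟨x, hx, y, hy, hxy⟩ := h1 j
    apply hxy
    have hm := update_mem hx (hy j' trivial)
    have e1 := h2 j x hx _ hm (by rw [Function.update_of_ne hne])
    have e2 := h2 j' _ hm y hy (by simp)
    rw [← hjj] at e2
    rw [e1, e2]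
  let e := Equiv.ofBijective τ (Finite.injective_iff_bijective.mp hinj)
  refine ⟨e.symm, fun i x hx y hy hxy => ?_⟩
  have := h2 (e.symm i) x hx y hy hxy
  have hi : τ (e.symm i) = i := e.apply_symm_apply i
  rwa [hi] at this
/-- parametrization of the sphere minus a point -/
noncomputable def sig (p : OnePoint ℂ) (t : ℂ) : OnePoint ℂ :=
  if p = ∞ then (t : OnePoint ℂ) else if t = 0 then ∞ else ((spDown p + t⁻¹ : ℂ) : OnePoint ℂ)

/-- coordinate on the sphere minus a point -/
noncomputable def rho (p : OnePoint ℂ) (w : OnePoint ℂ) : ℂ :=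
  if p = ∞ then spDown w else OnePoint.elim w 0 (fun v => (v - spDown p)⁻¹)

@[simp] lemma spDown_coe (z : ℂ) : spDown (z : OnePoint ℂ) = z := rfl
@[simp] lemma spDown_inf : spDown (∞ : OnePoint ℂ) = 0 := rfl
@[simp] lemma spInv_inf : spInv (∞ : OnePoint ℂ) = ((0 : ℂ) : OnePoint ℂ) := rfl
lemma spInv_coe (z : ℂ) : spInv (z : OnePoint ℂ) = if z = 0 then ∞ else ((z⁻¹ : ℂ) : OnePoint ℂ) :=
  rfl

lemma sig_inf (t : ℂ) : sig ∞ t = (t : OnePoint ℂ) := by simp [sig]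
lemma sig_coe (c t : ℂ) : sig (c : OnePoint ℂ) t =
    if t = 0 then ∞ else ((c + t⁻¹ : ℂ) : OnePoint ℂ) := by simp [sig]
lemma rho_inf (w : OnePoint ℂ) : rho ∞ w = spDown w := by simp [rho]
lemma rho_coe_coe (c v : ℂ) : rho (c : OnePoint ℂ) (v : OnePoint ℂ) = (v - c)⁻¹ := by simp [rho]
lemma rho_coe_inf (c : ℂ) : rho (c : OnePoint ℂ) ∞ = 0 := by simp [rho]

lemma sig_ne (p : OnePoint ℂ) (t : ℂ) : sig p t ≠ p := by
  induction p using OnePoint.rec with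
  | infty => rw [sig_inf]; exact OnePoint.coe_ne_infty t
  | coe c =>
    rw [sig_coe]
    split_ifs with h
    · exact OnePoint.infty_ne_coe c
    · intro e
      have := OnePoint.coe_injective e
      simp [h] at this

lemma rho_sig (p : OnePoint ℂ) (t : ℂ) : rho p (sig p t) = t := by
  induction p using OnePoint.rec with
  | infty => rw [sig_inf, rho_inf, spDown_coe]
  | coe c =>
    rw [sig_coe]
    split_ifs with h
    · rw [rho_coe_inf, h]
    · rw [rho_coe_coe]; simp

lemma sig_rho {p w : OnePoint ℂ} (h : w ≠ p) : sig p (rho p w) = w := by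
  induction p using OnePoint.rec with
  | infty =>
    rw [rho_inf, sig_inf]
    induction w using OnePoint.rec with
    | infty => exact absurd rfl h
    | coe v => rfl
  | coe c =>
    induction w using OnePoint.rec with
    | infty => rw [rho_coe_inf, sig_coe, if_pos rfl]
    | coe v =>
      have hv : v - c ≠ 0 := sub_ne_zero.mpr fun e => h (by rw [e])
      rw [rho_coe_coe, sig_coe, if_neg (inv_ne_zero hv)]
      simp

lemma sphChart_pt (p : OnePoint ℂ) : sphChart p (sphChartPt p) = p := by
  induction p using OnePoint.rec with
  | infty => simp [sphChart, sphChartPt, spInv_coe]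
  | coe c => simp [sphChart, sphChartPt]

lemma tendsto_inv_inf : Tendsto (fun z : ℂ => ((z⁻¹ : ℂ) : OnePoint ℂ)) (𝓝[≠] 0) (𝓝 ∞) := by
  have h1 : Tendsto (fun z : ℂ => z⁻¹) (𝓝[≠] 0) (coclosedCompact ℂ) := by
    rw [coclosedCompact_eq_cocompact, ← Metric.cobounded_eq_cocompact]
    exact tendsto_inv₀_nhdsNE_zero
  exact OnePoint.tendsto_coe_infty.comp h1

lemma sphChart_cont (p : OnePoint ℂ) : ContinuousAt (sphChart p) (sphChartPt p) := by
  induction p using OnePoint.rec with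
  | infty =>
    have e : sphChart ∞ = fun z : ℂ => spInv (z : OnePoint ℂ) := by simp [sphChart]
    have e2 : sphChartPt ∞ = 0 := by simp [sphChartPt]
    rw [e, e2, continuousAt_iff_punctured_nhds]
    have : spInv ((0 : ℂ) : OnePoint ℂ) = ∞ := by simp [spInv_coe]
    rw [this]
    refine tendsto_inv_inf.congr' ?_
    filter_upwards [self_mem_nhdsWithin] with z hz
    have hz : z ≠ 0 := hz
    rw [spInv_coe, if_neg hz]
  | coe c =>
    have e : sphChart (c : OnePoint ℂ) = fun z : ℂ => (z : OnePoint ℂ) := by simp [sphChart]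
    rw [e]
    exact OnePoint.continuous_coe.continuousAt

lemma sig_local (p : OnePoint ℂ) (t0 : ℂ) : ∃ u : ℂ → ℂ, AnalyticAt ℂ u t0 ∧
    u t0 = sphChartPt (sig p t0) ∧ ∀ᶠ t in 𝓝 t0, sig p t = sphChart (sig p t0) (u t) := by
  induction p using OnePoint.rec with
  | infty =>
    refine ⟨id, analyticAt_id, by simp [sig_inf, sphChartPt], Eventually.of_forall fun t => ?_⟩
    simp [sig_inf, sphChart]
  | coe c =>
    by_cases h : t0 = 0
    · subst h
      have hc : Continuous (fun t : ℂ => 1 + c * t) := by fun_prop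
      refine ⟨fun t => t / (1 + c * t), ?_, by simp [sig_coe, sphChartPt], ?_⟩
      · apply AnalyticAt.div <;> first | fun_prop | simp
      · have : ∀ᶠ t in 𝓝 (0:ℂ), 1 + c * t ≠ 0 := hc.continuousAt.eventually_ne (by simp)
        filter_upwards [this] with t ht
        by_cases h0 : t = 0
        · subst h0; simp [sig_coe, sphChart, spInv_coe]
        · simp only [sig_coe, if_neg h0, if_true, sphChart, spInv_coe]
          rw [if_neg (div_ne_zero h0 ht)]
          congr 1
          field_simp
          ring
    · refine ⟨fun t => c + t⁻¹, ?_, by simp [sig_coe, sphChartPt, h], ?_⟩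
      · exact analyticAt_const.add (analyticAt_id.inv h)
      · filter_upwards [isOpen_ne.mem_nhds h] with t ht
        have ht : t ≠ 0 := ht
        simp [sig_coe, sphChart, h, ht]

lemma sig_cont (p : OnePoint ℂ) : Continuous (sig p) := by
  rw [continuous_iff_continuousAt]
  intro t0
  obtain ⟨u, hu, hu0, he⟩ := sig_local p t0
  have h1 : ContinuousAt (fun t => sphChart (sig p t0) (u t)) t0 := by
    apply ContinuousAt.comp (g := sphChart (sig p t0))
    · rw [hu0]; exact sphChart_cont _
    · exact hu.continuousAt
  exact h1.congr (he.mono fun t ht => ht.symm)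

lemma rho_cont {p w : OnePoint ℂ} (h : w ≠ p) : ContinuousAt (rho p) w := by
  induction p using OnePoint.rec with
  | infty =>
    induction w using OnePoint.rec with
    | infty => exact absurd rfl h
    | coe v =>
      rw [OnePoint.continuousAt_coe]
      have : rho ∞ ∘ ((↑) : ℂ → OnePoint ℂ) = id := by ext z; simp [rho_inf]
      rw [this]; exact continuousAt_id
  | coe c =>
    induction w using OnePoint.rec with
    | infty =>
      rw [OnePoint.continuousAt_infty', rho_coe_inf]
      have e : rho (c : OnePoint ℂ) ∘ ((↑) : ℂ → OnePoint ℂ) = fun z => (z - c)⁻¹ := by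
        ext z; simp [rho_coe_coe]
      rw [e, coclosedCompact_eq_cocompact, ← Metric.cobounded_eq_cocompact]
      apply tendsto_inv₀_cobounded.comp
      simp [sub_eq_add_neg]
    | coe v =>
      rw [OnePoint.continuousAt_coe]
      have e : rho (c : OnePoint ℂ) ∘ ((↑) : ℂ → OnePoint ℂ) = fun z => (z - c)⁻¹ := by
        ext z; simp [rho_coe_coe]
      rw [e]
      exact (continuousAt_id.sub continuousAt_const).inv₀ (sub_ne_zero.mpr fun e => h (by
        simp only [id] at e; rw [e]))

lemma holo_congr {E : Type*} [NormedAddCommGroup E] [NormedSpace ℂ E] {h h' : E → OnePoint ℂ}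
    {a : E} (hh : SphHoloAt h a) (e : h' =ᶠ[𝓝 a] h) : SphHoloAt h' a := by
  refine ⟨hh.1.congr e.symm, ?_⟩
  rw [e.eq_of_nhds]
  refine hh.2.imp (fun H => ⟨H.1, H.2.congr ?_⟩) (fun H => ⟨H.1, H.2.congr ?_⟩)
  · exact e.symm.mono fun z hz => by simp only [hz]
  · exact e.symm.mono fun z hz => by simp only [hz]

lemma holo_comp {E G : Type*} [NormedAddCommGroup E] [NormedSpace ℂ E] [NormedAddCommGroup G]
    [NormedSpace ℂ G] {h : E → OnePoint ℂ} {φ : G → E} {a : G} {b : E}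
    (hh : SphHoloAt h b) (hφ : AnalyticAt ℂ φ a) (hb : φ a = b) :
    SphHoloAt (fun z => h (φ z)) a := by
  subst hb
  refine ⟨ContinuousAt.comp (g := h) hh.1 hφ.continuousAt, ?_⟩
  exact hh.2.imp
    (fun H => ⟨H.1, AnalyticAt.comp (g := fun z => spDown (h z)) (f := φ) H.2 hφ⟩)
    (fun H => ⟨H.1, AnalyticAt.comp (g := fun z => spDown (spInv (h z))) (f := φ) H.2 hφ⟩)

lemma holo_rho {E : Type*} [NormedAddCommGroup E] [NormedSpace ℂ E] {h : E → OnePoint ℂ}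
    {a : E} (hh : SphHoloAt h a) {p : OnePoint ℂ} (hp : h a ≠ p) :
    AnalyticAt ℂ (fun z => rho p (h z)) a := by
  obtain ⟨hc, ⟨h1, h2⟩ | ⟨h1, h2⟩⟩ := hh
  · induction p using OnePoint.rec with
    | infty => simpa only [rho_inf] using h2
    | coe c =>
      have hne : spDown (h a) - c ≠ 0 := by
        intro e
        apply hp
        obtain ⟨v, hv⟩ := OnePoint.ne_infty_iff_exists.mp h1
        rw [← hv] at e ⊢
        rw [spDown_coe, sub_eq_zero] at e
        rw [e]
      refine ((h2.sub analyticAt_const).inv hne).congr ?_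
      filter_upwards [hc.eventually_ne h1] with z hz
      obtain ⟨v, hv⟩ := OnePoint.ne_infty_iff_exists.mp hz
      simp [← hv, rho_coe_coe]
  · induction p using OnePoint.rec with
    | infty => exact absurd h1 hp
    | coe c =>
      have e0 : spDown (spInv (h a)) = 0 := by rw [h1]; simp
      have hd : AnalyticAt ℂ (fun z => spDown (spInv (h z)) / (1 - c * spDown (spInv (h z)))) a := by
        refine h2.div (analyticAt_const.sub (analyticAt_const.mul h2)) ?_
        rw [e0]; simp
      refine hd.congr ?_
      have h0 : h a ≠ ((0 : ℂ) : OnePoint ℂ) := by rw [h1]; exact OnePoint.infty_ne_coe 0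
      filter_upwards [hc.eventually_ne h0] with z hz
      generalize h z = w at hz
      induction w using OnePoint.rec with
      | infty => simp [rho_coe_inf]
      | coe v =>
        have hv : v ≠ 0 := fun e => hz (by rw [e])
        rw [rho_coe_coe, spInv_coe, if_neg hv, spDown_coe]
        have : 1 - c * v⁻¹ = (v - c) * v⁻¹ := by field_simp
        rw [this]
        by_cases hvc : v - c = 0
        · simp [hvc]
        · field_simp

end SphAux
/-- **The paper's Proposition, Riemann-sphere case.** Let `n ≥ 2`, let `X₁, …, Xₙ` be nonempty
open connected subsets of the Riemann sphere `ℂ∞` with infinite (equivalently, nonempty and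
indiscrete) complements, and let `Y₁, …, Yₙ` be nonempty open connected subsets of `ℂ∞` whose
complements each contain at least three points. Any proper holomorphic map
`F : X₁ × ⋯ × Xₙ → Y₁ × ⋯ × Yₙ` with finite fibers splits: each component `Fᵢ` depends only
on the variable `z_{π i}` for some permutation `π`. -/
theorem sphere_proposition (n : ℕ) (hn : 2 ≤ n) (X Y : Fin n → Set (OnePoint ℂ))
    (hXo : ∀ j, IsOpen (X j)) (hXc : ∀ j, IsConnected (X j))
    (hXind : ∀ j, ((X j)ᶜ : Set (OnePoint ℂ)).Infinite)
    (hYo : ∀ j, IsOpen (Y j)) (hYc : ∀ j, IsConnected (Y j))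
    (hYhyp : ∀ j, ∃ a b c : OnePoint ℂ, a ≠ b ∧ a ≠ c ∧ b ≠ c ∧ {a, b, c} ⊆ (Y j)ᶜ)
    (F : (Fin n → OnePoint ℂ) → (Fin n → OnePoint ℂ))
    (hF : ∀ i, SphHoloOnProd (fun z => F z i) (univ.pi X))
    (hmaps : MapsTo F (univ.pi X) (univ.pi Y))
    (hproper : ∀ K, K ⊆ univ.pi Y → IsCompact K → IsCompact (univ.pi X ∩ F ⁻¹' K))
    (hfin : ∀ w ∈ univ.pi Y, (univ.pi X ∩ F ⁻¹' {w}).Finite) :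
    ∃ (π : Equiv.Perm (Fin n)) (g : Fin n → OnePoint ℂ → OnePoint ℂ),
      (∀ i, SphHoloOnS (g i) (X (π i))) ∧
      (∀ i, MapsTo (g i) (X (π i)) (Y i)) ∧
      (∀ z ∈ univ.pi X, ∀ i, F z i = g i (z (π i))) := by
  have hne := fun j => (hXc j).nonempty
  choose x0 hx0 using hne
  have hx0P : x0 ∈ univ.pi X := fun j _ => hx0 j
  have hpz : ∀ j, ∃ p ζ : OnePoint ℂ, p ∉ X j ∧ ζ ≠ p ∧ ∃ᶠ w in nhdsWithin ζ {ζ}ᶜ, w ∉ X j := by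
    intro j
    obtain ⟨ζ, hζ⟩ := (hXind j).exists_accPt_principal
    obtain ⟨p, hp, hpz⟩ := (hXind j).nontrivial.exists_ne ζ
    exact ⟨p, ζ, hp, hpz.symm, accPt_iff_frequently_nhdsNE.mp hζ⟩
  choose p ζ hp hζp hζ using hpz
  choose a b c hab hac hbc habc using hYhyp
  have haY : ∀ i, a i ∉ Y i := fun i => habc i (by simp)
  have hbY : ∀ i, b i ∉ Y i := fun i => habc i (by simp)
  have hcY : ∀ i, c i ∉ Y i := fun i => habc i (by simp)
  have hXp : ∀ {j w}, w ∈ X j → w ≠ p j := fun {j w} hw e => hp j (e ▸ hw)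
  have hYcne : ∀ {i w}, w ∈ Y i → w ≠ c i := fun {j w} hw e => hcY j (e ▸ hw)
  let U : Fin n → Set ℂ := fun j => SphAux.sig (p j) ⁻¹' X j
  let V : Fin n → Set ℂ := fun i => SphAux.sig (c i) ⁻¹' Y i
  let S : (Fin n → ℂ) → Fin n → OnePoint ℂ := fun t k => SphAux.sig (p k) (t k)
  let R : (Fin n → OnePoint ℂ) → Fin n → ℂ := fun w k => SphAux.rho (p k) (w k)
  have hSc : Continuous S := continuous_pi fun k => (SphAux.sig_cont _).comp (continuous_apply k)
  have hSR : ∀ w ∈ univ.pi X, S (R w) = w := fun w hw =>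
    funext fun k => SphAux.sig_rho (hXp (hw k trivial))
  have hSU : ∀ t ∈ univ.pi U, S t ∈ univ.pi X := fun t ht k _ => ht k trivial
  have hRU : ∀ w ∈ univ.pi X, R w ∈ univ.pi U := fun w hw k _ => by
    change SphAux.sig (p k) (SphAux.rho (p k) (w k)) ∈ X k
    rw [SphAux.sig_rho (hXp (hw k trivial))]; exact hw k trivial
  let f : (Fin n → ℂ) → Fin n → ℂ := fun t i => SphAux.rho (c i) (F (S t) i)
  have hsf : ∀ t ∈ univ.pi U, ∀ i, SphAux.sig (c i) (f t i) = F (S t) i := fun t ht i =>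
    SphAux.sig_rho (hYcne (hmaps (hSU t ht) i trivial))
  obtain ⟨π, hπ⟩ : ∃ π : Equiv.Perm (Fin n), ∀ i, ∀ x ∈ univ.pi U, ∀ y ∈ univ.pi U,
      x (π i) = y (π i) → f x i = f y i := by
    refine SphAux.planar (V := V) (ζ := fun j => SphAux.rho (p j) (ζ j))
      (α := fun i => SphAux.rho (c i) (a i)) (β := fun i => SphAux.rho (c i) (b i))
      ?_ ?_ ⟨R x0, hRU x0 hx0P⟩ ?_ ?_ ?_ ?_ ?_ ?_ ?_
    · exact fun j => (hXo j).preimage (SphAux.sig_cont _)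
    · intro j
      have : U j = SphAux.rho (p j) '' X j := by
        ext t
        constructor
        · intro ht; exact ⟨_, ht, SphAux.rho_sig _ _⟩
        · rintro ⟨w, hw, rfl⟩
          change SphAux.sig (p j) (SphAux.rho (p j) w) ∈ X j
          rwa [SphAux.sig_rho (hXp hw)]
      rw [this]
      exact (hXc j).isPreconnected.image _ fun w hw =>
        (SphAux.rho_cont (hXp hw)).continuousWithinAt
    · intro j
      have hnear : ∀ᶠ w in nhds (ζ j), w ≠ p j := isOpen_ne.mem_nhds (hζp j)
      have ht : Filter.Tendsto (SphAux.rho (p j)) (nhdsWithin (ζ j) {ζ j}ᶜ)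
          (nhdsWithin (SphAux.rho (p j) (ζ j)) {SphAux.rho (p j) (ζ j)}ᶜ) := by
        refine tendsto_nhdsWithin_iff.mpr
          ⟨(SphAux.rho_cont (hζp j)).tendsto.mono_left nhdsWithin_le_nhds, ?_⟩
        filter_upwards [self_mem_nhdsWithin, hnear.filter_mono nhdsWithin_le_nhds] with w hw hwp
        intro e
        have e : SphAux.rho (p j) w = SphAux.rho (p j) (ζ j) := e
        apply hw
        have := congrArg (SphAux.sig (p j)) e
        rwa [SphAux.sig_rho hwp, SphAux.sig_rho (hζp j)] at this
      refine ht.frequently (((hζ j).and_eventually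
        (hnear.filter_mono nhdsWithin_le_nhds)).mono fun w hw => ?_)
      intro hm
      have hm : SphAux.sig (p j) (SphAux.rho (p j) w) ∈ X j := hm
      rw [SphAux.sig_rho hw.2] at hm
      exact hw.1 hm
    · intro i e
      have e : SphAux.rho (c i) (a i) = SphAux.rho (c i) (b i) := e
      have := congrArg (SphAux.sig (c i)) e
      rw [SphAux.sig_rho (hac i), SphAux.sig_rho (hbc i)] at this
      exact hab i this
    · intro i hm
      have hm : SphAux.sig (c i) (SphAux.rho (c i) (a i)) ∈ Y i := hm
      rw [SphAux.sig_rho (hac i)] at hm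
      exact haY i hm
    · intro i hm
      have hm : SphAux.sig (c i) (SphAux.rho (c i) (b i)) ∈ Y i := hm
      rw [SphAux.sig_rho (hbc i)] at hm
      exact hbY i hm
    · intro i t0 ht0
      have hloc := fun k => SphAux.sig_local (p k) (t0 k)
      choose u hu hu0 hue using hloc
      have hφ : AnalyticAt ℂ (fun t : Fin n → ℂ => fun k => u k (t k)) t0 := by
        rw [analyticAt_pi_iff]
        intro k
        have hpr : AnalyticAt ℂ (fun t : Fin n → ℂ => t k) t0 :=
          (ContinuousLinearMap.proj (R := ℂ) (φ := fun _ : Fin n => ℂ) k).analyticAt t0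
        exact AnalyticAt.comp (g := u k) (f := fun t : Fin n → ℂ => t k) (hu k) hpr
      have h1 := SphAux.holo_comp (hF i (S t0) (hSU t0 ht0)) hφ (funext hu0)
      have h2 : SphHoloAt (fun t => F (S t) i) t0 := by
        refine SphAux.holo_congr h1 ?_
        have hev : ∀ᶠ t : Fin n → ℂ in nhds t0, ∀ k,
            SphAux.sig (p k) (t k) = sphChart (S t0 k) (u k (t k)) := by
          rw [Filter.eventually_all]
          intro k
          exact ((continuous_apply k).tendsto t0).eventually (hue k)
        filter_upwards [hev] with t ht
        have : S t = fun k => sphChart (S t0 k) (u k (t k)) := funext ht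
        simp only [← this]
      exact SphAux.holo_rho h2 (hYcne (hmaps (hSU t0 ht0) i trivial))
    · intro t ht i
      change SphAux.sig (c i) (f t i) ∈ Y i
      rw [hsf t ht i]
      exact hmaps (hSU t ht) i trivial
    · intro K hK x hx j z0 hz0
      have hL : IsCompact (univ.pi fun i => SphAux.sig (c i) '' K i) :=
        isCompact_univ_pi fun i => (hK i).1.image (SphAux.sig_cont _)
      have hLY : (univ.pi fun i => SphAux.sig (c i) '' K i) ⊆ univ.pi Y := by
        intro w hw i _
        obtain ⟨v, hv, e⟩ := hw i trivial
        rw [← e]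
        exact (hK i).2 hv
      have hQ := (hproper _ hLY hL).isClosed
      have hcont : Continuous fun z : ℂ => S (Function.update x j z) :=
        hSc.comp (continuous_const.update j continuous_id)
      have hn : S (Function.update x j z0) ∉
          univ.pi X ∩ F ⁻¹' (univ.pi fun i => SphAux.sig (c i) '' K i) := by
        rintro ⟨h1, _⟩
        have := h1 j trivial
        simp only [S, Function.update_self] at this
        exact hz0 this
      have hev := hcont.continuousAt.eventually (hQ.isOpen_compl.mem_nhds hn)
      rw [eventually_nhdsWithin_iff]
      filter_upwards [hev] with z hz hzU
      have hm := SphAux.update_mem hx hzU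
      by_contra hcon
      push Not at hcon
      refine hz ⟨hSU _ hm, fun i _ => ⟨_, hcon i, hsf _ hm i⟩⟩
  refine ⟨π, fun i w => F (Function.update x0 (π i) w) i, ?_, ?_, ?_⟩
  · intro i w hw
    have hq := SphAux.update_mem hx0P hw
    set q := Function.update x0 (π i) w with hqd
    have hφ : AnalyticAt ℂ (fun z : ℂ => Function.update (fun k => sphChartPt (q k)) (π i) z)
        (sphChartPt w) := by
      rw [analyticAt_pi_iff]
      intro k
      by_cases hk : k = π i
      · subst hk; simp only [Function.update_self]; exact analyticAt_id
      · simp only [Function.update_of_ne hk]; exact analyticAt_const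
    have hqw : q (π i) = w := by simp [hqd]
    have h1 := SphAux.holo_comp (hF i q hq) hφ (by rw [← hqw]; exact Function.update_eq_self _ _)
    refine SphAux.holo_congr h1 (Filter.Eventually.of_forall fun z => ?_)
    have : (fun k => sphChart (q k) (Function.update (fun k => sphChartPt (q k)) (π i) z k))
        = Function.update x0 (π i) (sphChart w z) := by
      funext k
      by_cases hk : k = π i
      · subst hk; simp [hqw]
      · rw [Function.update_of_ne hk, Function.update_of_ne hk, SphAux.sphChart_pt, hqd,
          Function.update_of_ne hk]
    simp only [this]
  · intro i w hw
    exact hmaps (SphAux.update_mem hx0P hw) i trivial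
  · intro z hz i
    have hm := SphAux.update_mem hx0P (hz (π i) trivial)
    have := hπ i (R z) (hRU z hz) (R (Function.update x0 (π i) (z (π i)))) (hRU _ hm) (by simp [R])
    have h2 := congrArg (SphAux.sig (c i)) this
    rwa [hsf _ (hRU z hz), hsf _ (hRU _ hm), hSR z hz, hSR _ hm] at h2
end

section
/- Let D ⊆ U be open connected subsets of ℂ such that U ∖ D is nonempty and has a limit point belonging to U. Let (φ_{μν}), 1 ≤ μ ≤ k, 1 ≤ ν ≤ l, be a matrix of holomorphic functions on D, and suppose that for every ζ ∈ ∂D ∩ U one has ∏_{ν=1}^{l} ∑_{μ=1}^{k} |φ_{μν}(z)|² → 0 as z → ζ with z ∈ D. Then there exists ν₀ with 1 ≤ ν₀ ≤ l such that φ_{μν₀} ≡ 0 on D for every μ = 1,…,k. -/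
open Set Filter

namespace RadoAux
open Topology Metric

lemma pow_compare {x M a G : ℝ} (hM : 0 ≤ M) (ha : 0 < a)
    (h : ∀ N : ℕ, x ^ N * a ≤ M ^ N * G) : x ≤ M := by
  by_contra hlt
  push Not at hlt
  rcases hM.eq_or_lt with h0 | h0
  · have := h 1
    rw [← h0] at this hlt
    have : 0 < x * a := mul_pos hlt ha
    simp at *
    linarith
  · have h1 : 1 < x / M := by rwa [one_lt_div h0]
    obtain ⟨N, hN⟩ := pow_unbounded_of_one_lt (G / a) h1
    have := h N
    rw [div_pow, div_lt_div_iff₀ ha (by positivity)] at hN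
    nlinarith

lemma omega_open {U : Set ℂ} (hU : IsOpen U) {g : ℂ → ℂ} (hg : ContinuousOn g U) :
    IsOpen {z | z ∈ U ∧ g z ≠ 0} :=
  hg.isOpen_inter_preimage hU isOpen_compl_singleton

lemma max_principle {U : Set ℂ} (hU : IsOpen U) {g h : ℂ → ℂ} (hg : ContinuousOn g U)
    (hd : DifferentiableOn ℂ g {z | z ∈ U ∧ g z ≠ 0})
    {p : ℂ} {r : ℝ} (hr : closedBall p r ⊆ U)
    (hh : DifferentiableOn ℂ h {z | z ∈ U ∧ g z ≠ 0})
    {K M : ℝ} (hK : ∀ z ∈ closedBall p r, g z ≠ 0 → ‖h z‖ ≤ K)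
    (hM0 : 0 ≤ M) (hM : ∀ z ∈ sphere p r, g z ≠ 0 → ‖h z‖ ≤ M)
    {z : ℂ} (hz : z ∈ closedBall p r) (hgz : g z ≠ 0) : ‖h z‖ ≤ M := by
  by_cases hzs : z ∈ sphere p r
  · exact hM z hzs hgz
  have hzb : z ∈ ball p r := by
    simp only [mem_sphere, mem_closedBall, mem_ball] at *
    exact lt_of_le_of_ne hz hzs
  have hΩ := omega_open hU hg
  obtain ⟨G, hG⟩ := (isCompact_closedBall p r).exists_bound_of_continuousOn (hg.mono hr)
  refine pow_compare (a := ‖g z‖) (G := G) hM0 (norm_pos_iff.2 hgz) fun N => ?_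
  set V : Set ℂ := ball p r ∩ {z | z ∈ U ∧ g z ≠ 0} with hV
  have hVo : IsOpen V := isOpen_ball.inter hΩ
  have hVcl : closure V ⊆ closedBall p r :=
    (closure_mono inter_subset_left).trans closure_ball_subset_closedBall
  have key : ‖h z ^ N * g z‖ ≤ M ^ N * G := by
    refine Complex.norm_le_of_forall_mem_frontier_norm_le (f := fun z => h z ^ N * g z)
      (U := V) (isBounded_ball.subset inter_subset_left) ⟨?_, ?_⟩ ?_
      (subset_closure ⟨hzb, hr hz, hgz⟩)
    · exact ((hh.pow N).mul hd).mono inter_subset_right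
    · intro x hx
      have hxb := hVcl hx
      by_cases hgx : g x = 0
      · have hgc : Tendsto (fun y => K ^ N * ‖g y‖) (𝓝[closure V] x) (𝓝 0) := by
          have := (((hg.mono hr).mono hVcl) x hx).norm.const_mul (K ^ N)
          simpa [ContinuousWithinAt, hgx] using this
        rw [ContinuousWithinAt, hgx, mul_zero]
        refine squeeze_zero_norm' ?_ hgc
        filter_upwards [self_mem_nhdsWithin] with y hy
        by_cases hgy : g y = 0
        · simp [hgy]
        · rw [norm_mul, norm_pow]
          gcongr
          exact hK y (hVcl hy) hgy
      · have hxΩ : {z | z ∈ U ∧ g z ≠ 0} ∈ 𝓝 x := hΩ.mem_nhds ⟨hr hxb, hgx⟩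
        exact (((hh.differentiableAt hxΩ).pow N).mul
          (hd.differentiableAt hxΩ)).continuousAt.continuousWithinAt
    · intro x hx
      have hxb := hVcl hx.1
      have hG0 : 0 ≤ G := (norm_nonneg _).trans (hG x hxb)
      by_cases hgx : g x = 0
      · simp only [hgx, mul_zero, norm_zero]; positivity
      · have hxs : x ∈ sphere p r := by
          rw [hVo.frontier_eq] at hx
          by_contra hns
          exact hx.2 ⟨lt_of_le_of_ne hxb hns, hr hxb, hgx⟩
        rw [norm_mul, norm_pow]
        gcongr
        · exact hM x hxs hgx
        · exact hG x hxb
  simpa using key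

lemma lipschitz_zero {U : Set ℂ} (hU : IsOpen U) {g : ℂ → ℂ} (hg : ContinuousOn g U)
    (hd : DifferentiableOn ℂ g {z | z ∈ U ∧ g z ≠ 0})
    {p : ℂ} {r : ℝ} (hr0 : 0 < r) (hr : closedBall p r ⊆ U)
    {β : ℂ} (hβ : β ∈ ball p (r / 2)) (hgβ : g β = 0) :
    ∃ C : ℝ, ∀ᶠ z in 𝓝 β, ‖g z‖ ≤ C * ‖z - β‖ := by
  have hΩ := omega_open hU hg
  obtain ⟨G, hG⟩ := (isCompact_closedBall p r).exists_bound_of_continuousOn (hg.mono hr)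
  have hG0 : 0 ≤ G := (norm_nonneg _).trans (hG p (mem_closedBall_self hr0.le))
  have hβb : β ∈ ball p r := ball_subset_ball (by linarith) hβ
  by_cases hcl : β ∈ closure {z | z ∈ U ∧ g z ≠ 0}
  · refine ⟨2 * G / (r / 2), ?_⟩
    filter_upwards [isOpen_ball.mem_nhds hβb] with z hz
    by_cases hgz : g z = 0
    · rw [hgz, norm_zero]; positivity
    have hz' := ball_subset_closedBall hz
    have hne : (𝓝[{z | z ∈ U ∧ g z ≠ 0}] β).NeBot := mem_closure_iff_nhdsWithin_neBot.1 hcl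
    have hgc : Tendsto g (𝓝[{z | z ∈ U ∧ g z ≠ 0}] β) (𝓝 0) := by
      have := (hg.continuousAt (hU.mem_nhds (hr (ball_subset_closedBall hβb)))).tendsto
      rw [hgβ] at this
      exact this.mono_left nhdsWithin_le_nhds
    have hid : Tendsto (fun w : ℂ => w) (𝓝[{z | z ∈ U ∧ g z ≠ 0}] β) (𝓝 β) :=
      tendsto_id.mono_left nhdsWithin_le_nhds
    have h1 : Tendsto (fun w => ‖g z - g w‖) (𝓝[{z | z ∈ U ∧ g z ≠ 0}] β) (𝓝 ‖g z‖) := by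
      simpa using (hgc.const_sub (g z)).norm
    have h2 := ((hid.const_sub z).norm).const_mul (2 * G / (r / 2))
    refine le_of_tendsto_of_tendsto h1 h2 ?_
    filter_upwards [self_mem_nhdsWithin, nhdsWithin_le_nhds (isOpen_ball.mem_nhds hβ)]
      with w hw hwb
    have hwn : {z | z ∈ U ∧ g z ≠ 0} ∈ 𝓝 w := hΩ.mem_nhds hw
    have hc : ContinuousOn (dslope g w) U :=
      (continuousOn_dslope (hU.mem_nhds hw.1)).2 ⟨hg, hd.differentiableAt hwn⟩
    obtain ⟨K, hK⟩ := (isCompact_closedBall p r).exists_bound_of_continuousOn (hc.mono hr)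
    have hmax : ‖dslope g w z‖ ≤ 2 * G / (r / 2) := by
      refine max_principle hU hg hd hr ((Complex.differentiableOn_dslope hwn).2 hd)
        (fun z hz _ => hK z hz) (by positivity) ?_ hz' hgz
      intro x hx _
      have hdist : r / 2 ≤ ‖x - w‖ := by
        have e1 : dist x p = r := hx
        have e2 : dist w p < r / 2 := hwb
        have := dist_triangle x w p
        rw [← dist_eq_norm]; linarith
      have hxw : x ≠ w := by
        rintro rfl; simp at hdist; linarith
      rw [dslope_of_ne _ hxw, slope_def_field, norm_div]
      have e3 := hG x (sphere_subset_closedBall hx)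
      have e4 := hG w (ball_subset_closedBall (ball_subset_ball (by linarith) hwb))
      have e5 := norm_sub_le (g x) (g w)
      gcongr
      linarith
    have := sub_smul_dslope g w z
    rw [← this, norm_smul, mul_comm]
    gcongr
  · refine ⟨0, ?_⟩
    have : (closure {z | z ∈ U ∧ g z ≠ 0})ᶜ ∈ 𝓝 β := isClosed_closure.isOpen_compl.mem_nhds hcl
    filter_upwards [this, isOpen_ball.mem_nhds hβb] with z hz hzb
    have : g z = 0 := by
      by_contra hgz
      exact hz (subset_closure ⟨hr (ball_subset_closedBall hzb), hgz⟩)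
    simp [this]

lemma prod_bound {U : Set ℂ} (hU : IsOpen U) {g : ℂ → ℂ} (hg : ContinuousOn g U)
    (hd : DifferentiableOn ℂ g {z | z ∈ U ∧ g z ≠ 0})
    {p : ℂ} {r : ℝ} (hr0 : 0 < r) (hr : closedBall p r ⊆ U)
    (S : Finset ℂ) (hS : ∀ β ∈ S, β ∈ ball p (r / 2) ∧ g β = 0) :
    ∃ K : ℝ, ∀ z ∈ closedBall p r, ‖g z‖ ≤ K * ‖∏ β ∈ S, (z - β)‖ := by
  refine (isCompact_closedBall p r).induction_on
    (p := fun s => ∃ K : ℝ, ∀ z ∈ s, ‖g z‖ ≤ K * ‖∏ β ∈ S, (z - β)‖) ⟨0, by simp⟩ ?_ ?_ ?_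
  · rintro s t hst ⟨K, hK⟩
    exact ⟨K, fun z hz => hK z (hst hz)⟩
  · rintro s t ⟨K, hK⟩ ⟨L, hL⟩
    refine ⟨max K L, fun z hz => ?_⟩
    rcases hz with hz | hz
    · exact (hK z hz).trans (by gcongr; exact le_max_left _ _)
    · exact (hL z hz).trans (by gcongr; exact le_max_right _ _)
  · intro x hx
    suffices H : ∃ K : ℝ, ∀ᶠ z in 𝓝 x, ‖g z‖ ≤ K * ‖∏ β ∈ S, (z - β)‖ by
      obtain ⟨K, hK⟩ := H
      exact ⟨_, nhdsWithin_le_nhds hK, K, fun z hz => hz⟩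
    have hO : ∀ T : Finset ℂ, x ∉ T →
        (fun _ : ℂ => (1 : ℂ)) =O[𝓝 x] (fun z => ∏ β ∈ T, (z - β)) := by
      intro T hT
      have hc : ContinuousAt (fun z : ℂ => ∏ β ∈ T, (z - β)) x := by fun_prop
      have hne : ∏ β ∈ T, (x - β) ≠ 0 := by
        rw [Finset.prod_ne_zero_iff]
        intro β hβ h0
        exact hT (by rwa [sub_eq_zero.1 h0])
      refine (Asymptotics.isBigO_const_left_iff_pos_le_norm one_ne_zero).2
        ⟨‖∏ β ∈ T, (x - β)‖ / 2, by have := norm_pos_iff.2 hne; positivity, ?_⟩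
      have := hc.norm.eventually (lt_mem_nhds (half_lt_self (norm_pos_iff.2 hne)))
      filter_upwards [this] with z hz using hz.le
    have hfin : g =O[𝓝 x] (fun z => ∏ β ∈ S, (z - β)) := by
      by_cases hxS : x ∈ S
      · obtain ⟨hb, h0⟩ := hS x hxS
        obtain ⟨C, hC⟩ := lipschitz_zero hU hg hd hr0 hr hb h0
        have h1 : g =O[𝓝 x] (fun z => z - x) := Asymptotics.IsBigO.of_bound C hC
        have := h1.mul (hO (S.erase x) (Finset.notMem_erase x S))
        refine this.congr (fun z => mul_one _) (fun z => ?_)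
        exact Finset.mul_prod_erase S (fun β => z - β) hxS
      · have h1 : g =O[𝓝 x] (fun _ => (1 : ℂ)) :=
          (hg.continuousAt (hU.mem_nhds (hr hx))).tendsto.isBigO_one ℂ
        exact h1.trans (hO S hxS)
    exact hfin.bound

lemma local_zero {U : Set ℂ} (hU : IsOpen U) {g : ℂ → ℂ} (hg : ContinuousOn g U)
    (hd : DifferentiableOn ℂ g {z | z ∈ U ∧ g z ≠ 0})
    {p : ℂ} (hp : p ∈ U) (hf : ∃ᶠ z in 𝓝[≠] p, g z = 0) : ∀ᶠ z in 𝓝 p, g z = 0 := by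
  obtain ⟨r, hr0, hr⟩ := nhds_basis_closedBall.mem_iff.1 (hU.mem_nhds hp)
  obtain ⟨G, hG⟩ := (isCompact_closedBall p r).exists_bound_of_continuousOn (hg.mono hr)
  have hG0 : 0 ≤ G := (norm_nonneg _).trans (hG p (mem_closedBall_self hr0.le))
  have hinf : {z | z ∈ ball p (r / 4) ∧ g z = 0}.Infinite := by
    intro hfin
    have h1 : ∀ᶠ z in 𝓝[≠] p, z ∉ {z | z ∈ ball p (r / 4) ∧ g z = 0} :=
      nhdsNE_le_cofinite p hfin.compl_mem_cofinite
    have h2 : ∀ᶠ z in 𝓝[≠] p, z ∈ ball p (r / 4) :=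
      nhdsWithin_le_nhds (ball_mem_nhds p (by linarith))
    obtain ⟨z, hz, hz1, hz2⟩ := (hf.and_eventually (h1.and h2)).exists
    exact hz1 ⟨hz2, hz⟩
  filter_upwards [ball_mem_nhds p (show 0 < r / 4 by linarith)] with z hz
  by_contra hgz
  have hzc : z ∈ closedBall p r := ball_subset_closedBall (ball_subset_ball (by linarith) hz)
  have hb : ∀ n : ℕ, ‖g z‖ ≤ G * (2 / 3) ^ n := by
    intro n
    obtain ⟨S, hS, hcard⟩ := hinf.exists_subset_card_eq n
    have hS' : ∀ β ∈ S, β ∈ ball p (r / 4) ∧ g β = 0 := fun β hβ => hS hβ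
    obtain ⟨K, hK⟩ := prod_bound hU hg hd hr0 hr S
      (fun β hβ => ⟨ball_subset_ball (by linarith) (hS' β hβ).1, (hS' β hβ).2⟩)
    have hne : ∀ x, g x ≠ 0 → ∏ β ∈ S, (x - β) ≠ 0 := by
      intro x hx
      rw [Finset.prod_ne_zero_iff]
      intro β hβ h0
      rw [sub_eq_zero.1 h0] at hx
      exact hx (hS' β hβ).2
    have hmax : ‖g z / ∏ β ∈ S, (z - β)‖ ≤ G / (3 * r / 4) ^ n := by
      refine max_principle (h := fun z => g z / ∏ β ∈ S, (z - β)) (K := K) hU hg hd hr ?_ ?_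
        (by positivity) ?_ hzc hgz
      · refine hd.div ?_ (fun x hx => hne x hx.2)
        fun_prop
      · intro x hx hgx
        rw [norm_div, div_le_iff₀ (norm_pos_iff.2 (hne x hgx))]
        exact hK x hx
      · intro x hx hgx
        rw [norm_div]
        gcongr
        · exact hG x (sphere_subset_closedBall hx)
        · rw [norm_prod, ← hcard]
          rw [← Finset.prod_const]
          refine Finset.prod_le_prod (fun _ _ => by positivity) fun β hβ => ?_
          have e1 : dist x p = r := hx
          have e2 : dist β p < r / 4 := (hS' β hβ).1
          have := dist_triangle x β p
          rw [← dist_eq_norm]; linarith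
    rw [norm_div, div_le_iff₀ (norm_pos_iff.2 (hne z hgz))] at hmax
    refine hmax.trans ?_
    have hprod : ‖∏ β ∈ S, (z - β)‖ ≤ (r / 2) ^ n := by
      rw [norm_prod, ← hcard, ← Finset.prod_const]
      refine Finset.prod_le_prod (fun _ _ => norm_nonneg _) fun β hβ => ?_
      have e1 : dist z p < r / 4 := hz
      have e2 : dist β p < r / 4 := (hS' β hβ).1
      have := dist_triangle_right z β p
      rw [← dist_eq_norm]; linarith
    calc G / (3 * r / 4) ^ n * ‖∏ β ∈ S, (z - β)‖ ≤ G / (3 * r / 4) ^ n * (r / 2) ^ n := by gcongr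
      _ = G * (2 / 3) ^ n := by
        rw [div_mul_eq_mul_div, mul_div_assoc, ← div_pow]
        congr 2
        field_simp
        norm_num
  have hlim : Tendsto (fun n : ℕ => G * (2 / 3 : ℝ) ^ n) atTop (𝓝 0) := by
    simpa using (tendsto_pow_atTop_nhds_zero_of_lt_one (by norm_num : (0 : ℝ) ≤ 2 / 3)
      (by norm_num)).const_mul G
  have := ge_of_tendsto' hlim hb
  exact hgz (norm_le_zero_iff.1 this)

lemma global_zero {U : Set ℂ} (hU : IsOpen U) (hUc : IsConnected U) {g : ℂ → ℂ}
    (hg : ContinuousOn g U) (hd : DifferentiableOn ℂ g {z | z ∈ U ∧ g z ≠ 0})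
    {p : ℂ} (hp : p ∈ U) (hf : ∃ᶠ z in 𝓝[≠] p, g z = 0) : ∀ z ∈ U, g z = 0 := by
  have hsub : U ⊆ {x | ∀ᶠ z in 𝓝 x, g z = 0} := by
    refine hUc.isPreconnected.subset_of_closure_inter_subset isOpen_setOfPred_eventually_nhds
      ⟨p, hp, local_zero hU hg hd hp hf⟩ ?_
    rintro x ⟨hx, hxU⟩
    by_contra hxu
    refine hxu (local_zero hU hg hd hxU ?_)
    rw [mem_closure_iff_frequently] at hx
    rw [frequently_nhdsWithin_iff]
    refine hx.mono fun y hy => ⟨hy.self_of_nhds, ?_⟩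
    rintro rfl
    exact hxu hy
  exact fun z hz => (hsub hz).self_of_nhds

lemma prod_zero {D : Set ℂ} (hDo : IsOpen D) (hDc : IsConnected D) {ι : Type*} (s : Finset ι)
    (f : ι → ℂ → ℂ) (hf : ∀ i, DifferentiableOn ℂ (f i) D)
    (h : ∀ z ∈ D, ∏ i ∈ s, f i z = 0) : ∃ i ∈ s, ∀ z ∈ D, f i z = 0 := by
  classical
  induction s using Finset.induction_on with
  | empty =>
    obtain ⟨z, hz⟩ := hDc.nonempty
    simpa using h z hz
  | insert a s ha ih =>
    simp only [Finset.prod_insert ha] at h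
    have hp : DifferentiableOn ℂ (fun z => ∏ i ∈ s, f i z) D :=
      DifferentiableOn.fun_finsetProd fun i _ => hf i
    rcases AnalyticOnNhd.eq_zero_or_eq_zero_of_mul_eq_zero ((hf a).analyticOnNhd hDo)
      (hp.analyticOnNhd hDo) h hDc.isPreconnected with h1 | h1
    · exact ⟨a, by simp, h1⟩
    · obtain ⟨i, hi, h2⟩ := ih h1
      exact ⟨i, by simp [hi], h2⟩

end RadoAux

/-- **Generalization of Rado's theorem.** Let `D ⊆ U` be open connected subsets of `ℂ` with
`U ∖ D` nonempty and having a limit point in `U`. If `(φ μ ν)` is a matrix of holomorphic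
functions on `D` such that `∏ ν ∑ μ |φ μ ν z|² → 0` as `z → ζ` within `D`, for every
`ζ ∈ ∂D ∩ U`, then some column of the matrix vanishes identically on `D`. -/
theorem rado_generalization (k l : ℕ) (hk : 0 < k) (hl : 0 < l)
    (D U : Set ℂ) (hDo : IsOpen D) (hDc : IsConnected D)
    (hUo : IsOpen U) (hUc : IsConnected U) (hDU : D ⊆ U)
    (hne : (U \ D).Nonempty)
    (hlim : ∃ p ∈ U, p ∈ closure ((U \ D) \ {p}))
    (φ : Fin k → Fin l → ℂ → ℂ)
    (hφ : ∀ μ ν, DifferentiableOn ℂ (φ μ ν) D)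
    (hbd : ∀ ζ ∈ frontier D ∩ U,
      Tendsto (fun z => ∏ ν : Fin l, ∑ μ : Fin k, ‖φ μ ν z‖ ^ 2)
        (nhdsWithin ζ D) (nhds 0)) :
    ∃ ν₀ : Fin l, ∀ μ : Fin k, ∀ z ∈ D, φ μ ν₀ z = 0 := by
  classical
  by_contra hcon
  push Not at hcon
  choose m w hw hwne using hcon
  set f : ℂ → ℂ := fun z => ∏ ν, φ (m ν) ν z with hf
  have hfd : DifferentiableOn ℂ f D := DifferentiableOn.fun_finsetProd fun ν _ => hφ (m ν) ν
  have hfle : ∀ z, ‖f z‖ ^ 2 ≤ ∏ ν : Fin l, ∑ μ : Fin k, ‖φ μ ν z‖ ^ 2 := by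
    intro z
    rw [hf, norm_prod, ← Finset.prod_pow]
    refine Finset.prod_le_prod (fun _ _ => by positivity) fun ν _ => ?_
    exact Finset.single_le_sum (f := fun μ => ‖φ μ ν z‖ ^ 2) (fun _ _ => by positivity)
      (Finset.mem_univ (m ν))
  have hf0 : ∀ ζ ∈ frontier D ∩ U, Tendsto f (nhdsWithin ζ D) (nhds 0) := by
    intro ζ hζ
    have h1 : Tendsto (fun z => ‖f z‖ ^ 2) (nhdsWithin ζ D) (nhds 0) :=
      squeeze_zero (fun _ => by positivity) hfle (hbd ζ hζ)
    have h2 := (Real.continuous_sqrt.tendsto 0).comp h1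
    rw [tendsto_zero_iff_norm_tendsto_zero]
    simpa [Function.comp_def, Real.sqrt_sq (norm_nonneg _)] using h2
  set g : ℂ → ℂ := D.indicator f with hg
  have hgD : ∀ x ∈ D, g =ᶠ[nhds x] f := fun x hx => by
    filter_upwards [hDo.mem_nhds hx] with z hz using indicator_of_mem hz f
  have hgd : ∀ x ∈ D, DifferentiableAt ℂ g x := fun x hx =>
    (hfd.differentiableAt (hDo.mem_nhds hx)).congr_of_eventuallyEq (hgD x hx)
  have hgc : ContinuousOn g U := by
    intro x hxU
    refine ContinuousAt.continuousWithinAt ?_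
    by_cases hxD : x ∈ D
    · exact (hgd x hxD).continuousAt
    have hgx : g x = 0 := indicator_of_notMem hxD f
    rw [ContinuousAt, hgx]
    have hN : Tendsto g (nhdsWithin x Dᶜ) (nhds 0) :=
      tendsto_const_nhds.congr' (by
        filter_upwards [self_mem_nhdsWithin] with z hz using (indicator_of_notMem hz f).symm)
    have hY : Tendsto g (nhdsWithin x D) (nhds 0) := by
      by_cases hcl : x ∈ closure D
      · refine (hf0 x ⟨by rw [hDo.frontier_eq]; exact ⟨hcl, hxD⟩, hxU⟩).congr' ?_
        filter_upwards [self_mem_nhdsWithin] with z hz using (indicator_of_mem hz f).symm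
      · rw [notMem_closure_iff_nhdsWithin_eq_bot.1 hcl]
        exact tendsto_bot
    have := hY.sup hN
    rwa [← nhdsWithin_union, union_compl_self, nhdsWithin_univ] at this
  have hgdo : DifferentiableOn ℂ g {z | z ∈ U ∧ g z ≠ 0} := by
    intro z hz
    refine (hgd z ?_).differentiableWithinAt
    by_contra hzD
    exact hz.2 (indicator_of_notMem hzD f)
  obtain ⟨p, hpU, hp⟩ := hlim
  have hfr : ∃ᶠ z in nhdsWithin p {p}ᶜ, g z = 0 := by
    rw [mem_closure_iff_frequently] at hp
    rw [frequently_nhdsWithin_iff]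
    exact hp.mono fun z hz => ⟨indicator_of_notMem hz.1.2 f, hz.2⟩
  have hz := RadoAux.global_zero hUo hUc hgc hgdo hpU hfr
  obtain ⟨ν, _, hν⟩ := RadoAux.prod_zero hDo hDc Finset.univ (fun ν => φ (m ν) ν)
    (fun ν => hφ (m ν) ν) (fun z hzD => by
      have := hz z (hDU hzD)
      rwa [hg, indicator_of_mem hzD] at this)
  exact hwne ν (hν _ (hw ν))
end

section
/- Let A ⊆ ℂ∞ be a finite subset of the Riemann sphere, and let Y ⊆ ℂ∞ be a nonempty open connected set whose complement ℂ∞ ∖ Y is infinite (equivalently, nonempty and indiscrete, since ℂ∞ is compact). Then every holomorphic map f : ℂ∞ ∖ A → Y is constant. -/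
open Set OnePoint
open scoped Classical

open Metric Filter Topology in
theorem bloch_aux {h : ℂ → ℂ} {c : ℂ} {R : ℝ} (hR : 0 < R)
    (hd : ∀ z ∈ closedBall c R, AnalyticAt ℂ h z) (h0 : deriv h c ≠ 0) :
    ∃ p, ball (h p) (R * ‖deriv h c‖ / 48) ⊆ h '' closedBall c R := by
  have hcont : ContinuousOn (fun z => (R - dist z c) * ‖deriv h z‖) (closedBall c R) := by
    apply ContinuousOn.mul (by fun_prop)
    intro z hz
    exact ((hd z hz).deriv.continuousAt.norm).continuousWithinAt
  obtain ⟨p, hp, hmax⟩ := (isCompact_closedBall c R).exists_isMaxOn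
    ⟨c, mem_closedBall_self hR.le⟩ hcont
  have hmax' : ∀ z ∈ closedBall c R, (R - dist z c) * ‖deriv h z‖ ≤ (R - dist p c) * ‖deriv h p‖ :=
    fun z hz => hmax hz
  have hc := hmax' c (mem_closedBall_self hR.le)
  simp only [dist_self, sub_zero] at hc
  have hpos : 0 < R * ‖deriv h c‖ := mul_pos hR (norm_pos_iff.2 h0)
  have hpR : dist p c ≤ R := hp
  have hprod : 0 < (R - dist p c) * ‖deriv h p‖ := lt_of_lt_of_le hpos hc
  have hdp : 0 < ‖deriv h p‖ := by
    rcases (norm_nonneg (deriv h p)).eq_or_lt with h1 | h1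
    · rw [← h1] at hprod; simp at hprod
    · exact h1
  have hr2 : 0 < R - dist p c := pos_of_mul_pos_left hprod hdp.le
  obtain ⟨r, hr⟩ : ∃ r, r = (R - dist p c) / 2 := ⟨_, rfl⟩
  have hr0 : 0 < r := by linarith
  have hsub : ∀ z ∈ ball p r, dist z c ≤ R - r := by
    intro z hz
    have := dist_triangle z p c
    have h2 : dist z p < r := hz
    linarith
  have hsub' : ∀ z ∈ ball p r, z ∈ closedBall c R := by
    intro z hz
    have := hsub z hz
    rw [mem_closedBall]; linarith
  have hbd : ∀ z ∈ ball p r, ‖deriv h z‖ ≤ 2 * ‖deriv h p‖ := by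
    intro z hz
    have h1 := hmax' z (hsub' z hz)
    have h2 := hsub z hz
    have h3 : r * ‖deriv h z‖ ≤ (R - dist z c) * ‖deriv h z‖ := by gcongr; linarith
    have h4 : r * ‖deriv h z‖ ≤ r * (2 * ‖deriv h p‖) := by
      calc _ ≤ _ := h3
        _ ≤ _ := h1
        _ = _ := by rw [hr]; ring
    exact le_of_mul_le_mul_left h4 hr0
  have hsch : ∀ z ∈ ball p r, dist (deriv h z) (deriv h p) ≤ 3 * ‖deriv h p‖ / r * dist z p := by
    intro z hz
    apply Complex.dist_le_div_mul_dist_of_mapsTo_ball _ _ hz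
    · intro w hw
      exact (hd w (hsub' w hw)).deriv.differentiableAt.differentiableWithinAt
    · intro w hw
      rw [mem_closedBall, dist_eq_norm]
      have := norm_sub_le (deriv h w) (deriv h p)
      have := hbd w hw
      linarith
  have hin : closedBall p (r / 6) ⊆ ball p r := closedBall_subset_ball (by linarith)
  have hk : ∀ z ∈ closedBall p (r / 6),
      ‖(h z - deriv h p * z) - (h p - deriv h p * p)‖ ≤ ‖deriv h p‖ / 2 * ‖z - p‖ := by
    intro z hz
    have hder : ∀ x ∈ closedBall p (r/6), HasDerivAt (fun z => h z - deriv h p * z)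
        (deriv h x - deriv h p) x := by
      intro x hx
      have h1 := (hd x (hsub' x (hin hx))).differentiableAt.hasDerivAt
      have h2 := (hasDerivAt_id x).const_mul (deriv h p)
      simpa using! h1.sub h2
    refine (convex_closedBall p (r/6)).norm_image_sub_le_of_norm_hasDerivWithin_le
      (f := fun z => h z - deriv h p * z) 
      (fun x hx => (hder x hx).hasDerivWithinAt) ?_ (mem_closedBall_self (by linarith)) hz
    intro x hx
    have h1 := hsch x (hin hx)
    rw [dist_eq_norm] at h1
    have h2 : dist x p ≤ r / 6 := hx
    calc _ ≤ _ := h1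
      _ ≤ 3 * ‖deriv h p‖ / r * (r / 6) := by gcongr
      _ = _ := by field_simp; norm_num
  have hsph : ∀ z ∈ sphere p (r / 6), ‖deriv h p‖ * r / 12 ≤ ‖h z - h p‖ := by
    intro z hz
    have h1 := hk z (sphere_subset_closedBall hz)
    have h2 : ‖z - p‖ = r / 6 := by rw [← dist_eq_norm]; exact hz
    have h3 : deriv h p * (z - p) =
      (h z - h p) - ((h z - deriv h p * z) - (h p - deriv h p * p)) := by ring
    have h4 := norm_sub_le (h z - h p) ((h z - deriv h p * z) - (h p - deriv h p * p))
    rw [← h3, norm_mul, h2] at h4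
    rw [h2] at h1
    linarith
  have hfreq : ∃ᶠ z in 𝓝 p, h z ≠ h p := by
    have h1 := (hd p hp).differentiableAt.hasDerivAt.eventually_ne (c := h p) (norm_pos_iff.1 hdp)
    exact h1.frequently.filter_mono nhdsWithin_le_nhds
  have hdc : DiffContOnCl ℂ h (ball p (r / 6)) := by
    apply DifferentiableOn.diffContOnCl_ball (U := ball p r) _ hin
    intro w hw
    exact (hd w (hsub' w hw)).differentiableAt.differentiableWithinAt
  refine ⟨p, ?_⟩
  have key := hdc.ball_subset_image_closedBall (by linarith) hsph hfreq
  refine (ball_subset_ball ?_).trans (key.trans (Set.image_mono (fun z hz => hsub' z (hin hz))))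
  rw [hr]; linarith

open Metric in
theorem exists_log_ball {f : ℂ → ℂ} {c : ℂ} {R : ℝ} (hR : 0 < R)
    (hd : DifferentiableOn ℂ f (ball c R)) (h0 : ∀ z ∈ ball c R, f z ≠ 0) :
    ∃ g : ℂ → ℂ, DifferentiableOn ℂ g (ball c R) ∧ (∀ z ∈ ball c R, Complex.exp (g z) = f z) ∧
      g c = Complex.log (f c) := by
  have h1 : DifferentiableOn ℂ (fun z => deriv f z / f z) (ball c R) :=
    (hd.deriv isOpen_ball).div hd h0
  obtain ⟨g, hgc, hg⟩ := h1.isExactOn_ball.with_val_at c (Complex.log (f c))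
  refine ⟨g, fun z hz => (hg z hz).differentiableAt.differentiableWithinAt, ?_, hgc⟩
  have hder : ∀ z ∈ ball c R, HasDerivAt (fun z => f z * Complex.exp (-g z)) 0 z := by
    intro z hz
    have h2 := (hd.differentiableAt (isOpen_ball.mem_nhds hz)).hasDerivAt
    have h3 := h2.mul ((hg z hz).neg.cexp)
    convert! h3 using 1
    have := h0 z hz
    simp only [Pi.neg_apply]
    field_simp
    ring
  have hconst : ∀ z ∈ ball c R, f z * Complex.exp (-g z) = f c * Complex.exp (-g c) := by
    intro z hz
    have := (convex_ball c R).norm_image_sub_le_of_norm_hasDerivWithin_le (C := 0)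
      (f := fun z => f z * Complex.exp (-g z)) (f' := fun _ => 0)
      (fun x hx => (hder x hx).hasDerivWithinAt) (by simp) (mem_ball_self hR) hz
    simp only [zero_mul, norm_le_zero_iff] at this
    exact sub_eq_zero.1 this
  intro z hz
  have h4 := hconst z hz
  rw [hgc, Complex.exp_neg (Complex.log _), Complex.exp_log (h0 c (mem_ball_self hR)),
    mul_inv_cancel₀ (h0 c (mem_ball_self hR)), Complex.exp_neg] at h4
  field_simp at h4
  exact h4.symm

theorem cosh_net_real (x : ℝ) : ∃ y : ℝ, |y - x| ≤ 2 ∧ ∃ n : ℕ, Real.cosh y ^ 2 = n := by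
  have main : ∀ x : ℝ, 0 ≤ x → ∃ y : ℝ, |y - x| ≤ 2 ∧ ∃ n : ℕ, Real.cosh y ^ 2 = n := by
    intro x hx
    have h1 : (1:ℝ) ≤ Real.cosh x ^ 2 := by
      have := Real.one_le_cosh x
      nlinarith
    obtain ⟨n, hn⟩ : ∃ n, n = ⌊Real.cosh x ^ 2⌋₊ := ⟨_, rfl⟩
    have hn1 : 1 ≤ n := by rw [hn]; exact Nat.le_floor (by simpa using h1)
    have hn1' : (1:ℝ) ≤ n := by exact_mod_cast hn1
    have hn2 : (n:ℝ) ≤ Real.cosh x ^ 2 := by rw [hn]; exact Nat.floor_le (by positivity)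
    have hn3 : Real.cosh x ^ 2 < n + 1 := by rw [hn]; exact Nat.lt_floor_add_one _
    have hs : √(n:ℝ) ∈ Set.Icc (Real.cosh 0) (Real.cosh x) := by
      refine ⟨?_, ?_⟩
      · rw [Real.cosh_zero]; exact Real.one_le_sqrt.2 hn1'
      · exact Real.sqrt_le_iff.2 ⟨(Real.cosh_pos x).le, hn2⟩
    obtain ⟨y, hy, hyn⟩ := intermediate_value_Icc hx Real.continuous_cosh.continuousOn hs
    have hyn2 : Real.cosh y ^ 2 = n := by rw [hyn]; exact Real.sq_sqrt (by positivity)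
    refine ⟨y, ?_, n, hyn2⟩
    have h5 : Real.cosh x ≤ 2 * Real.cosh y := by
      have := Real.cosh_pos y
      have := Real.cosh_pos x
      nlinarith
    have h6 : Real.exp x ≤ 2 * Real.cosh x := by
      rw [Real.cosh_eq]; have := Real.exp_pos (-x); linarith
    have h7 : Real.cosh y ≤ Real.exp y := by
      rw [Real.cosh_eq]
      have : Real.exp (-y) ≤ Real.exp y := Real.exp_le_exp.2 (by linarith [hy.1])
      linarith
    have h8 : (4:ℝ) ≤ Real.exp 2 := by
      have := Real.add_one_le_exp (1:ℝ)
      have h9 : Real.exp 2 = Real.exp 1 * Real.exp 1 := by rw [← Real.exp_add]; norm_num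
      nlinarith
    have h9 : Real.exp x ≤ Real.exp (2 + y) := by
      rw [Real.exp_add]
      have := Real.exp_pos y
      nlinarith
    have h10 := Real.exp_le_exp.1 h9
    rw [abs_le]
    constructor <;> linarith [hy.2]
  rcases le_total 0 x with hx | hx
  · exact main x hx
  · obtain ⟨y, hy, n, hn⟩ := main (-x) (by linarith)
    refine ⟨-y, ?_, n, by simpa using hn⟩
    rw [abs_le] at hy ⊢
    constructor <;> linarith [hy.1, hy.2]

theorem cosh_net (w : ℂ) : ∃ v : ℂ, ‖v - w‖ < 10 ∧ ∃ n : ℕ, Complex.cosh v ^ 2 = n := by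
  obtain ⟨y, hy, n, hn⟩ := cosh_net_real w.re
  obtain ⟨k, hk⟩ : ∃ k, k = round (w.im / (2 * Real.pi)) := ⟨_, rfl⟩
  refine ⟨y + k * (2 * Real.pi * Complex.I), ?_, n, ?_⟩
  · have h1 := abs_sub_round (w.im / (2 * Real.pi))
    rw [← hk] at h1
    have h2 : |(k:ℝ) * (2 * Real.pi) - w.im| ≤ 4 := by
      have hpi := Real.pi_pos
      have e : (k:ℝ) * (2 * Real.pi) - w.im = -((w.im / (2 * Real.pi) - k) * (2 * Real.pi)) := by
        field_simp; ring
      rw [e, abs_neg, abs_mul, abs_of_pos (by positivity : 0 < 2 * Real.pi)]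
      nlinarith [Real.pi_lt_four]
    refine lt_of_le_of_lt (Complex.norm_le_abs_re_add_abs_im _) ?_
    have e1 : (↑y + ↑k * (2 * ↑Real.pi * Complex.I) - w).re = y - w.re := by simp
    have e2 : (↑y + ↑k * (2 * ↑Real.pi * Complex.I) - w).im = k * (2 * Real.pi) - w.im := by
      simp
    rw [e1, e2]
    linarith
  · have e : Complex.cosh (y + k * (2 * Real.pi * Complex.I)) = Complex.cosh y := by
      unfold Complex.cosh
      rw [neg_add, Complex.exp_add, Complex.exp_add, Complex.exp_int_mul_two_pi_mul_I,
        Complex.exp_neg (k * _), Complex.exp_int_mul_two_pi_mul_I]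
      simp
    rw [e]
    exact_mod_cast congrArg (fun x : ℝ => (x : ℂ)) hn

open Metric in
theorem schottky_aux (M : ℝ) (hM : 1 ≤ M) : ∃ C : ℝ, ∀ (f : ℂ → ℂ) (c : ℂ) (R : ℝ), 0 < R →
    DifferentiableOn ℂ f (ball c R) → (∀ z ∈ ball c R, f z ≠ 0) → (∀ z ∈ ball c R, f z ≠ 1) →
    M⁻¹ ≤ ‖f c‖ → ‖f c‖ ≤ M → ∀ z ∈ ball c (R / 2), ‖f z‖ ≤ C := by
  obtain ⟨K, hK⟩ : ∃ K, K = Real.log M + Real.pi := ⟨_, rfl⟩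
  refine ⟨Real.exp (2 * Real.pi * (Real.exp 960 * (2 * (K + 1))) ^ 2), ?_⟩
  intro f c R hR hd hf0 hf1 hm1 hm2
  have hpi := Real.pi_pos
  have hcR : c ∈ ball c R := mem_ball_self hR
  obtain ⟨G, hGd, hG, hGc⟩ := exists_log_ball hR hd hf0
  have h2pi : (2 * Real.pi * Complex.I : ℂ) ≠ 0 := Complex.two_pi_I_ne_zero
  obtain ⟨g, hgdef⟩ : ∃ g : ℂ → ℂ, g = fun z => G z / (2 * Real.pi * Complex.I) := ⟨_, rfl⟩
  have hgd : DifferentiableOn ℂ g (ball c R) := by rw [hgdef]; exact hGd.div_const _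
  have hgG : ∀ z, g z * (2 * Real.pi * Complex.I) = G z := by
    intro z; rw [hgdef]; field_simp
  have hgn : ∀ z ∈ ball c R, ∀ n : ℕ, g z ≠ n := by
    intro z hz n hn
    apply hf1 z hz
    rw [← hG z hz, ← hgG, hn]
    exact_mod_cast Complex.exp_int_mul_two_pi_mul_I n
  have hgK : ‖g c‖ ≤ K := by
    have h1 : ‖G c‖ ≤ K := by
      rw [hGc]
      refine (Complex.norm_le_abs_re_add_abs_im _).trans ?_
      rw [Complex.log_re, Complex.log_im, hK]
      have hM0 : 0 < M := by linarith
      have hpos : 0 < ‖f c‖ := norm_pos_iff.2 (hf0 c hcR)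
      refine add_le_add ?_ (Complex.abs_arg_le_pi _)
      rw [abs_le]
      constructor
      · rw [← Real.log_inv]; exact Real.log_le_log (by positivity) hm1
      · exact Real.log_le_log hpos hm2
    rw [← hgG, norm_mul] at h1
    have h3 : ‖(2 * Real.pi * Complex.I : ℂ)‖ = 2 * Real.pi := by
      simp [abs_of_pos hpi]
    rw [h3] at h1
    nlinarith [norm_nonneg (g c), Real.pi_gt_three]
  have hK0 : 0 ≤ K := (norm_nonneg _).trans hgK
  obtain ⟨S, hSd, hS, -⟩ := exists_log_ball hR hgd (fun z hz => by simpa using hgn z hz 0)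
  obtain ⟨T, hTd, hT, -⟩ := exists_log_ball (f := fun z => g z - 1) hR (hgd.sub_const 1)
    (fun z hz => sub_ne_zero.2 (by simpa using hgn z hz 1))
  obtain ⟨s, hsdef⟩ : ∃ s : ℂ → ℂ, s = fun z => Complex.exp (S z / 2) := ⟨_, rfl⟩
  obtain ⟨t, htdef⟩ : ∃ s : ℂ → ℂ, s = fun z => Complex.exp (T z / 2) := ⟨_, rfl⟩
  have hsd : DifferentiableOn ℂ s (ball c R) := by rw [hsdef]; exact (hSd.div_const _).cexp
  have htd : DifferentiableOn ℂ t (ball c R) := by rw [htdef]; exact (hTd.div_const _).cexp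
  have hs2 : ∀ z ∈ ball c R, s z ^ 2 = g z := by
    intro z hz
    rw [hsdef, ← hS z hz]
    simp only
    rw [← Complex.exp_nat_mul]; congr 1; push_cast; ring
  have ht2 : ∀ z ∈ ball c R, t z ^ 2 = g z - 1 := by
    intro z hz
    rw [htdef, ← hT z hz]
    simp only
    rw [← Complex.exp_nat_mul]; congr 1; push_cast; ring
  have huv : ∀ z ∈ ball c R, (s z + t z) * (s z - t z) = 1 := by
    intro z hz
    have : (s z + t z) * (s z - t z) = s z ^ 2 - t z ^ 2 := by ring
    rw [this, hs2 z hz, ht2 z hz]; ring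
  obtain ⟨h, hhd, hh, -⟩ := exists_log_ball (f := fun z => s z + t z) hR (hsd.add htd)
    (fun z hz h0 => by have := huv z hz; rw [h0] at this; simp at this)
  have hh' : ∀ z ∈ ball c R, Complex.exp (-h z) = s z - t z := by
    intro z hz
    rw [Complex.exp_neg, hh z hz]
    exact inv_eq_of_mul_eq_one_right (huv z hz)
  have hcosh : ∀ z ∈ ball c R, Complex.cosh (h z) ^ 2 = g z := by
    intro z hz
    rw [Complex.cosh, hh z hz, hh' z hz, ← hs2 z hz]; ring
  have hsc : ‖s c‖ ≤ K + 1 := by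
    have := congrArg norm (hs2 c hcR)
    rw [norm_pow] at this
    nlinarith [norm_nonneg (s c)]
  have htc : ‖t c‖ ≤ K + 1 := by
    have := congrArg norm (ht2 c hcR)
    rw [norm_pow] at this
    have h2 := norm_sub_le (g c) 1
    simp only [norm_one] at h2
    nlinarith [norm_nonneg (t c)]
  have hexp : Real.exp |(h c).re| ≤ 2 * (K + 1) := by
    rcases abs_choice (h c).re with h1 | h1
    · rw [h1, ← Complex.norm_exp, hh c hcR]
      exact (norm_add_le _ _).trans (by linarith)
    · rw [h1, ← Complex.neg_re, ← Complex.norm_exp, hh' c hcR]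
      exact (norm_sub_le _ _).trans (by linarith)
  have hder : ∀ z ∈ ball c (R / 2), ‖deriv h z‖ ≤ 1920 / R := by
    intro z hz
    by_contra hlt
    rw [not_le] at hlt
    have hzR : dist z c < R / 2 := hz
    have hsub : closedBall z (R / 4) ⊆ ball c R := closedBall_subset_ball' (by linarith)
    have hne : deriv h z ≠ 0 := by
      rw [← norm_pos_iff]; exact lt_trans (by positivity) hlt
    obtain ⟨p, hp⟩ := bloch_aux (h := h) (c := z) (R := R / 4) (by linarith)
      (fun w hw => hhd.analyticAt (isOpen_ball.mem_nhds (hsub hw))) hne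
    obtain ⟨v, hv, n, hn⟩ := cosh_net (h p)
    rw [div_lt_iff₀ hR] at hlt
    have hvb : v ∈ ball (h p) (R / 4 * ‖deriv h z‖ / 48) := by
      rw [mem_ball, dist_eq_norm]; linarith
    obtain ⟨w, hw, hwv⟩ := hp hvb
    apply hgn w (hsub hw) n
    rw [← hcosh w (hsub hw), hwv, hn]
  intro z hz
  have hsubR : ball c (R / 2) ⊆ ball c R := ball_subset_ball (by linarith)
  have hzR := hsubR hz
  have hdiff : ‖h z - h c‖ ≤ 960 := by
    have := (convex_ball c (R / 2)).norm_image_sub_le_of_norm_deriv_le (f := h)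
      (fun x hx => hhd.differentiableAt (isOpen_ball.mem_nhds (hsubR hx))) hder
      (mem_ball_self (by linarith)) hz
    have h2 : ‖z - c‖ < R / 2 := by rw [← dist_eq_norm]; exact hz
    calc _ ≤ _ := this
      _ ≤ 1920 / R * (R / 2) := by gcongr
      _ = 960 := by field_simp; norm_num
  have hre : |(h z).re| ≤ 960 + |(h c).re| := by
    have h1 := Complex.abs_re_le_norm (h z - h c)
    rw [Complex.sub_re] at h1
    have h2 := abs_add_le ((h z).re - (h c).re) (h c).re
    rw [sub_add_cancel] at h2
    linarith
  have hch : ‖Complex.cosh (h z)‖ ≤ Real.exp 960 * (2 * (K + 1)) := by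
    have h1 : ‖Complex.cosh (h z)‖ ≤ Real.exp |(h z).re| := by
      rw [Complex.cosh, norm_div]
      have h3 := norm_add_le (Complex.exp (h z)) (Complex.exp (-h z))
      rw [Complex.norm_exp, Complex.norm_exp, Complex.neg_re] at h3
      have h4 := Real.exp_le_exp.2 (le_abs_self (h z).re)
      have h5 := Real.exp_le_exp.2 (neg_le_abs (h z).re)
      simp only [Complex.norm_ofNat]
      linarith
    calc _ ≤ _ := h1
      _ ≤ Real.exp (960 + |(h c).re|) := Real.exp_le_exp.2 hre
      _ = Real.exp 960 * Real.exp |(h c).re| := Real.exp_add _ _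
      _ ≤ _ := by gcongr
  rw [← hG z hzR, Complex.norm_exp]
  apply Real.exp_le_exp.2
  refine (Complex.re_le_norm _).trans ?_
  have h3 : ‖(2 * Real.pi * Complex.I : ℂ)‖ = 2 * Real.pi := by
    simp [abs_of_pos hpi]
  rw [← hgG, norm_mul, h3, ← hcosh z hzR, norm_pow, mul_comm]
  gcongr

open Metric Filter Topology Bornology in
/-- Big Picard at the origin. -/
theorem big_picard_zero {φ : ℂ → ℂ} {a b : ℂ} {ρ : ℝ} (hρ : 0 < ρ)
    (hd : ∀ z, z ≠ 0 → ‖z‖ < ρ → DifferentiableAt ℂ φ z)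
    (hab : a ≠ b) (ha : ∀ z, z ≠ 0 → ‖z‖ < ρ → φ z ≠ a) (hb : ∀ z, z ≠ 0 → ‖z‖ < ρ → φ z ≠ b) :
    (∃ c, Tendsto φ (𝓝[≠] 0) (𝓝 c)) ∨ Tendsto φ (𝓝[≠] 0) (cobounded ℂ) := by
  by_cases hinf : Tendsto φ (𝓝[≠] 0) (cobounded ℂ)
  · exact Or.inr hinf
  left
  have hM : ∃ M : ℝ, ∃ᶠ z in 𝓝[≠] (0:ℂ), φ z ∈ closedBall (0:ℂ) M := by
    by_contra hcon
    push Not at hcon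
    apply hinf
    rw [← tendsto_norm_atTop_iff_cobounded, Filter.tendsto_atTop]
    intro M
    filter_upwards [hcon M] with z hz
    rw [mem_closedBall, dist_zero_right, not_le] at hz
    exact hz.le
  obtain ⟨M, hM⟩ := hM
  obtain ⟨c, -, hc⟩ := (isCompact_closedBall (0:ℂ) M).exists_mapClusterPt_of_frequently hM
  clear hM hinf
  wlog hca : c ≠ a generalizing a b with H
  · push Not at hca
    exact H hab.symm hb ha (by rw [hca]; exact hab)
  -- normalise
  have hba : b - a ≠ 0 := sub_ne_zero.2 hab.symm
  obtain ⟨ψ, hψ⟩ : ∃ ψ : ℂ → ℂ, ψ = fun z => (φ z - a) / (b - a) := ⟨_, rfl⟩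
  have hψd : ∀ z, z ≠ 0 → ‖z‖ < ρ → DifferentiableAt ℂ ψ z := by
    intro z h1 h2; rw [hψ]; exact ((hd z h1 h2).sub_const a).div_const _
  have hψ0 : ∀ z, z ≠ 0 → ‖z‖ < ρ → ψ z ≠ 0 := by
    intro z h1 h2; rw [hψ]; exact div_ne_zero (sub_ne_zero.2 (ha z h1 h2)) hba
  have hψ1 : ∀ z, z ≠ 0 → ‖z‖ < ρ → ψ z ≠ 1 := by
    intro z h1 h2 h3
    rw [hψ] at h3
    simp only at h3
    rw [div_eq_one_iff_eq hba] at h3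
    exact hb z h1 h2 (by simpa using h3)
  obtain ⟨c', hc'⟩ : ∃ c', c' = (c - a) / (b - a) := ⟨_, rfl⟩
  have hc'0 : 0 < ‖c'‖ := by
    rw [norm_pos_iff, hc']; exact div_ne_zero (sub_ne_zero.2 hca) hba
  have hψc : MapClusterPt c' (𝓝[≠] 0) ψ := by
    have : ContinuousAt (fun w : ℂ => (w - a) / (b - a)) c := by fun_prop
    rw [hc', hψ]
    exact hc.continuousAt_comp this
  obtain ⟨N, hN⟩ : ∃ N, N = 1 + 2 * ‖c'‖ + 2 * ‖c'‖⁻¹ := ⟨_, rfl⟩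
  have hN1 : 1 ≤ N := by rw [hN]; have := inv_pos.2 hc'0; linarith
  have hfreq : ∃ᶠ z in 𝓝[≠] (0:ℂ), N⁻¹ ≤ ‖ψ z‖ ∧ ‖ψ z‖ ≤ N := by
    have hinv := inv_pos.2 hc'0
    refine (hψc.frequently (ball_mem_nhds c' (half_pos hc'0))).mono ?_
    intro z hz
    have hz' : ‖ψ z - c'‖ < ‖c'‖ / 2 := by rw [← dist_eq_norm]; exact hz
    have h1 := norm_sub_norm_le c' (ψ z)
    rw [norm_sub_rev] at h1
    have h2 := norm_sub_norm_le (ψ z) c'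
    constructor
    · have : N⁻¹ ≤ ‖c'‖ / 2 := by
        rw [inv_le_comm₀ (by linarith) (by linarith)]
        rw [hN, inv_div, div_eq_mul_inv]; linarith
      linarith
    · linarith
  obtain ⟨C, hC⟩ := schottky_aux N hN1
  have hball : ∀ ε > 0, ∃ z : ℂ, z ≠ 0 ∧ ‖z‖ < ε ∧ ∀ ζ : ℂ, ‖ζ‖ = ‖z‖ → ‖ψ ζ‖ ≤ C := by
    intro ε hε
    have hmem : ball (0:ℂ) (min ε (ρ * Real.exp (-8))) ∈ 𝓝 (0:ℂ) :=
      ball_mem_nhds _ (lt_min hε (by positivity))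
    have h1 := (hfreq.and_eventually ((mem_nhdsWithin_of_mem_nhds hmem :
      _ ∈ 𝓝[≠] (0:ℂ)))).and_eventually self_mem_nhdsWithin
    obtain ⟨z, ⟨⟨hz1, hz2⟩, hz3⟩, hz4⟩ := h1.exists
    have hz0 : z ≠ 0 := hz4
    rw [dist_zero_right, lt_min_iff] at hz3
    refine ⟨z, hz0, hz3.1, ?_⟩
    intro ζ hζ
    have hζ0 : ζ ≠ 0 := by rw [← norm_pos_iff, hζ]; exact norm_pos_iff.2 hz0
    have hin : ∀ w ∈ ball (Complex.log z) 8, ‖Complex.exp w‖ < ρ := by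
      intro w hw
      rw [mem_ball, dist_eq_norm] at hw
      have h2 := (Complex.re_le_norm (w - Complex.log z)).trans_lt hw
      rw [Complex.sub_re, Complex.log_re] at h2
      rw [Complex.norm_exp]
      calc Real.exp w.re < Real.exp (8 + Real.log ‖z‖) := Real.exp_lt_exp.2 (by linarith)
        _ = Real.exp 8 * ‖z‖ := by rw [Real.exp_add, Real.exp_log (norm_pos_iff.2 hz0)]
        _ < Real.exp 8 * (ρ * Real.exp (-8)) := by gcongr; exact hz3.2
        _ = ρ * (Real.exp 8 * Real.exp (-8)) := by ring
        _ = ρ := by rw [← Real.exp_add]; simp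
    have h3 := hC (fun w => ψ (Complex.exp w)) (Complex.log z) 8 (by norm_num)
      (fun w hw => ((hψd _ (Complex.exp_ne_zero w) (hin w hw)).comp w
        Complex.differentiableAt_exp).differentiableWithinAt)
      (fun w hw => hψ0 _ (Complex.exp_ne_zero w) (hin w hw))
      (fun w hw => hψ1 _ (Complex.exp_ne_zero w) (hin w hw))
      (by simpa only [Complex.exp_log hz0] using hz1)
      (by simpa only [Complex.exp_log hz0] using hz2)
    -- the point over ζ
    have hq : ∃ w ∈ ball (Complex.log z) (8 / 2), Complex.exp w = ζ := by
      refine ⟨Complex.log z + Complex.log (ζ / z), ?_, ?_⟩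
      · rw [mem_ball, dist_eq_norm, add_sub_cancel_left]
        refine (Complex.norm_le_abs_re_add_abs_im _).trans_lt ?_
        rw [Complex.log_re, Complex.log_im, norm_div, hζ, div_self (norm_pos_iff.2 hz0).ne']
        have := Complex.abs_arg_le_pi (ζ / z)
        have := Real.pi_lt_four
        simp only [Real.log_one, abs_zero]
        linarith
      · rw [Complex.exp_add, Complex.exp_log hz0, Complex.exp_log (div_ne_zero hζ0 hz0)]
        field_simp
    obtain ⟨w, hw, hwζ⟩ := hq
    have := h3 w hw
    rwa [hwζ] at this
  obtain ⟨z₀, hz₀, hz₀ρ, hz₀C⟩ := hball ρ hρ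
  have hz₀p := norm_pos_iff.2 hz₀
  have hbound : ∀ ζ : ℂ, ζ ≠ 0 → ‖ζ‖ < ‖z₀‖ → ‖ψ ζ‖ ≤ C := by
    intro ζ hζ hζz
    obtain ⟨z₁, hz₁, hz₁ζ, hz₁C⟩ := hball ‖ζ‖ (norm_pos_iff.2 hζ)
    have hz₁p := norm_pos_iff.2 hz₁
    obtain ⟨U, hU⟩ : ∃ U : Set ℂ, U = {w | ‖z₁‖ < ‖w‖ ∧ ‖w‖ < ‖z₀‖} := ⟨_, rfl⟩
    have hUo : IsOpen U := by
      rw [hU]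
      exact (isOpen_lt continuous_const continuous_norm).inter
        (isOpen_lt continuous_norm continuous_const)
    have hcl : closure U ⊆ {w | ‖z₁‖ ≤ ‖w‖ ∧ ‖w‖ ≤ ‖z₀‖} := by
      apply closure_minimal
      · rw [hU]; exact fun w hw => ⟨hw.1.le, hw.2.le⟩
      · exact (isClosed_le continuous_const continuous_norm).inter
          (isClosed_le continuous_norm continuous_const)
    have hdc : DiffContOnCl ℂ ψ U := by
      apply DifferentiableOn.diffContOnCl
      intro w hw
      have := hcl hw
      exact (hψd w (norm_pos_iff.1 (hz₁p.trans_le this.1))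
        (this.2.trans_lt hz₀ρ)).differentiableWithinAt
    have hUb : IsBounded U := by
      refine (isBounded_ball (x := (0:ℂ)) (r := ‖z₀‖)).subset ?_
      rw [hU]; intro w hw; simpa using hw.2
    refine Complex.norm_le_of_forall_mem_frontier_norm_le hUb hdc ?_ (subset_closure ?_)
    · intro w hw
      have h1 := hcl hw.1
      have h2 : w ∉ U := by
        have := hw.2; rwa [hUo.interior_eq] at this
      rcases h1.1.eq_or_lt with h3 | h3
      · exact hz₁C w h3.symm
      · rcases h1.2.eq_or_lt with h4 | h4
        · exact hz₀C w h4
        · exact absurd (by rw [hU]; exact ⟨h3, h4⟩) h2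
    · rw [hU]; exact ⟨hz₁ζ, hζz⟩
  have hev : ∀ᶠ z in 𝓝[≠] (0:ℂ), z ≠ 0 ∧ ‖z‖ < ‖z₀‖ := by
    refine eventually_mem_nhdsWithin.and ?_
    have : ball (0:ℂ) ‖z₀‖ ∈ 𝓝[≠] (0:ℂ) := mem_nhdsWithin_of_mem_nhds (ball_mem_nhds _ hz₀p)
    filter_upwards [this] with z hz
    simpa using hz
  have hlim := Complex.tendsto_limUnder_of_differentiable_on_punctured_nhds_of_bounded_under
    (f := ψ) (c := 0) (by
      filter_upwards [hev] with z hz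
      exact hψd z hz.1 (hz.2.trans hz₀ρ))
    ⟨C + ‖ψ 0‖, by
      rw [eventually_map]
      filter_upwards [hev] with z hz
      exact (norm_sub_le _ _).trans (by linarith [hbound z hz.1 hz.2])⟩
  refine ⟨_, ((hlim.mul_const (b - a)).add_const a).congr ?_⟩
  intro z
  rw [hψ]
  field_simp
  ring

open Filter Topology Bornology in
theorem inv_sub_limit {G : ℂ → ℂ} {l : Filter ℂ}
    (h : (∃ c, Tendsto G l (𝓝 c)) ∨ Tendsto G l (cobounded ℂ)) :
    ∃ e : ℂ, ∀ a, a ≠ e → ∃ k, Tendsto (fun z => (G z - a)⁻¹) l (𝓝 k) := by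
  rcases h with ⟨c, hc⟩ | h
  · exact ⟨c, fun a ha => ⟨_, (hc.sub_const a).inv₀ (sub_ne_zero.2 ha.symm)⟩⟩
  · refine ⟨0, fun a _ => ⟨0, ?_⟩⟩
    have h1 : Tendsto (fun z => G z - a) l (cobounded ℂ) := by
      rw [← tendsto_norm_atTop_iff_cobounded] at h ⊢
      refine tendsto_atTop_mono (fun z => norm_sub_norm_le (G z) a) ?_
      exact tendsto_atTop_add_const_right _ _ h
    exact tendsto_inv₀_cobounded.comp h1

open Metric Filter Topology Bornology in
theorem plane_core (S : Set ℂ) (hS : S.Finite) (G : ℂ → ℂ)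
    (hG : ∀ z, z ∉ S → DifferentiableAt ℂ G z) (O : Set ℂ) (hO : O.Infinite)
    (hom : ∀ z, z ∉ S → G z ∉ O) : ∃ k, ∀ z, z ∉ S → G z = k := by
  obtain ⟨a, ha, b, hb, hab⟩ := hO.nontrivial
  have hloc : ∀ s : ℂ, (∃ c, Tendsto G (𝓝[≠] s) (𝓝 c)) ∨ Tendsto G (𝓝[≠] s) (cobounded ℂ) := by
    intro s
    have hopen : IsOpen (S \ {s})ᶜ := (hS.subset sdiff_subset).isClosed.isOpen_compl
    obtain ⟨ρ, hρ, hsub⟩ := Metric.isOpen_iff.1 hopen s (by simp)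
    have hnot : ∀ z : ℂ, z ≠ 0 → ‖z‖ < ρ → s + z ∉ S := by
      intro z hz hzρ hmem
      exact hsub (show s + z ∈ ball s ρ by simpa using hzρ) ⟨hmem, by simpa using hz⟩
    have key := big_picard_zero (φ := fun z => G (s + z)) (a := a) (b := b) hρ
      (fun z h1 h2 => (hG _ (hnot z h1 h2)).comp z (by fun_prop)) hab
      (fun z h1 h2 h3 => hom _ (hnot z h1 h2) (h3 ▸ ha))
      (fun z h1 h2 h3 => hom _ (hnot z h1 h2) (h3 ▸ hb))
    have hshift : Tendsto (fun z => z - s) (𝓝[≠] s) (𝓝[≠] 0) := by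
      refine tendsto_nhdsWithin_iff.2 ⟨?_, ?_⟩
      · have : ContinuousAt (fun z => z - s) s := by fun_prop
        have h2 := this.tendsto
        rw [sub_self] at h2
        exact h2.mono_left nhdsWithin_le_nhds
      · filter_upwards [self_mem_nhdsWithin] with z hz
        exact sub_ne_zero.2 hz
    refine key.imp (fun ⟨c, hc⟩ => ⟨c, ?_⟩) (fun hc => ?_)
    · simpa [Function.comp_def] using hc.comp hshift
    · simpa [Function.comp_def] using hc.comp hshift
  have hinf : (∃ c, Tendsto G (cobounded ℂ) (𝓝 c)) ∨ Tendsto G (cobounded ℂ) (cobounded ℂ) := by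
    obtain ⟨B, hB⟩ := hS.isBounded.exists_norm_le
    have hB1 : 0 < |B| + 1 := by positivity
    have hnot : ∀ z : ℂ, z ≠ 0 → ‖z‖ < (|B| + 1)⁻¹ → z⁻¹ ∉ S := by
      intro z hz hzρ hmem
      have h1 := hB _ hmem
      rw [norm_inv] at h1
      have h2 := (lt_inv_comm₀ (norm_pos_iff.2 hz) hB1).1 hzρ
      linarith [le_abs_self B]
    have key := big_picard_zero (φ := fun z => G z⁻¹) (a := a) (b := b) (inv_pos.2 hB1)
      (fun z h1 h2 => (hG _ (hnot z h1 h2)).comp z (differentiableAt_inv h1)) hab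
      (fun z h1 h2 h3 => hom _ (hnot z h1 h2) (h3 ▸ ha))
      (fun z h1 h2 h3 => hom _ (hnot z h1 h2) (h3 ▸ hb))
    have hshift : Tendsto (fun z : ℂ => z⁻¹) (cobounded ℂ) (𝓝[≠] 0) := by
      refine tendsto_nhdsWithin_iff.2 ⟨tendsto_inv₀_cobounded, ?_⟩
      filter_upwards [eventually_ne_cobounded (0:ℂ)] with z hz
      exact inv_ne_zero hz
    refine key.imp (fun ⟨c, hc⟩ => ⟨c, ?_⟩) (fun hc => ?_)
    · simpa [Function.comp_def] using hc.comp hshift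
    · simpa [Function.comp_def] using hc.comp hshift
  choose e he using fun s => inv_sub_limit (hloc s)
  obtain ⟨e', he'⟩ := inv_sub_limit hinf
  obtain ⟨d, hd, hde⟩ := (hO.sdiff ((hS.image e).union (finite_singleton e'))).nonempty
  have hdS : ∀ s ∈ S, d ≠ e s := fun s hs h => hde (Or.inl ⟨s, hs, h.symm⟩)
  obtain ⟨k', hk'⟩ := he' d (fun h => hde (Or.inr h))
  have hl : ∀ s, ∃ l, s ∈ S → Tendsto (fun z => (G z - d)⁻¹) (𝓝[≠] s) (𝓝 l) := by
    intro s
    by_cases hs : s ∈ S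
    · obtain ⟨l, hl⟩ := he s d (hdS s hs)
      exact ⟨l, fun _ => hl⟩
    · exact ⟨0, fun h => absurd h hs⟩
  choose l hl using hl
  obtain ⟨H, hH⟩ : ∃ H : ℂ → ℂ, H = fun z => if z ∈ S then l z else (G z - d)⁻¹ := ⟨_, rfl⟩
  have hHS : ∀ z, z ∉ S → H z = (G z - d)⁻¹ := by intro z hz; rw [hH]; simp [hz]
  have hpun : ∀ s : ℂ, ∀ᶠ z in 𝓝[≠] s, z ∉ S := by
    intro s
    have hopen : IsOpen (S \ {s})ᶜ := (hS.subset sdiff_subset).isClosed.isOpen_compl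
    filter_upwards [mem_nhdsWithin_of_mem_nhds (hopen.mem_nhds (show s ∈ (S \ {s})ᶜ by simp)),
      self_mem_nhdsWithin] with z h1 h2 h3
    exact h1 ⟨h3, h2⟩
  have hdiff0 : ∀ z, z ∉ S → DifferentiableAt ℂ H z := by
    intro z hz
    have h1 : DifferentiableAt ℂ (fun z => (G z - d)⁻¹) z :=
      ((hG z hz).sub_const d).inv (sub_ne_zero.2 (fun h => hom z hz (h ▸ hd)))
    refine h1.congr_of_eventuallyEq ?_
    filter_upwards [hS.isClosed.isOpen_compl.mem_nhds hz] with w hw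
    exact hHS w hw
  have hHd : Differentiable ℂ H := by
    intro s
    by_cases hs : s ∈ S
    · refine (Complex.analyticAt_of_differentiable_on_punctured_nhds_of_continuousAt
        ((hpun s).mono hdiff0) ?_).differentiableAt
      rw [continuousAt_iff_punctured_nhds]
      have e1 : H s = l s := by rw [hH]; simp [hs]
      rw [e1]
      refine (hl s hs).congr' ?_
      filter_upwards [hpun s] with z hz
      exact (hHS z hz).symm
    · exact hdiff0 s hs
  have hHt : Tendsto H (cocompact ℂ) (𝓝 k') := by
    rw [← Metric.cobounded_eq_cocompact]
    refine hk'.congr' ?_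
    have : ∀ᶠ z in cobounded ℂ, z ∉ S := hS.isBounded
    filter_upwards [this] with z hz
    exact (hHS z hz).symm
  refine ⟨k'⁻¹ + d, fun z hz => ?_⟩
  have := hHd.apply_eq_of_tendsto_cocompact z hHt
  rw [hHS z hz] at this
  rw [← this, inv_inv]; ring

/-- The Moebius map sending `p` to infinity. -/
noncomputable def mobP (p : ℂ) : OnePoint ℂ → ℂ :=
  fun y => OnePoint.elim y 0 (fun w => (w - p)⁻¹)

theorem mobP_infty (p : ℂ) : mobP p ∞ = 0 := rfl
theorem mobP_coe (p w : ℂ) : mobP p (w : OnePoint ℂ) = (w - p)⁻¹ := rfl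
theorem spDown_coe (w : ℂ) : spDown (w : OnePoint ℂ) = w := rfl
theorem spInv_infty : spInv ∞ = ((0 : ℂ) : OnePoint ℂ) := rfl
theorem spInv_coe (w : ℂ) : spInv (w : OnePoint ℂ) =
    if w = 0 then (∞ : OnePoint ℂ) else ((w⁻¹ : ℂ) : OnePoint ℂ) := rfl

theorem mobP_injOn (p : ℂ) : InjOn (mobP p) {(p : OnePoint ℂ)}ᶜ := by
  intro x hx y hy hxy
  induction x using OnePoint.rec with
  | infty =>
    induction y using OnePoint.rec with
    | infty => rfl
    | coe y =>
      rw [mobP_infty, mobP_coe, eq_comm, inv_eq_zero, sub_eq_zero] at hxy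
      exact absurd (by rw [hxy]; rfl) hy
  | coe x =>
    induction y using OnePoint.rec with
    | infty =>
      rw [mobP_infty, mobP_coe, inv_eq_zero, sub_eq_zero] at hxy
      exact absurd (by rw [hxy]; rfl) hx
    | coe y =>
      rw [mobP_coe, mobP_coe, inv_inj, sub_left_inj] at hxy
      rw [hxy]

open Filter Topology in
theorem mobP_diff {h : ℂ → OnePoint ℂ} {z p : ℂ} (hh : SphHoloAt h z) (hp : h z ≠ p) :
    DifferentiableAt ℂ (fun w => mobP p (h w)) z := by
  obtain ⟨hc, ⟨h1, h2⟩ | ⟨h1, h2⟩⟩ := hh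
  · have hev : ∀ᶠ w in 𝓝 z, h w ≠ ∞ := hc.eventually_ne h1
    have hne : spDown (h z) - p ≠ 0 := by
      intro h0
      rw [sub_eq_zero] at h0
      obtain ⟨y, hy⟩ := OnePoint.ne_infty_iff_exists.1 h1
      rw [← hy, spDown_coe] at h0
      exact hp (by rw [← hy, h0])
    refine ((h2.differentiableAt.sub_const p).inv hne).congr_of_eventuallyEq ?_
    filter_upwards [hev] with w hw
    obtain ⟨y, hy⟩ := OnePoint.ne_infty_iff_exists.1 hw
    simp only [Pi.inv_apply, ← hy, spDown_coe, mobP_coe]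
  · have hev : ∀ᶠ w in 𝓝 z, h w ≠ ((0 : ℂ) : OnePoint ℂ) :=
      hc.eventually_ne (by rw [h1]; exact OnePoint.infty_ne_coe 0)
    have hk0 : spDown (spInv (h z)) = 0 := by rw [h1]; rfl
    have hd : DifferentiableAt ℂ
        (fun w => spDown (spInv (h w)) / (1 - p * spDown (spInv (h w)))) z := by
      refine h2.differentiableAt.fun_div ((h2.differentiableAt.const_mul p).const_sub 1) ?_
      rw [hk0]; simp
    refine hd.congr_of_eventuallyEq ?_
    filter_upwards [hev] with w hw
    generalize h w = x at hw
    induction x using OnePoint.rec with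
    | infty => rw [mobP_infty, spInv_infty, spDown_coe]; simp
    | coe y =>
      have hy : y ≠ 0 := fun h0 => hw (by rw [h0])
      rw [mobP_coe, spInv_coe, if_neg hy, spDown_coe, ← inv_div]
      congr 1
      field_simp

open Filter Topology

/-- **Claim B of the paper, with ambient surfaces `ℂ∞`.** If `A` is a finite subset of the
Riemann sphere and `Y` is a nonempty open connected subset of the Riemann sphere whose
complement is infinite (equivalently, nonempty and indiscrete), then every holomorphic map
`f : ℂ∞ ∖ A → Y` is constant. -/
theorem claim_B (A : Set (OnePoint ℂ)) (hA : A.Finite)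
    (Y : Set (OnePoint ℂ)) (hYo : IsOpen Y) (hYc : IsConnected Y)
    (hYind : (Yᶜ : Set (OnePoint ℂ)).Infinite)
    (f : OnePoint ℂ → OnePoint ℂ)
    (hf : SphHoloOnS f Aᶜ) (hmaps : MapsTo f Aᶜ Y) :
    ∀ z ∈ Aᶜ, ∀ w ∈ Aᶜ, f z = f w := by
  obtain ⟨p', hp'Y, hp'⟩ := (hYind.sdiff (finite_singleton (∞ : OnePoint ℂ))).nonempty
  obtain ⟨p, rfl⟩ := OnePoint.ne_infty_iff_exists.1 (show p' ≠ ∞ from hp')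
  obtain ⟨S, hSdef⟩ : ∃ S : Set ℂ, S = (fun z : ℂ => (z : OnePoint ℂ)) ⁻¹' A := ⟨_, rfl⟩
  have hS : S.Finite := by
    rw [hSdef]; exact hA.preimage (OnePoint.coe_injective.injOn)
  have hSA : ∀ z : ℂ, z ∉ S → (z : OnePoint ℂ) ∈ Aᶜ := by intro z hz; rwa [hSdef] at hz
  have hAS : ∀ z : ℂ, (z : OnePoint ℂ) ∈ Aᶜ → z ∉ S := by intro z hz; rwa [hSdef]
  have hYp : ∀ y ∈ Y, y ∈ ({(p : OnePoint ℂ)}ᶜ : Set (OnePoint ℂ)) := by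
    intro y hy h; rw [h] at hy; exact hp'Y hy
  obtain ⟨k, hk⟩ := plane_core S hS (fun z => mobP p (f z))
    (fun z hz => by
      have h1 := hf _ (hSA z hz)
      have e1 : sphChart (z : OnePoint ℂ) = fun w : ℂ => (w : OnePoint ℂ) := by
        simp [sphChart]
      have e2 : sphChartPt (z : OnePoint ℂ) = z := by simp [sphChartPt, spDown_coe]
      rw [e1, e2] at h1
      exact mobP_diff h1 (hYp _ (hmaps (hSA z hz))))
    (mobP p '' (Yᶜ \ {(p : OnePoint ℂ)}))
    ((hYind.sdiff (finite_singleton _)).image ((mobP_injOn p).mono (fun x hx => hx.2)))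
    (by
      rintro z hz ⟨y, hy, hyz⟩
      have := mobP_injOn p hy.2 (hYp _ (hmaps (hSA z hz))) hyz
      exact hy.1 (this ▸ hmaps (hSA z hz)))
  have hfin : ∀ z w : ℂ, (z : OnePoint ℂ) ∈ Aᶜ → (w : OnePoint ℂ) ∈ Aᶜ → f z = f w := by
    intro z w hz hw
    exact mobP_injOn p (hYp _ (hmaps hz)) (hYp _ (hmaps hw))
      ((hk z (hAS z hz)).trans (hk w (hAS w hw)).symm)
  have hinf : (∞ : OnePoint ℂ) ∈ Aᶜ → ∀ z : ℂ, (z : OnePoint ℂ) ∈ Aᶜ → f ∞ = f z := by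
    intro hi z hz
    have h1 := (hf _ hi).1
    have e1 : sphChart ∞ = fun w : ℂ => spInv (w : OnePoint ℂ) := by simp [sphChart]
    have e2 : sphChartPt ∞ = 0 := by simp [sphChartPt]
    rw [e1, e2] at h1
    have h2 : Tendsto (fun w : ℂ => f (spInv (w : OnePoint ℂ))) (𝓝[≠] 0) (𝓝 (f ∞)) := by
      have h3 := h1.tendsto.mono_left (nhdsWithin_le_nhds (s := {0}ᶜ))
      simpa [spInv_coe] using h3
    have h4 : ∀ᶠ w : ℂ in 𝓝[≠] (0:ℂ), f (spInv (w : OnePoint ℂ)) = f z := by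
      have hev : ∀ᶠ w in Bornology.cobounded ℂ, w ∉ S := hS.isBounded
      have hev2 := (tendsto_inv₀_nhdsNE_zero (α := ℂ)).eventually hev
      filter_upwards [hev2, self_mem_nhdsWithin] with w hw hw0
      rw [spInv_coe, if_neg (show w ≠ 0 from hw0)]
      exact hfin _ _ (hSA _ hw) hz
    exact tendsto_nhds_unique h2 (tendsto_const_nhds.congr' (h4.mono fun w hw => hw.symm))
  intro z hz w hw
  induction z using OnePoint.rec with
  | infty =>
    induction w using OnePoint.rec with
    | infty => rfl
    | coe w => exact hinf hz w hw
  | coe z =>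
    induction w using OnePoint.rec with
    | infty => exact (hinf hw z hz).symm
    | coe w => exact hfin z w hz hw
end

section
/- Every holomorphic map h : ℂ ∖ {0,1} → ℂ ∖ {0,1} is the restriction of a rational function: there exist polynomials P, Q ∈ ℂ[X] with Q not identically zero, such that Q(z) ≠ 0 and h(z) = P(z)/Q(z) for every z ∈ ℂ ∖ {0,1}. -/
open Set

lemma aux_log {f : ℂ → ℂ} {c : ℂ} {r : ℝ} (hr : 0 < r)
    (hf : DifferentiableOn ℂ f (Metric.ball c r)) (h0 : ∀ z ∈ Metric.ball c r, f z ≠ 0) :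
    ∃ g : ℂ → ℂ, DifferentiableOn ℂ g (Metric.ball c r) ∧ g c = Complex.log (f c) ∧
      ∀ z ∈ Metric.ball c r, Complex.exp (g z) = f z := by
  have h1 : DifferentiableOn ℂ (fun z => deriv f z / f z) (Metric.ball c r) :=
    (hf.deriv Metric.isOpen_ball).div hf h0
  obtain ⟨g, hgc, hg⟩ := h1.isExactOn_ball.with_val_at c (Complex.log (f c))
  have hgd : DifferentiableOn ℂ g (Metric.ball c r) :=
    fun z hz => (hg z hz).differentiableAt.differentiableWithinAt
  refine ⟨g, hgd, hgc, fun z hz => ?_⟩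
  have hF : ∀ w ∈ Metric.ball c r, HasDerivAt (fun w => f w * Complex.exp (- g w)) 0 w := by
    intro w hw
    have hfw := (hf.differentiableAt (Metric.isOpen_ball.mem_nhds hw)).hasDerivAt
    have h2 : HasDerivAt (fun w => f w * Complex.exp (- g w)) (deriv f w * Complex.exp (- g w) +
        f w * (Complex.exp (- g w) * (- (deriv f w / f w)))) w := hfw.mul ((hg w hw).neg.cexp)
    have h3 : deriv f w * Complex.exp (- g w) +
        f w * (Complex.exp (- g w) * (- (deriv f w / f w))) = 0 := by
      have := h0 w hw
      field_simp
      ring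
    rwa [h3] at h2
  have hc : c ∈ Metric.ball c r := Metric.mem_ball_self hr
  have hb := (convex_ball c r).norm_image_sub_le_of_norm_hasDerivWithin_le (C := 0)
    (fun w hw => (hF w hw).hasDerivWithinAt) (by simp) hc hz
  simp only [zero_mul, norm_le_zero_iff, sub_eq_zero] at hb
  rw [hgc, Complex.exp_neg (Complex.log _), Complex.exp_log (h0 c hc), mul_inv_cancel₀ (h0 c hc), Complex.exp_neg] at hb
  have := Complex.exp_ne_zero (g z)
  field_simp at hb
  exact hb.symm

lemma aux_bloch {g : ℂ → ℂ} {U : Set ℂ} {c : ℂ} {r : ℝ} (hr : 0 < r) (hU : IsOpen U)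
    (hg : DifferentiableOn ℂ g U) (hsub : Metric.closedBall c r ⊆ U) :
    ∃ w, Metric.ball w (r * ‖deriv g c‖ / 72) ⊆ g '' Metric.closedBall c r := by
  by_cases h0 : deriv g c = 0
  · exact ⟨0, by simp [h0]⟩
  have hg' : DifferentiableOn ℂ (deriv g) U := hg.deriv hU
  obtain ⟨p, hp, hmax⟩ := (isCompact_closedBall c r).exists_isMaxOn
    (f := fun z => ‖deriv g z‖ * (r - dist z c)) ⟨c, by simp [hr.le]⟩
    ((hg'.continuousOn.mono hsub).norm.mul (by fun_prop))
  have hN0 : r * ‖deriv g c‖ ≤ ‖deriv g p‖ * (r - dist p c) := by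
    have := hmax (show c ∈ Metric.closedBall c r by simp [hr.le])
    simp only [dist_self, sub_zero, mem_ofPred_eq] at this
    linarith
  have hpos : 0 < r * ‖deriv g c‖ := mul_pos hr (norm_pos_iff.2 h0)
  have hpc : dist p c ≤ r := hp
  have hA : 0 < ‖deriv g p‖ := by
    by_contra h
    have : ‖deriv g p‖ = 0 := le_antisymm (not_lt.1 h) (norm_nonneg _)
    rw [this] at hN0; linarith
  have ht : 0 < r - dist p c := by
    by_contra h
    nlinarith
  set A := ‖deriv g p‖ with hAdef
  obtain ⟨t, htdef⟩ : ∃ t, t = (r - dist p c) / 2 := ⟨_, rfl⟩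
  have ht0 : 0 < t := by linarith
  have hin : ∀ z ∈ Metric.ball p t, dist z c ≤ r - t := by
    intro z hz
    have := dist_triangle z p c
    have h2 : dist z p < t := hz
    linarith
  have hball : Metric.ball p t ⊆ Metric.closedBall c r := fun z hz => by
    have := hin z hz
    simp only [Metric.mem_closedBall]; linarith
  have hbd : ∀ z ∈ Metric.ball p t, ‖deriv g z‖ ≤ 2 * A := by
    intro z hz
    have h1 : ‖deriv g z‖ * (r - dist z c) ≤ A * (r - dist p c) := hmax (hball hz)
    have h2 := hin z hz
    have h3 : ‖deriv g z‖ * t ≤ ‖deriv g z‖ * (r - dist z c) := by gcongr; linarith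
    have h4 : ‖deriv g z‖ * t ≤ (2 * A) * t := by nlinarith
    exact le_of_mul_le_mul_right h4 ht0
  have hmaps : MapsTo (deriv g) (Metric.ball p t) (Metric.closedBall (deriv g p) (3 * A)) := by
    intro z hz
    rw [mem_closedBall_iff_norm]
    have := norm_sub_le (deriv g z) (deriv g p)
    have := hbd z hz
    linarith
  have hsch : ∀ z ∈ Metric.closedBall p (t/12), ‖deriv g z - deriv g p‖ ≤ A / 4 := by
    intro z hz
    have hz' : dist z p ≤ t / 12 := hz
    have hzb : z ∈ Metric.ball p t := by rw [Metric.mem_ball]; linarith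
    have := Complex.dist_le_div_mul_dist_of_mapsTo_ball (hg'.mono (hball.trans hsub)) hmaps hzb
    rw [dist_eq_norm] at this
    refine this.trans ?_
    calc 3 * A / t * dist z p ≤ 3 * A / t * (t / 12) := by gcongr
      _ = A / 4 := by field_simp; norm_num
  have hcb : Metric.closedBall p (t/12) ⊆ U := fun z hz => hsub (hball (by
    have hz' : dist z p ≤ t / 12 := hz
    rw [Metric.mem_ball]; linarith))
  have hmv : ∀ z ∈ Metric.closedBall p (t/12), ‖(g z - deriv g p * z) - (g p - deriv g p * p)‖ ≤ A / 4 * ‖z - p‖ := by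
    intro z hz
    refine (convex_closedBall p (t/12)).norm_image_sub_le_of_norm_hasDerivWithin_le
      (f := fun z => g z - deriv g p * z) (f' := fun z => deriv g z - deriv g p) ?_ hsch (by simp; linarith) hz
    intro w hw
    have : HasDerivAt (fun z => g z - deriv g p * z) (deriv g w - deriv g p * 1) w :=
      (hg.differentiableAt (hU.mem_nhds (hcb hw))).hasDerivAt.sub ((hasDerivAt_id w).const_mul (deriv g p))
    rw [mul_one] at this
    exact this.hasDerivWithinAt
  have hlow : ∀ z ∈ Metric.sphere p (t/12), (t * A / 16) ≤ ‖g z - g p‖ := by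
    intro z hz
    have h1 := hmv z (Metric.sphere_subset_closedBall hz)
    have hz' : ‖z - p‖ = t / 12 := by simpa [dist_eq_norm] using hz
    have h2 : ‖deriv g p * (z - p)‖ ≤ ‖g z - g p‖ + ‖(g z - deriv g p * z) - (g p - deriv g p * p)‖ := by
      refine le_trans (le_of_eq ?_) (norm_sub_le _ _)
      congr 1; ring
    rw [norm_mul, hz', ← hAdef] at h2
    rw [hz'] at h1
    nlinarith
  have hfreq : ∃ᶠ z in nhds p, g z ≠ g p := by
    intro hev
    have hev' : g =ᶠ[nhds p] fun _ => g p := by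
      filter_upwards [hev] with z hz
      simpa using hz
    have := hev'.deriv_eq
    simp at this
    simp [hAdef, this] at hA
  have hfin := DiffContOnCl.ball_subset_image_closedBall (f := g) (z₀ := p) (r := t/12)
    (DifferentiableOn.diffContOnCl (hg.mono (Metric.closure_ball_subset_closedBall.trans hcb))) (by linarith) hlow hfreq
  refine ⟨g p, (Metric.ball_subset_ball ?_).trans (hfin.trans (image_mono ?_))⟩
  · have : A * (r - dist p c) = 2 * (t * A) := by rw [htdef]; ring
    nlinarith [mul_pos ht0 hA]
  · intro z hz
    apply hball
    have hz' : dist z p ≤ t / 12 := hz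
    rw [Metric.mem_ball]; linarith

lemma aux_net (w : ℂ) : ∃ w' : ℂ, dist w' w ≤ 6 ∧ ∃ n : ℤ, Complex.cosh w' = 2 * n + 1 := by
  -- reduce to nonneg real part
  suffices H : ∀ w : ℂ, 0 ≤ w.re → ∃ w' : ℂ, dist w' w ≤ 6 ∧ ∃ n : ℤ, Complex.cosh w' = 2 * n + 1 by
    rcases le_total 0 w.re with h | h
    · exact H w h
    · obtain ⟨w', h1, n, h2⟩ := H (-w) (by simpa using h)
      refine ⟨-w', ?_, n, by rw [Complex.cosh_neg, h2]⟩
      rw [← dist_neg_neg, neg_neg]; exact h1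
  intro w hw
  set x := w.re with hx
  have hgap : Real.cosh x + 2 ≤ Real.cosh (x + 2) := by
    rw [Real.cosh_add]
    have h1 : 3 ≤ Real.cosh 2 := by
      have := Real.cosh_sq 1
      have h2 : Real.cosh 2 = Real.cosh 1 ^ 2 + Real.sinh 1 ^ 2 := by
        rw [← Real.cosh_two_mul]; norm_num
      have : 1 ≤ Real.sinh 1 := Real.self_le_sinh_iff.2 zero_le_one
      nlinarith
    have h2 := Real.one_le_cosh x
    have h3 : 0 ≤ Real.sinh x := Real.sinh_nonneg_iff.2 hw
    have h4 : 0 ≤ Real.sinh 2 := Real.sinh_nonneg_iff.2 (by norm_num)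
    nlinarith [mul_nonneg h3 h4]
  obtain ⟨n, hn1, hn2⟩ : ∃ n : ℤ, Real.cosh x ≤ 2 * n + 1 ∧ (2 * n + 1 : ℝ) ≤ Real.cosh x + 2 := by
    refine ⟨⌈(Real.cosh x - 1) / 2⌉, ?_, ?_⟩
    · have := Int.le_ceil ((Real.cosh x - 1) / 2); linarith
    · have := Int.ceil_lt_add_one ((Real.cosh x - 1) / 2); linarith
  obtain ⟨t, ht, htn⟩ := intermediate_value_Icc (show x ≤ x + 2 by linarith)
    (Real.continuous_cosh.continuousOn) (show (2 * n + 1 : ℝ) ∈ _ from ⟨hn1, hn2.trans hgap⟩)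
  set m : ℤ := round (w.im / (2 * Real.pi)) with hm
  have hmb := abs_sub_round (w.im / (2 * Real.pi))
  refine ⟨t + m * (2 * Real.pi * Complex.I), ?_, n, ?_⟩
  · rw [dist_eq_norm]
    refine (Complex.norm_le_abs_re_add_abs_im _).trans ?_
    have e1 : ((t + m * (2 * Real.pi * Complex.I) : ℂ) - w).re = t - x := by simp [hx]
    have e2 : ((t + m * (2 * Real.pi * Complex.I) : ℂ) - w).im = m * (2 * Real.pi) - w.im := by simp
    rw [e1, e2]
    have a1 : |t - x| ≤ 2 := by rw [abs_le]; constructor <;> linarith [ht.1, ht.2]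
    have a2 : |m * (2 * Real.pi) - w.im| ≤ Real.pi := by
      have : m * (2 * Real.pi) - w.im = -((w.im / (2 * Real.pi) - m) * (2 * Real.pi)) := by
        field_simp; ring
      rw [this, abs_neg, abs_mul, abs_of_pos Real.two_pi_pos]
      nlinarith [Real.pi_pos]
    linarith [Real.pi_lt_four]
  · have : Complex.cosh (t + m * (2 * Real.pi * Complex.I)) = Complex.cosh t := by
      simp only [Complex.cosh, neg_add]
      rw [Complex.exp_add, Complex.exp_add, Complex.exp_int_mul_two_pi_mul_I, Complex.exp_neg (m * _), Complex.exp_int_mul_two_pi_mul_I]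
      simp
    rw [this, ← Complex.ofReal_cosh, htn]
    push_cast; rfl

lemma aux_landau {v : ℂ → ℂ} {c : ℂ} {R : ℝ} (hR : 0 < R)
    (hv : DifferentiableOn ℂ v (Metric.ball c R))
    (hom : ∀ z ∈ Metric.ball c R, ∀ n : ℤ, Complex.cosh (v z) ≠ 2 * n + 1) :
    ∀ z ∈ Metric.ball c (R / 2), ‖v z - v c‖ ≤ 1008 := by
  intro z hz
  have hder : ∀ w ∈ Metric.ball c (R / 2), ‖deriv v w‖ ≤ 2016 / R := by
    intro w hw
    have hw' : dist w c < R / 2 := hw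
    have hs : Metric.closedBall w (R / 4) ⊆ Metric.ball c R := by
      apply Metric.closedBall_subset_ball'; linarith
    obtain ⟨b, hb⟩ := aux_bloch (by linarith) Metric.isOpen_ball hv hs
    by_contra hcon
    push Not at hcon
    have h7 : 6 < R / 4 * ‖deriv v w‖ / 72 := by
      rw [div_lt_iff₀ hR] at hcon
      linarith
    obtain ⟨w', hw1, n, hn⟩ := aux_net b
    obtain ⟨y, hy, hyw⟩ := hb (show w' ∈ Metric.ball b _ from lt_of_le_of_lt hw1 h7)
    exact hom y (hs hy) n (by rw [hyw, hn])
  have := Convex.norm_image_sub_le_of_norm_deriv_le (f := v) (s := Metric.ball c (R/2)) (x := c) (y := z)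
    (fun x hx => hv.differentiableAt (Metric.isOpen_ball.mem_nhds (Metric.ball_subset_ball (by linarith) hx)))
    hder (convex_ball _ _) (Metric.mem_ball_self (by linarith)) hz
  refine this.trans ?_
  have hz' : ‖z - c‖ ≤ R / 2 := by rw [← dist_eq_norm]; exact (Metric.mem_ball.1 hz).le
  calc 2016 / R * ‖z - c‖ ≤ 2016 / R * (R / 2) := by gcongr
    _ = 1008 := by field_simp; norm_num

lemma aux_normlog (z : ℂ) : ‖Complex.log z‖ ≤ |Real.log ‖z‖| + 4 := by
  refine (Complex.norm_le_abs_re_add_abs_im _).trans ?_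
  rw [Complex.log_re, Complex.log_im]
  linarith [Complex.abs_arg_le_pi z, Real.pi_lt_four]

lemma aux_schottky1 (M : ℝ) : ∃ S : ℝ, ∀ (f : ℂ → ℂ) (c : ℂ) (R : ℝ), 0 < R →
    DifferentiableOn ℂ f (Metric.ball c R) → (∀ z ∈ Metric.ball c R, f z ≠ 0 ∧ f z ≠ 1) →
    1 / 2 ≤ ‖f c‖ → ‖f c‖ ≤ M → ∀ z ∈ Metric.ball c (R / 2), ‖f z‖ ≤ S := by
  set B : ℝ := (M + 1) + 4 with hB
  set B2 : ℝ := 2 * B + 1 + 4 + 1008 with hB2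
  refine ⟨Real.exp (Real.pi * Real.exp B2), fun f c R hR hf hom hlo hhi z hz => ?_⟩
  have hc : c ∈ Metric.ball c R := Metric.mem_ball_self hR
  have hzR : z ∈ Metric.ball c R := Metric.ball_subset_ball (by linarith) hz
  obtain ⟨g, hgd, hgc, hg⟩ := aux_log hR hf.neg (fun z hz => neg_ne_zero.2 (hom z hz).1)
  have hpi : (Real.pi * Complex.I : ℂ) ≠ 0 := by simp [Real.pi_ne_zero]
  set u : ℂ → ℂ := fun z => g z / (Real.pi * Complex.I) with hu
  have hud : DifferentiableOn ℂ u (Metric.ball c R) := hgd.div_const _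
  have hgu : ∀ z, g z = Real.pi * Complex.I * u z := fun z => by
    simp only [hu]; rw [mul_div_cancel₀ _ hpi]
  have huo : ∀ z ∈ Metric.ball c R, ∀ n : ℤ, u z ≠ 2 * n + 1 := by
    intro z hz n hn
    have h1 := hg z hz
    have h2 : g z = n * (2 * Real.pi * Complex.I) + Real.pi * Complex.I := by rw [hgu, hn]; ring
    rw [h2, Complex.exp_add, Complex.exp_int_mul_two_pi_mul_I, Complex.exp_pi_mul_I] at h1
    apply (hom z hz).2
    simp at h1
    exact h1.symm
  have hq : ∀ z ∈ Metric.ball c R, u z ^ 2 - 1 ≠ 0 := by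
    intro z hz h
    have h1 : (u z - 1) * (u z + 1) = 0 := by rw [← h]; ring
    rcases mul_eq_zero.1 h1 with h1 | h1
    · exact huo z hz 0 (by simpa using sub_eq_zero.1 h1)
    · exact huo z hz (-1) (by push_cast; linear_combination h1)
  obtain ⟨g2, hg2d, -, hg2⟩ := aux_log hR ((hud.pow 2).sub_const 1) hq
  set s : ℂ → ℂ := fun z => Complex.exp (g2 z / 2) with hs
  have hsd : DifferentiableOn ℂ s (Metric.ball c R) := (hg2d.div_const 2).cexp
  have hss : ∀ z ∈ Metric.ball c R, s z ^ 2 = u z ^ 2 - 1 := by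
    intro z hz
    have h : Complex.exp (g2 z) = u z ^ 2 - 1 := hg2 z hz
    simp only [hs, ← Complex.exp_nat_mul]
    rw [← h]; congr 1; push_cast; ring
  have hmul : ∀ z ∈ Metric.ball c R, (u z + s z) * (u z - s z) = 1 := by
    intro z hz
    linear_combination - hss z hz
  obtain ⟨v, hvd, hvc, hv⟩ := aux_log hR (hud.add hsd) (fun z hz h => by
    have := hmul z hz
    simp only [Pi.add_apply] at h
    rw [h, zero_mul] at this
    exact zero_ne_one this)
  have hcosh : ∀ z ∈ Metric.ball c R, Complex.cosh (v z) = u z := by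
    intro z hz
    have h1 := hv z hz
    simp only [Pi.add_apply] at h1
    rw [Complex.cosh, Complex.exp_neg, h1, inv_eq_of_mul_eq_one_right (hmul z hz)]
    ring
  have hL := aux_landau hR hvd (fun z hz n => by rw [hcosh z hz]; exact huo z hz n) z hz
  -- bounds at the centre
  have b1 : ‖g c‖ ≤ B := by
    rw [hgc]
    refine (aux_normlog _).trans ?_
    simp only [Pi.neg_apply, norm_neg, hB]
    have hp : 0 < ‖f c‖ := by linarith
    have : |Real.log ‖f c‖| ≤ M + 1 := by
      rw [abs_le]
      constructor
      · have h1 := Real.one_sub_inv_le_log_of_pos hp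
        have h2 : ‖f c‖⁻¹ ≤ 2 := by
          rw [inv_le_comm₀ hp (by norm_num)]; linarith
        linarith
      · have := Real.log_le_sub_one_of_pos hp
        linarith
    linarith
  have b2 : ‖u c‖ ≤ B := by
    simp only [hu, norm_div, norm_mul, Complex.norm_I, mul_one, Complex.norm_real, Real.norm_eq_abs, abs_of_pos Real.pi_pos]
    refine (div_le_self (norm_nonneg _) (by linarith [Real.pi_gt_three])).trans b1
  have hB0 : 0 ≤ B := (norm_nonneg _).trans b1
  have b3 : ‖s c‖ ≤ B + 1 := by
    have h1 : ‖s c‖ ^ 2 ≤ ‖u c‖ ^ 2 + 1 := by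
      rw [← norm_pow, hss c hc]
      refine (norm_sub_le _ _).trans ?_
      simp
    have h2 : ‖s c‖ ^ 2 ≤ (B + 1) ^ 2 := by nlinarith [norm_nonneg (u c)]
    exact le_of_sq_le_sq h2 (by linarith)
  have b4 : ‖u c + s c‖ ≤ 2 * B + 1 := (norm_add_le _ _).trans (by linarith)
  have b5 : ‖u c - s c‖ ≤ 2 * B + 1 := (norm_sub_le _ _).trans (by linarith)
  have b6 : ‖u c + s c‖ * ‖u c - s c‖ = 1 := by rw [← norm_mul, hmul c hc, norm_one]
  have b7 : ‖v c‖ ≤ 2 * B + 1 + 4 := by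
    rw [hvc]
    refine (aux_normlog _).trans ?_
    simp only [Pi.add_apply]
    have hp : 0 < ‖u c + s c‖ := by
      by_contra h
      have : ‖u c + s c‖ = 0 := le_antisymm (not_lt.1 h) (norm_nonneg _)
      rw [this] at b6; simp at b6
    have : |Real.log ‖u c + s c‖| ≤ 2 * B + 1 := by
      rw [abs_le]
      constructor
      · have h1 := Real.one_sub_inv_le_log_of_pos hp
        rw [inv_eq_of_mul_eq_one_right b6] at h1
        linarith
      · have := Real.log_le_sub_one_of_pos hp
        linarith
    linarith
  have b8 : ‖v z‖ ≤ B2 := by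
    have := norm_add_le (v z - v c) (v c)
    rw [sub_add_cancel] at this
    linarith
  have b9 : ‖u z‖ ≤ Real.exp B2 := by
    rw [← hcosh z hzR, Complex.cosh, norm_div]
    have h1 := Complex.norm_exp_le_exp_norm (v z)
    have h2 := Complex.norm_exp_le_exp_norm (-v z)
    rw [norm_neg] at h2
    have h3 := norm_add_le (Complex.exp (v z)) (Complex.exp (-v z))
    have h4 := Real.exp_le_exp.2 b8
    rw [show ‖(2:ℂ)‖ = 2 by simp]
    linarith
  have h1 : ‖f z‖ = ‖Complex.exp (g z)‖ := by rw [hg z hzR]; simp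
  rw [h1]
  refine (Complex.norm_exp_le_exp_norm _).trans (Real.exp_le_exp.2 ?_)
  rw [hgu, norm_mul, norm_mul, Complex.norm_I, mul_one, Complex.norm_real, Real.norm_eq_abs, abs_of_pos Real.pi_pos]
  gcongr

lemma aux_schottky (M : ℝ) : ∃ S : ℝ, ∀ (f : ℂ → ℂ) (c : ℂ) (R : ℝ), 0 < R →
    DifferentiableOn ℂ f (Metric.ball c R) → (∀ z ∈ Metric.ball c R, f z ≠ 0 ∧ f z ≠ 1) →
    ‖f c‖ ≤ M → ∀ z ∈ Metric.ball c (R / 2), ‖f z‖ ≤ S := by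
  obtain ⟨S, hS⟩ := aux_schottky1 (max M 2)
  refine ⟨S + 1, fun f c R hR hf hom hhi z hz => ?_⟩
  by_cases hlo : 1 / 2 ≤ ‖f c‖
  · linarith [hS f c R hR hf hom hlo (hhi.trans (le_max_left _ _)) z hz]
  · have h1 := norm_sub_norm_le (1:ℂ) (f c)
    have h2 := norm_sub_le (1:ℂ) (f c)
    rw [norm_one] at h1 h2
    push Not at hlo
    have := hS (fun z => 1 - f z) c R hR (hf.const_sub 1)
      (fun z hz => ⟨fun h => (hom z hz).2 (sub_eq_zero.1 h).symm, fun h => (hom z hz).1 (by simpa using h)⟩)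
      (by linarith) (le_trans (by linarith) (le_max_right _ _)) z hz
    have h3 := norm_sub_le (1:ℂ) (1 - f z)
    rw [sub_sub_cancel, norm_one] at h3
    linarith

lemma aux_mero_bdd {f : ℂ → ℂ} {s : Set ℂ} {c : ℂ} {C : ℝ} (hs : s ∈ nhds c)
    (hd : DifferentiableOn ℂ f (s \ {c})) (hb : ∀ z ∈ s \ {c}, ‖f z‖ ≤ C) : MeromorphicAt f c := by
  have h := Complex.differentiableOn_update_limUnder_of_bddAbove hs hd
    ⟨C, by rintro _ ⟨z, hz, rfl⟩; exact hb z hz⟩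
  refine (h.analyticAt hs).meromorphicAt.congr ?_
  filter_upwards [self_mem_nhdsWithin] with z hz
  rw [Function.update_of_ne hz]

lemma aux_picard {f : ℂ → ℂ} {δ : ℝ} (hδ : 0 < δ)
    (hd : DifferentiableOn ℂ f (Metric.ball 0 δ \ {0}))
    (hom : ∀ z ∈ Metric.ball (0:ℂ) δ \ {0}, f z ≠ 0 ∧ f z ≠ 1) : MeromorphicAt f 0 := by
  have hopen : IsOpen (Metric.ball (0:ℂ) δ \ {0}) := Metric.isOpen_ball.sdiff isClosed_singleton
  by_cases hcase : ∃ M : ℝ, ∃ᶠ z in nhdsWithin (0:ℂ) {0}ᶜ, ‖f z‖ ≤ M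
  · obtain ⟨M, hM⟩ := hcase
    obtain ⟨S, hS⟩ := aux_schottky M
    have hfind : ∀ ε > 0, ∃ z0 : ℂ, z0 ≠ 0 ∧ ‖z0‖ < ε ∧ ‖f z0‖ ≤ M := by
      intro ε hε
      have := hM.and_eventually (Filter.Eventually.and self_mem_nhdsWithin
        (mem_nhdsWithin_of_mem_nhds (Metric.ball_mem_nhds (0:ℂ) hε)))
      obtain ⟨z, h1, h2, h3⟩ := this.exists
      exact ⟨z, h2, by simpa using h3, h1⟩
    set δ' := δ * Real.exp (-8) with hδ'
    have hδ'0 : 0 < δ' := by positivity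
    have hδδ : δ' ≤ δ := by
      have : Real.exp (-8) ≤ 1 := Real.exp_le_one_iff.2 (by norm_num)
      nlinarith
    have hcirc : ∀ z0 : ℂ, z0 ≠ 0 → ‖z0‖ < δ' → ‖f z0‖ ≤ M → ∀ z : ℂ, ‖z‖ = ‖z0‖ → ‖f z‖ ≤ S := by
      intro z0 h0 h1 h2 z hz
      have hmaps : ∀ w ∈ Metric.ball (0:ℂ) 8, z0 * Complex.exp w ∈ Metric.ball (0:ℂ) δ \ {0} := by
        intro w hw
        refine ⟨?_, by simp [h0]⟩
        rw [mem_ball_zero_iff] at hw ⊢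
        rw [norm_mul]
        have h3 : ‖Complex.exp w‖ ≤ Real.exp 8 :=
          (Complex.norm_exp_le_exp_norm w).trans (Real.exp_le_exp.2 hw.le)
        calc ‖z0‖ * ‖Complex.exp w‖ ≤ ‖z0‖ * Real.exp 8 := by gcongr
          _ < δ' * Real.exp 8 := by gcongr
          _ = δ := by rw [hδ', mul_assoc, ← Real.exp_add]; simp
      have hnz : ‖z / z0‖ = 1 := by rw [norm_div, hz, div_self (norm_ne_zero_iff.2 h0)]
      have hne : z / z0 ≠ 0 := by rw [← norm_ne_zero_iff, hnz]; exact one_ne_zero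
      have := hS (fun w => f (z0 * Complex.exp w)) 0 8 (by norm_num)
        (hd.comp (by fun_prop) hmaps) (fun w hw => hom _ (hmaps w hw)) (by simpa using h2)
        (Complex.log (z / z0)) (by
          rw [mem_ball_zero_iff]
          refine (Complex.norm_le_abs_re_add_abs_im _).trans_lt ?_
          rw [Complex.log_re, Complex.log_im, hnz, Real.log_one, abs_zero]
          linarith [Complex.abs_arg_le_pi (z / z0), Real.pi_lt_four])
      simpa [Complex.exp_log hne, mul_div_cancel₀ _ h0] using this
    obtain ⟨z1, h10, h11, h12⟩ := hfind δ' hδ'0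
    refine aux_mero_bdd (s := Metric.ball 0 ‖z1‖) (C := S) (Metric.ball_mem_nhds _ (norm_pos_iff.2 h10))
      (hd.mono (sdiff_subset_sdiff_left (Metric.ball_subset_ball (h11.le.trans hδδ)))) ?_
    rintro z ⟨hz1, hz2⟩
    rw [mem_ball_zero_iff] at hz1
    have hz2 : z ≠ 0 := hz2
    obtain ⟨z2, h20, h21, h22⟩ := hfind (min ‖z‖ δ') (lt_min (norm_pos_iff.2 hz2) hδ'0)
    have h2z := h21.trans_le (min_le_left _ _)
    have h2d := h21.trans_le (min_le_right _ _)
    set U : Set ℂ := {w | ‖z2‖ < ‖w‖ ∧ ‖w‖ < ‖z1‖} with hU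
    have hcl : closure U ⊆ {w | ‖z2‖ ≤ ‖w‖ ∧ ‖w‖ ≤ ‖z1‖} := by
      apply closure_minimal
      · intro w hw; exact ⟨hw.1.le, hw.2.le⟩
      · exact (isClosed_le continuous_const continuous_norm).inter (isClosed_le continuous_norm continuous_const)
    have hUo : IsOpen U :=
      (isOpen_lt continuous_const continuous_norm).inter (isOpen_lt continuous_norm continuous_const)
    have hUb : Bornology.IsBounded U := Metric.isBounded_ball.subset (s := U) (t := Metric.ball 0 ‖z1‖)
      (fun w hw => by rw [mem_ball_zero_iff]; exact hw.2)
    refine Complex.norm_le_of_forall_mem_frontier_norm_le hUb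
      (DifferentiableOn.diffContOnCl (hd.mono ?_)) ?_ (subset_closure (⟨h2z, hz1⟩ : z ∈ U))
    · intro w hw
      obtain ⟨a, b⟩ := hcl hw
      refine ⟨by rw [mem_ball_zero_iff]; linarith, ?_⟩
      have := norm_pos_iff.2 h20
      exact norm_pos_iff.1 (by linarith : 0 < ‖w‖)
    · intro w hw
      rw [hUo.frontier_eq] at hw
      obtain ⟨a, b⟩ := hcl hw.1
      rcases eq_or_lt_of_le a with a | a
      · exact hcirc z2 h20 h2d h22 w a.symm
      · rcases eq_or_lt_of_le b with b | b
        · exact hcirc z1 h10 h11 h12 w b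
        · exact absurd ⟨a, b⟩ hw.2
  · push Not at hcase
    have h1 := hcase 1
    rw [eventually_nhdsWithin_iff, Metric.eventually_nhds_iff_ball] at h1
    obtain ⟨ε, hε, h1⟩ := h1
    have : MeromorphicAt (fun z => (f z)⁻¹) 0 := by
      refine aux_mero_bdd (s := Metric.ball 0 (min ε δ)) (C := 1) (Metric.ball_mem_nhds _ (lt_min hε hδ)) ?_ ?_
      · refine (hd.mono (sdiff_subset_sdiff_left (Metric.ball_subset_ball (min_le_right _ _)))).inv ?_
        intro z hz
        exact (hom z ⟨Metric.ball_subset_ball (min_le_right _ _) hz.1, hz.2⟩).1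
      · intro z hz
        have := h1 z (Metric.ball_subset_ball (min_le_left _ _) hz.1) hz.2
        rw [norm_inv]
        exact inv_le_one_of_one_le₀ this.le
    simpa using this.fun_inv

lemma aux_poly {g : ℂ → ℂ} (hg : Differentiable ℂ g) {C R0 : ℝ} {k : ℕ}
    (hb : ∀ z : ℂ, R0 ≤ ‖z‖ → ‖g z‖ ≤ C * ‖z‖ ^ k) : ∃ P : Polynomial ℂ, ∀ z, g z = P.eval z := by
  have hz : ∀ n, k < n → iteratedDeriv n g 0 = 0 := by
    intro n hn
    have hlim : Filter.Tendsto (fun R : ℝ => n.factorial * C * (R⁻¹) ^ (n - k)) Filter.atTop (nhds (n.factorial * C * 0 ^ (n - k))) :=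
      (tendsto_inv_atTop_zero.pow _).const_mul _
    rw [zero_pow (by omega), mul_zero] at hlim
    rw [← norm_le_zero_iff]
    refine ge_of_tendsto hlim ?_
    filter_upwards [Filter.eventually_ge_atTop (max R0 1)] with R hR
    have hR0 : 0 < R := lt_of_lt_of_le one_pos ((le_max_right _ _).trans hR)
    have := Complex.norm_iteratedDeriv_le_of_forall_mem_sphere_norm_le (c := 0) n hR0 hg.diffContOnCl (C := C * R ^ k)
      (fun z hz => by
        have hz' : ‖z‖ = R := by simpa using hz
        rw [← hz']; exact hb z (by rw [hz']; exact (le_max_left _ _).trans hR))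
    refine this.trans (le_of_eq ?_)
    obtain ⟨m, rfl⟩ := Nat.exists_eq_add_of_lt hn
    rw [show k + m + 1 - k = m + 1 by omega, show k + m + 1 = k + (m + 1) by omega, pow_add, inv_pow]
    field_simp
  refine ⟨∑ n ∈ Finset.range (k + 1), Polynomial.C ((n.factorial : ℂ)⁻¹ * iteratedDeriv n g 0) * Polynomial.X ^ n, fun z => ?_⟩
  have h := Complex.taylorSeries_eq_of_entire' (c := 0) (z := z) hg
  rw [← h, tsum_eq_sum (s := Finset.range (k + 1))]
  · simp [Polynomial.eval_finsetSum]
  · intro n hn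
    rw [hz n (by simpa using hn)]; simp

theorem holo_selfmap_is_rational (h : ℂ → ℂ)
    (hd : DifferentiableOn ℂ h ({0, 1} : Set ℂ)ᶜ)
    (hm : MapsTo h ({0, 1} : Set ℂ)ᶜ ({0, 1} : Set ℂ)ᶜ) :
    ∃ P Q : Polynomial ℂ, Q ≠ 0 ∧
      ∀ z ∈ ({0, 1} : Set ℂ)ᶜ, Q.eval z ≠ 0 ∧ h z = P.eval z / Q.eval z := by
  have hmem : ∀ z : ℂ, z ∈ ({0, 1} : Set ℂ)ᶜ ↔ z ≠ 0 ∧ z ≠ 1 := fun z => by simp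
  have hom : ∀ z : ℂ, z ≠ 0 → z ≠ 1 → h z ≠ 0 ∧ h z ≠ 1 := fun z h0 h1 =>
    (hmem _).1 (hm ((hmem z).2 ⟨h0, h1⟩))
  have hne1 : ∀ z ∈ Metric.ball (0:ℂ) 1, z ≠ 1 := by
    rintro z hz rfl; simp at hz
  have hopen : IsOpen ({0, 1} : Set ℂ)ᶜ := (Set.toFinite _).isClosed.isOpen_compl
  -- the three punctures
  obtain ⟨a, ha⟩ : MeromorphicAt h 0 := by
    refine aux_picard one_pos (hd.mono ?_) ?_
    · intro z hz; exact (hmem z).2 ⟨hz.2, hne1 z hz.1⟩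
    · intro z hz; exact hom z hz.2 (hne1 z hz.1)
  have h1mero : MeromorphicAt (fun z => h (z + 1)) 0 := by
    have key : ∀ z ∈ Metric.ball (0:ℂ) 1 \ {0}, z + 1 ≠ 0 ∧ z + 1 ≠ 1 := by
      rintro z ⟨hz, hz0⟩
      refine ⟨fun h => ?_, by simpa using hz0⟩
      rw [eq_neg_of_add_eq_zero_left h] at hz
      simp at hz
    refine aux_picard one_pos (hd.comp (by fun_prop) ?_) ?_
    · intro z hz; exact (hmem _).2 (key z hz)
    · intro z hz; exact hom _ (key z hz).1 (key z hz).2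
  obtain ⟨b, hb⟩ := h1mero
  have himero : MeromorphicAt (fun z => h z⁻¹) 0 := by
    have key : ∀ z ∈ Metric.ball (0:ℂ) 1 \ {0}, z⁻¹ ≠ 0 ∧ z⁻¹ ≠ 1 := by
      rintro z ⟨hz, hz0⟩
      exact ⟨inv_ne_zero hz0, fun h => hne1 z hz (inv_eq_one.1 h)⟩
    refine aux_picard one_pos (hd.comp (differentiableOn_inv.mono ?_) ?_) ?_
    · intro z hz; exact hz.2
    · intro z hz; exact (hmem _).2 (key z hz)
    · intro z hz; exact hom _ (key z hz).1 (key z hz).2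
  obtain ⟨k, hk⟩ := himero
  simp only [sub_zero, smul_eq_mul] at ha hb hk
  have hb' : AnalyticAt ℂ (fun z => (z - 1) ^ b * h z) 1 := by
    have h2 : AnalyticAt ℂ (fun z : ℂ => z - 1) 1 := by fun_prop
    have h3 : AnalyticAt ℂ (fun z => z ^ b * h (z + 1)) ((fun z : ℂ => z - 1) 1) := by simpa using hb
    have := AnalyticAt.comp (f := fun z : ℂ => z - 1) (x := 1) h3 h2
    simpa [Function.comp_def] using this
  set g : ℂ → ℂ := fun z => z ^ a * (z - 1) ^ b * h z with hg
  have hgd : Differentiable ℂ g := by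
    intro z
    by_cases h0 : z = 0
    · subst h0
      have : DifferentiableAt ℂ (fun z : ℂ => (z - 1) ^ b * (z ^ a * h z)) 0 :=
        DifferentiableAt.mul (by fun_prop) ha.differentiableAt
      convert this using 1
      ext z; simp only [hg]; ring
    by_cases h1 : z = 1
    · subst h1
      have : DifferentiableAt ℂ (fun z : ℂ => z ^ a * ((z - 1) ^ b * h z)) 1 :=
        DifferentiableAt.mul (by fun_prop) hb'.differentiableAt
      convert this using 1
      ext z; simp only [hg]; ring
    · exact DifferentiableAt.mul (by fun_prop) (hd.differentiableAt (hopen.mem_nhds ((hmem z).2 ⟨h0, h1⟩)))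
  obtain ⟨C, hC⟩ : ∃ C, ∀ᶠ z in nhds (0:ℂ), ‖z ^ k * h z⁻¹‖ ≤ C := by
    refine ⟨_, (hk.continuousAt.norm.eventually (gt_mem_nhds (lt_add_one _))).mono fun z hz => hz.le⟩
  rw [Metric.eventually_nhds_iff_ball] at hC
  obtain ⟨ε, hε, hC⟩ := hC
  have hhb : ∀ z : ℂ, ε⁻¹ + 1 ≤ ‖z‖ → ‖h z‖ ≤ C * ‖z‖ ^ k := by
    intro z hz
    have hp : 0 < ε⁻¹ := inv_pos.2 hε
    have hz0 : 0 < ‖z‖ := by linarith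
    have := hC z⁻¹ (by
      rw [mem_ball_zero_iff, norm_inv, inv_lt_comm₀ hz0 hε]; linarith)
    rw [inv_inv, norm_mul, norm_pow, norm_inv, inv_pow, inv_mul_le_iff₀ (by positivity)] at this
    linarith
  obtain ⟨P, hP⟩ := aux_poly hgd (C := 2 ^ b * C) (R0 := ε⁻¹ + 1) (k := a + b + k) (by
    intro z hz
    have h1 := hhb z hz
    have hz1 : 1 ≤ ‖z‖ := by linarith [inv_pos.2 hε]
    have h2 : ‖z - 1‖ ≤ 2 * ‖z‖ := (norm_sub_le _ _).trans (by rw [norm_one]; linarith)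
    simp only [hg]
    rw [norm_mul, norm_mul, norm_pow, norm_pow]
    calc ‖z‖ ^ a * ‖z - 1‖ ^ b * ‖h z‖ ≤ ‖z‖ ^ a * (2 * ‖z‖) ^ b * (C * ‖z‖ ^ k) := by gcongr
      _ = _ := by rw [mul_pow]; ring)
  refine ⟨P, Polynomial.X ^ a * (Polynomial.X - Polynomial.C 1) ^ b, ?_, ?_⟩
  · exact mul_ne_zero (pow_ne_zero _ Polynomial.X_ne_zero) (pow_ne_zero _ (Polynomial.X_sub_C_ne_zero 1))
  · intro z hz
    obtain ⟨h0, h1⟩ := (hmem z).1 hz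
    have hQ : (Polynomial.X ^ a * (Polynomial.X - Polynomial.C 1) ^ b : Polynomial ℂ).eval z = z ^ a * (z - 1) ^ b := by simp
    have hQ0 : z ^ a * (z - 1) ^ b ≠ 0 := mul_ne_zero (pow_ne_zero _ h0) (pow_ne_zero _ (sub_ne_zero.2 h1))
    rw [hQ, ← hP z]
    exact ⟨hQ0, by simp only [hg]; rw [mul_div_cancel_left₀ _ hQ0]⟩
end
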